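/- arXiv:1005.2863 — 2 statements merged into one kernel-verified Lean document; each statement's English description precedes it below -/
import Mathlib

section
/- F(n) = (1+o(1))·2^{n(n+1)/2−1}; that is, F(n)/2^{n(n+1)/2−1} → 1 as n → ∞. -/
open Filter

noncomputable section

/-- A colored graph on `Fin n`: a simple graph whose edges are partitioned
into red and blue edges. -/
structure ColoredGraph (n : ℕ) where
  red : SimpleGraph (Fin n)
  blue : SimpleGraph (Fin n)
  disj : ∀ x y, ¬ (red.Adj x y ∧ blue.Adj x y)

namespace ColoredGraph

variable {n : ℕ}

/-- The underlying (uncolored) simple graph. -/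
def graph (G : ColoredGraph n) : SimpleGraph (Fin n) := G.red ⊔ G.blue

/-- Adjacency in a colored graph. -/
def Adj (G : ColoredGraph n) (x y : Fin n) : Prop := G.graph.Adj x y

/-- The neighborhood of a vertex. -/
def nbhd (G : ColoredGraph n) (x : Fin n) : Set (Fin n) := {y | G.Adj x y}

/-- `Γ(Q)`, the external neighborhood of a set of vertices. -/
def nbhdSet (G : ColoredGraph n) (Q : Set (Fin n)) : Set (Fin n) :=
  (⋃ x ∈ Q, G.nbhd x) \ Q

/-- The degree of a vertex. -/
def deg (G : ColoredGraph n) (x : Fin n) : ℕ := (G.nbhd x).ncard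

open scoped Classical in
/-- Indicator that the edge `xy` is blue. -/
def blueInd (G : ColoredGraph n) (x y : Fin n) : ℕ := if G.blue.Adj x y then 1 else 0

/-- Odd-blue-triangle-free: no triangle with an odd number of blue edges. -/
def OBTF (G : ColoredGraph n) : Prop :=
  ∀ x y z : Fin n, G.Adj x y → G.Adj y z → G.Adj x z →
    ¬ Odd (G.blueInd x y + G.blueInd y z + G.blueInd x z)

/-- The colored graph induced on the vertex set `A` is blue-bipartite: there is a
partition `U ⊔ (A \ U)` of `A` such that blue edges within `A` cross the partition
and red edges within `A` do not. -/
def BlueBipartiteOn (G : ColoredGraph n) (A : Set (Fin n)) : Prop :=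
  ∃ U ⊆ A, ∀ x ∈ A, ∀ y ∈ A,
    (G.blue.Adj x y → (x ∈ U ↔ y ∉ U)) ∧ (G.red.Adj x y → (x ∈ U ↔ y ∈ U))

/-- Blue-bipartite colored graph. -/
def BlueBipartite (G : ColoredGraph n) : Prop := G.BlueBipartiteOn Set.univ

/-- `κ(G)`: the minimum size of a vertex set whose removal leaves a blue-bipartite graph. -/
def kappa (G : ColoredGraph n) : ℕ :=
  sInf {k | ∃ K : Set (Fin n), K.ncard = k ∧ G.BlueBipartiteOn Kᶜ}

end ColoredGraph

/-- `𝓕(n)`: the set of OBTF colored graphs on `[n]`. -/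
def obtfSet (n : ℕ) : Set (ColoredGraph n) := {G | G.OBTF}

/-- `F(n) = |𝓕(n)|`. -/
def Fnum (n : ℕ) : ℕ := (obtfSet n).ncard

/-- `𝓑(n)`: the set of blue-bipartite colored graphs on `[n]`. -/
def bbSet (n : ℕ) : Set (ColoredGraph n) := {G | G.BlueBipartite}

/-- `|𝓑(n)|`. -/
def Bnum (n : ℕ) : ℕ := (bbSet n).ncard

/-- `b(n) = 2^{n(n+1)/2 - 1}`. -/
def bnum (n : ℕ) : ℕ := 2 ^ (n * (n + 1) / 2 - 1)

namespace OB

section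

open scoped Classical



/-- signs from booleans -/
def sg (b : Bool) : SignType := if b then 1 else -1

/-- signed symmetric matrix coding of an OBTF coloured graph -/
def IsG {V : Type} (w : V → V → SignType) : Prop :=
  (∀ x, w x x = 0) ∧ (∀ x y, w x y = w y x) ∧ ∀ x y z, w x y * w y z * w x z ≠ -1

def FS (n : ℕ) : Finset (Fin n → Fin n → SignType) := Finset.univ.filter IsG

def tw {V : Type} (σ : V → Bool) (w : V → V → SignType) (x y : V) : SignType :=
  sg (σ x) * w x y * sg (σ y)

def Bal {V : Type} (w : V → V → SignType) : Prop :=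
  ∃ σ : V → Bool, ∀ x y, tw σ w x y ≠ -1

def US (n : ℕ) : Finset (Fin n → Fin n → SignType) := (FS n).filter (fun w => ¬ Bal w)

/-- target count -/
def T (n : ℕ) : ℝ := (2 : ℝ) ^ (((n : ℝ) ^ 2 + n) / 2 - 1)

def supp {ι : Type} [Fintype ι] (s : ι → SignType) : Finset ι := Finset.univ.filter (fun i => s i ≠ 0)

def SP (ι : Type) [Fintype ι] (k : ℝ) : Finset (ι → SignType) :=
  Finset.univ.filter (fun s => ((supp s).card : ℝ) ≤ k)

lemma mem_SP {ι : Type} [Fintype ι] {k : ℝ} {s : ι → SignType} :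
    s ∈ SP ι k ↔ ((supp s).card : ℝ) ≤ k := by simp [SP]

lemma card_sign : Fintype.card SignType = 3 := by decide

lemma gen_sum (ι : Type) [Fintype ι] (x : ℝ) :
    ∑ s : ι → SignType, x ^ (supp s).card = (1 + 2 * x) ^ (Fintype.card ι) := by
  have h := Finset.prod_univ_sum (fun _ : ι => (Finset.univ : Finset SignType))
    (fun _ a => if a ≠ 0 then x else (1:ℝ))
  have h1 : ∑ a : SignType, (if a ≠ 0 then x else (1:ℝ)) = 1 + 2 * x := by
    have : (Finset.univ : Finset SignType) = {0, -1, 1} := by decide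
    rw [this]
    rw [Finset.sum_insert (by decide), Finset.sum_insert (by decide), Finset.sum_singleton]
    norm_num
    ring
  rw [h1] at h
  simp only [Finset.prod_const, Finset.card_univ, Fintype.piFinset_univ] at h
  rw [h]
  refine Finset.sum_congr rfl (fun s _ => ?_)
  rw [Finset.prod_ite]
  simp [supp]

lemma sparse_basic (ι : Type) [Fintype ι] (k x : ℝ) (hx : 0 < x) (hx1 : x ≤ 1) :
    ((SP ι k).card : ℝ) * x ^ k ≤ (1 + 2 * x) ^ (Fintype.card ι) := by
  rw [← gen_sum ι x, ← nsmul_eq_mul, ← Finset.sum_const]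
  calc ∑ _s ∈ SP ι k, x ^ k ≤ ∑ s ∈ SP ι k, x ^ (supp s).card := by
        refine Finset.sum_le_sum (fun s hs => ?_)
        rw [← Real.rpow_natCast]
        refine Real.rpow_le_rpow_of_exponent_ge hx hx1 ?_
        simpa [SP] using hs
    _ ≤ _ := Finset.sum_le_sum_of_subset_of_nonneg (Finset.subset_univ _)
        (fun _ _ _ => by positivity)

lemma sparse (η : ℝ) (hη : 0 < η) : ∃ δ : ℝ, 0 < δ ∧ ∀ (ι : Type) [Fintype ι] (N k : ℝ),
    (Fintype.card ι : ℝ) ≤ N → k ≤ δ * N → ((SP ι k).card : ℝ) ≤ 2 ^ (η * N) := by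
  obtain ⟨q, hq0, hq⟩ : ∃ q : ℝ, 1 ≤ q ∧ (1 + 2 * (2:ℝ) ^ (-q)) ≤ 2 ^ (η / 2) := by
    have h1 : Tendsto (fun q : ℝ => 1 + 2 * (2:ℝ) ^ (-q)) atTop (nhds (1 + 2 * 0)) := by
      refine Tendsto.const_add _ (Tendsto.const_mul _ ?_)
      have := tendsto_rpow_atTop_of_base_lt_one (1/2 : ℝ) (by norm_num) (by norm_num)
      refine this.congr (fun q => ?_)
      rw [Real.rpow_neg (by norm_num), one_div, Real.inv_rpow (by norm_num)]
    have h2 : (1 + 2 * 0 : ℝ) < 2 ^ (η / 2) := by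
      have := Real.one_lt_rpow (x := 2) (by norm_num) (half_pos hη)
      linarith
    obtain ⟨q, hq⟩ := ((h1.eventually (gt_mem_nhds h2)).and (eventually_ge_atTop 1)).exists
    exact ⟨q, hq.2, hq.1.le⟩
  refine ⟨η / (2 * q), by positivity, fun ι _ N k hN hk => ?_⟩
  have hx : (0:ℝ) < 2 ^ (-q) := by positivity
  have hx1 : (2:ℝ) ^ (-q) ≤ 1 := Real.rpow_le_one_of_one_le_of_nonpos (by norm_num) (by linarith)
  have h := sparse_basic ι k _ hx hx1
  have h3 : (1 + 2 * (2:ℝ) ^ (-q)) ^ (Fintype.card ι) ≤ 2 ^ (η / 2 * N) := by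
    calc (1 + 2 * (2:ℝ) ^ (-q)) ^ (Fintype.card ι) ≤ (2 ^ (η / 2)) ^ (Fintype.card ι) := by
          gcongr
      _ = (2:ℝ) ^ (η / 2 * Fintype.card ι) := by
          rw [Real.rpow_mul (by norm_num), Real.rpow_natCast]
      _ ≤ _ := Real.rpow_le_rpow_of_exponent_le (by norm_num) (by gcongr)
  have h4 : (((2:ℝ) ^ (-q)) ^ k) = 2 ^ (-(q * k)) := by
    rw [← Real.rpow_mul (by norm_num)]; ring_nf
  rw [h4, Real.rpow_neg (by norm_num), mul_inv_le_iff₀ (by positivity)] at h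
  calc ((SP ι k).card : ℝ) ≤ 2 ^ (η / 2 * N) * 2 ^ (q * k) := h.trans (by gcongr)
    _ = 2 ^ (η / 2 * N + q * k) := by rw [Real.rpow_add (by norm_num)]
    _ ≤ _ := by
        refine Real.rpow_le_rpow_of_exponent_le (by norm_num) ?_
        have : q * k ≤ q * (η / (2 * q) * N) := by gcongr
        have h5 : q * (η / (2 * q) * N) = η / 2 * N := by field_simp
        linarith

/-- counting functions with few choices -/
lemma pi_card_le {V α : Type} [Fintype V] (P : V → Finset α) (Z : Finset V)
    (h2 : ∀ x, (P x).card ≤ 2) (h1 : ∀ x ∈ Z, (P x).card ≤ 1) :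
    ((Fintype.piFinset P).card : ℝ) ≤ 2 ^ ((Fintype.card V : ℝ) - Z.card) := by
  rw [Fintype.card_piFinset]
  have : ∏ x, (P x).card ≤ ∏ x, (if x ∈ Z then 1 else 2) := by
    refine Finset.prod_le_prod' (fun x _ => ?_)
    split_ifs with h
    · exact h1 x h
    · exact h2 x
  rw [Finset.prod_ite] at this
  simp only [Finset.prod_const, one_pow, one_mul] at this
  have h3 : (Finset.univ.filter (fun x => x ∉ Z)).card = Fintype.card V - Z.card := by
    rw [← Finset.card_compl]; congr 1; ext; simp
  rw [h3] at this
  have h4 : ((Fintype.card V - Z.card : ℕ) : ℝ) = (Fintype.card V : ℝ) - Z.card :=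
    Nat.cast_sub (Finset.card_le_univ Z)
  rw [← h4, Real.rpow_natCast]
  exact_mod_cast this

end

end OB

namespace OB

section

open scoped Classical



variable {V : Type} [Fintype V]

def Ext (w : V → V → SignType) (s : V → SignType) : Prop := ∀ x y, s x * w x y * s y ≠ -1

def killed (w : V → V → SignType) (f : V → SignType) : Finset (V × SignType) :=
  Finset.univ.filter (fun p => ∃ x, f x * w x p.1 * p.2 = -1)

def nb (w : V → V → SignType) (x : V) (e : SignType) : Finset (V × SignType) :=
  Finset.univ.filter (fun p => e * w x p.1 * p.2 = -1)

def cont (w : V → V → SignType) (d : ℕ) (f : V → SignType) (x : V) : Finset SignType :=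
  Finset.univ.filter (fun e => e ≠ 0 ∧ (x, e) ∉ killed w f ∧ (nb w x e \ killed w f).card < d)

lemma killed_card (w : V → V → SignType) (f : V → SignType) :
    (killed w f).card ≤ 2 * Fintype.card V := by
  have : killed w f ⊆ (Finset.univ : Finset V) ×ˢ ({1, -1} : Finset SignType) := by
    rintro ⟨y, e⟩ h
    simp only [killed, Finset.mem_filter, Finset.mem_univ, true_and] at h
    obtain ⟨x, hx⟩ := h
    simp only [Finset.mem_product, Finset.mem_univ, true_and]
    generalize f x = a at hx
    generalize w x y = b at hx
    revert a b e; decide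
  refine (Finset.card_le_card this).trans ?_
  rw [Finset.card_product, show ({1, -1} : Finset SignType).card = 2 by decide, Finset.card_univ,
    mul_comm]

lemma exists_fingerprint (w : V → V → SignType) (d : ℕ) (hd : 0 < d) (s : V → SignType)
    (hs : Ext w s) :
    ∃ f : V → SignType, d * (supp f).card ≤ 2 * Fintype.card V ∧
      ∀ x, s x = 0 ∨ s x ∈ cont w d f x := by
  let C : Finset (V → SignType) := Finset.univ.filter
    (fun f => (∀ x, f x = 0 ∨ f x = s x) ∧ d * (supp f).card ≤ (killed w f).card)
  have hC : C.Nonempty := ⟨fun _ => 0, by simp [C, supp]⟩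
  obtain ⟨f, hf, hmax⟩ := Finset.exists_max_image C (fun f => (supp f).card) hC
  simp only [C, Finset.mem_filter, Finset.mem_univ, true_and] at hf
  obtain ⟨hfs, hfd⟩ := hf
  refine ⟨f, hfd.trans (killed_card w f), fun x => ?_⟩
  by_cases hx : s x = 0
  · exact Or.inl hx
  right
  simp only [cont, Finset.mem_filter, Finset.mem_univ, true_and]
  refine ⟨hx, ?_, ?_⟩
  · simp only [killed, Finset.mem_filter, Finset.mem_univ, true_and, not_exists]
    intro z
    rcases hfs z with h | h
    · rw [h]; generalize w z x = a; generalize s x = b; revert a b; decide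
    · rw [h]; exact hs z x
  · by_contra hcon
    push Not at hcon
    have hfx : f x = 0 := by
      by_contra hne
      have hfx : f x = s x := (hfs x).resolve_left hne
      have : nb w x (s x) \ killed w f = ∅ := by
        rw [Finset.sdiff_eq_empty_iff_subset]
        intro p hp
        simp only [nb, killed, Finset.mem_filter, Finset.mem_univ, true_and] at hp ⊢
        exact ⟨x, by rw [hfx]; exact hp⟩
      rw [this] at hcon
      simp at hcon
      omega
    let g := Function.update f x (s x)
    have hgx : g x = s x := by simp [g]
    have hgy : ∀ y, y ≠ x → g y = f y := fun y hy => by simp [g, hy]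
    have hsup : supp g = insert x (supp f) := by
      ext y
      by_cases hy : y = x
      · subst hy; simp [supp, hgx, hx]
      · simp [supp, hgy y hy, hy]
    have hcard : (supp g).card = (supp f).card + 1 := by
      rw [hsup, Finset.card_insert_of_notMem (by simp [supp, hfx])]
    have hk : killed w f ∪ (nb w x (s x) \ killed w f) ⊆ killed w g := by
      intro p hp
      simp only [nb, killed, Finset.mem_filter, Finset.mem_univ, true_and, Finset.mem_union,
        Finset.mem_sdiff] at hp ⊢
      rcases hp with ⟨z, hz⟩ | ⟨hp, _⟩
      · refine ⟨z, ?_⟩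
        have : z ≠ x := by
          rintro rfl
          rw [hfx] at hz
          generalize w z p.1 = a at hz
          generalize p.2 = b at hz
          revert a b; decide
        rw [hgy z this]; exact hz
      · exact ⟨x, by rw [hgx]; exact hp⟩
    have hk2 := Finset.card_le_card hk
    rw [Finset.card_union_of_disjoint Finset.disjoint_sdiff] at hk2
    have hgC : g ∈ C := by
      simp only [C, Finset.mem_filter, Finset.mem_univ, true_and]
      refine ⟨fun y => ?_, ?_⟩
      · by_cases hy : y = x
        · subst hy; exact Or.inr hgx
        · rw [hgy y hy]; exact hfs y
      · rw [hcard, mul_add, mul_one]; omega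
    have := hmax g hgC
    omega

def lev (w : V → V → SignType) (d : ℕ) (f : V → SignType) (j : ℕ) : Finset V :=
  Finset.univ.filter (fun x => (cont w d f x).card = j)

lemma cont_card_le (w : V → V → SignType) (d : ℕ) (f : V → SignType) (x : V) :
    (cont w d f x).card ≤ 2 := by
  have : cont w d f x ⊆ {1, -1} := by
    intro e he
    simp only [cont, Finset.mem_filter] at he
    have := he.2.1
    clear he
    revert e; decide
  exact (Finset.card_le_card this).trans (by decide)

/-- extension vectors within the container -/
def inCont (w : V → V → SignType) (d : ℕ) (f : V → SignType) : Finset (V → SignType) :=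
  Fintype.piFinset (fun x => insert 0 (cont w d f x))

lemma three_le : (3:ℝ) ≤ 2 ^ (1.6:ℝ) := by
  have h : ((2:ℝ) ^ (1.6:ℝ)) ^ 5 = 256 := by
    rw [← Real.rpow_natCast, ← Real.rpow_mul (by norm_num)]
    norm_num
  by_contra hc
  push Not at hc
  have : ((2:ℝ) ^ (1.6:ℝ)) ^ 5 < 3 ^ 5 := by gcongr
  rw [h] at this
  norm_num at this

lemma inCont_card (w : V → V → SignType) (d : ℕ) (f : V → SignType) :
    ((inCont w d f).card : ℝ) ≤
      2 ^ ((Fintype.card V : ℝ) - (lev w d f 0).card + 0.6 * (lev w d f 2).card) := by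
  have h0 : ∀ x, ((insert 0 (cont w d f x)).card : ℝ) ≤
      2 ^ ((1:ℝ) - (if (cont w d f x).card = 0 then 1 else 0)
        + 0.6 * (if (cont w d f x).card = 2 then 1 else 0)) := by
    intro x
    have hc := Finset.card_insert_le (0:SignType) (cont w d f x)
    have h2 := cont_card_le w d f x
    have hc' : ((insert 0 (cont w d f x)).card : ℝ) ≤ (cont w d f x).card + 1 := by exact_mod_cast hc
    refine hc'.trans ?_
    interval_cases (cont w d f x).card
    · norm_num
    · norm_num
    · have := three_le
      norm_num at this ⊢
      exact this
  rw [inCont, Fintype.card_piFinset]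
  push_cast
  calc ∏ x, ((insert 0 (cont w d f x)).card : ℝ) ≤ ∏ x, (2:ℝ) ^ ((1:ℝ) -
        (if (cont w d f x).card = 0 then 1 else 0)
        + 0.6 * (if (cont w d f x).card = 2 then 1 else 0)) :=
        Finset.prod_le_prod (fun _ _ => by positivity) (fun x _ => h0 x)
    _ = _ := by
        rw [← Real.rpow_sum_of_pos (by norm_num)]
        congr 1
        rw [Finset.sum_add_distrib, Finset.sum_sub_distrib, ← Finset.mul_sum]
        simp [lev]

lemma lev_two_mem {w : V → V → SignType} {d : ℕ} {f : V → SignType} {x : V}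
    (hx : x ∈ lev w d f 2) (e : SignType) (he : e ≠ 0) : e ∈ cont w d f x := by
  have hsub : cont w d f x ⊆ {1, -1} := by
    intro e he
    simp only [cont, Finset.mem_filter] at he
    have := he.2.1
    clear he
    revert e; decide
  have : cont w d f x = {1, -1} := by
    refine Finset.eq_of_subset_of_card_le hsub ?_
    simp only [lev, Finset.mem_filter] at hx
    rw [hx.2]; decide
  rw [this]
  revert e; decide

lemma lev_two_nbr {w : V → V → SignType} {d : ℕ} {f : V → SignType} {x : V}
    (hx : x ∈ lev w d f 2) :
    (Finset.univ.filter (fun y => w x y ≠ 0 ∧ y ∉ lev w d f 0)).card ≤ 2 * d := by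
  have hsub : Finset.univ.filter (fun y => w x y ≠ 0 ∧ y ∉ lev w d f 0) ⊆
      (nb w x 1 \ killed w f).image Prod.fst ∪ (nb w x (-1) \ killed w f).image Prod.fst := by
    intro y hy
    simp only [Finset.mem_filter, Finset.mem_univ, true_and, lev, Finset.card_eq_zero] at hy
    obtain ⟨hw, hy⟩ := hy
    obtain ⟨e, he⟩ := Finset.nonempty_iff_ne_empty.mpr hy
    simp only [cont, Finset.mem_filter, Finset.mem_univ, true_and] at he
    obtain ⟨he0, hek, -⟩ := he
    simp only [Finset.mem_union, Finset.mem_image, Finset.mem_sdiff, Prod.exists,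
      exists_and_right, exists_eq_right]
    have : (1 * w x y * e = -1) ∨ (-1 * w x y * e = -1) := by
      clear hek
      generalize w x y = a at hw
      revert a e; decide
    rcases this with h | h
    · exact Or.inl ⟨e, by simpa [nb] using h, hek⟩
    · exact Or.inr ⟨e, by simpa [nb] using h, hek⟩
  have h1 : (nb w x 1 \ killed w f).card < d := by
    have := lev_two_mem hx 1 (by decide)
    simp only [cont, Finset.mem_filter] at this
    exact this.2.2.2
  have h2 : (nb w x (-1) \ killed w f).card < d := by
    have := lev_two_mem hx (-1) (by decide)
    simp only [cont, Finset.mem_filter] at this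
    exact this.2.2.2
  have h3 := Finset.card_le_card hsub
  have h4 := Finset.card_union_le ((nb w x 1 \ killed w f).image Prod.fst)
    ((nb w x (-1) \ killed w f).image Prod.fst)
  have h5 : ((nb w x 1 \ killed w f).image Prod.fst).card ≤ _ := Finset.card_image_le
  have h6 : ((nb w x (-1) \ killed w f).image Prod.fst).card ≤ _ := Finset.card_image_le
  omega

/-- number of violating ordered pairs -/
def viol (w : V → V → SignType) (σ : V → Bool) : ℕ :=
  ∑ x, (Finset.univ.filter (fun y => tw σ w x y = -1)).card

lemma near_section (w : V → V → SignType) (d : ℕ) (f : V → SignType)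
    (h2 : lev w d f 2 = ∅) :
    ∃ σ : V → Bool, (∀ x, ∀ e ∈ cont w d f x, e = sg (σ x)) ∧
      viol w σ ≤ Fintype.card V * (d + 2 * (lev w d f 0).card) := by
  let σ : V → Bool := fun x => decide ((1:SignType) ∈ cont w d f x)
  have hσ : ∀ x, ∀ e ∈ cont w d f x, e = sg (σ x) := by
    intro x e he
    have hx : x ∉ lev w d f 2 := by rw [h2]; simp
    simp only [lev, Finset.mem_filter, Finset.mem_univ, true_and] at hx
    have hle : (cont w d f x).card ≤ 1 := by
      have := cont_card_le w d f x; omega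
    rw [Finset.card_le_one] at hle
    by_cases h1 : (1:SignType) ∈ cont w d f x
    · have := hle e he 1 h1
      simp [σ, h1, sg, this]
    · have he0 : e ≠ 0 := by
        simp only [cont, Finset.mem_filter] at he; exact he.2.1
      have he1 : e ≠ 1 := by rintro rfl; exact h1 he
      simp only [σ, h1, decide_false, sg]
      clear he
      revert e; decide
  refine ⟨σ, hσ, ?_⟩
  have hx : ∀ x, (Finset.univ.filter (fun y => tw σ w x y = -1)).card ≤
      (d + (lev w d f 0).card) + if x ∈ lev w d f 0 then Fintype.card V else 0 := by
    intro x
    split_ifs with hx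
    · exact (Finset.card_le_univ _).trans (by omega)
    · have hne : (cont w d f x).Nonempty := by
        simpa [lev, Finset.nonempty_iff_ne_empty] using hx
      obtain ⟨e, he⟩ := hne
      have hee := hσ x e he
      have hs : Finset.univ.filter (fun y => tw σ w x y = -1) ⊆
          lev w d f 0 ∪ (nb w x e \ killed w f).image Prod.fst := by
        intro y hy
        by_cases hy0 : y ∈ lev w d f 0
        · exact Finset.mem_union_left _ hy0
        refine Finset.mem_union_right _ ?_
        have hne : (cont w d f y).Nonempty := by
          simpa [lev, Finset.nonempty_iff_ne_empty] using hy0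
        obtain ⟨e', he'⟩ := hne
        have hee' := hσ y e' he'
        have hy := (Finset.mem_filter.mp hy).2
        rw [tw, ← hee, ← hee'] at hy
        simp only [cont, Finset.mem_filter] at he'
        refine Finset.mem_image.mpr ⟨(y, e'), ?_, rfl⟩
        rw [Finset.mem_sdiff]
        exact ⟨by simpa [nb] using hy, he'.2.2.1⟩
      have h3 := Finset.card_le_card hs
      have h4 := Finset.card_union_le (lev w d f 0) ((nb w x e \ killed w f).image Prod.fst)
      have h5 : ((nb w x e \ killed w f).image Prod.fst).card ≤ _ := Finset.card_image_le
      simp only [cont, Finset.mem_filter] at he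
      have := he.2.2.2
      omega
  calc viol w σ ≤ ∑ x, ((d + (lev w d f 0).card) +
        if x ∈ lev w d f 0 then Fintype.card V else 0) := Finset.sum_le_sum (fun x _ => hx x)
    _ = _ := by
        rw [Finset.sum_add_distrib]
        simp [Finset.sum_ite_mem]
        ring

end

end OB

namespace OB

section

open scoped Classical



variable {V : Type} [Fintype V]

def pos (w : V → V → SignType) (σ : V → Bool) (x : V) : Finset V :=
  Finset.univ.filter (fun y => tw σ w x y = 1)

def neg (w : V → V → SignType) (σ : V → Bool) (x : V) : Finset V :=
  Finset.univ.filter (fun y => tw σ w x y = -1)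

def dg (w : V → V → SignType) (x : V) : ℕ := (Finset.univ.filter (fun y => w x y ≠ 0)).card

lemma dg_eq (w : V → V → SignType) (σ : V → Bool) (x : V) :
    dg w x = (pos w σ x).card + (neg w σ x).card := by
  rw [← Finset.card_union_of_disjoint]
  · rw [dg]
    congr 1
    ext y
    simp only [pos, neg, Finset.mem_filter, Finset.mem_univ, true_and, Finset.mem_union]
    rw [tw]
    generalize w x y = a; generalize σ x = b; generalize σ y = c
    revert a b c; decide
  · rw [Finset.disjoint_left]
    intro y h1 h2
    have h1 := (Finset.mem_filter.mp h1).2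
    have h2 := (Finset.mem_filter.mp h2).2
    rw [h1] at h2
    revert h2; decide

lemma viol_int (w : V → V → SignType) (σ : V → Bool) :
    (viol w σ : ℤ) = ∑ u, ∑ v, if tw σ w u v = -1 then (1:ℤ) else 0 := by
  rw [viol]
  push_cast
  refine Finset.sum_congr rfl (fun u _ => ?_)
  rw [Finset.sum_boole]

lemma viol_flip (w : V → V → SignType) (h0 : ∀ x, w x x = 0) (hs : ∀ x y, w x y = w y x)
    (σ : V → Bool) (x : V) :
    (viol w (Function.update σ x (!σ x)) : ℤ) =
      viol w σ + 2 * ((pos w σ x).card - (neg w σ x).card) := by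
  set τ := Function.update σ x (!σ x) with hτ
  have hx : τ x = !σ x := by simp [hτ]
  have hy : ∀ y, y ≠ x → τ y = σ y := fun y h => by simp [hτ, h]
  have key : ∀ u v, (if tw τ w u v = -1 then (1:ℤ) else 0) = (if tw σ w u v = -1 then (1:ℤ) else 0)
      + (if u = x then ((if tw σ w u v = 1 then (1:ℤ) else 0)
        - (if tw σ w u v = -1 then (1:ℤ) else 0)) else 0)
      + (if v = x then ((if tw σ w u v = 1 then (1:ℤ) else 0)
        - (if tw σ w u v = -1 then (1:ℤ) else 0)) else 0) := by
    intro u v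
    by_cases hu : u = x
    · by_cases hv : v = x
      · subst hu; subst hv
        have e1 : tw τ w v v = 0 := by simp [tw, h0]
        have e2 : tw σ w v v = 0 := by simp [tw, h0]
        rw [e1, e2]; simp
      · subst hu
        have e : tw τ w u v = - tw σ w u v := by
          rw [tw, tw, hx, hy v hv]
          generalize σ u = a; generalize σ v = b; generalize w u v = c
          revert a b c; decide
        rw [e]
        simp only [hv, if_true, if_false]
        generalize tw σ w u v = c
        revert c; decide
    · by_cases hv : v = x
      · subst hv
        have e : tw τ w u v = - tw σ w u v := by
          rw [tw, tw, hx, hy u hu]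
          generalize σ u = a; generalize σ v = b; generalize w u v = c
          revert a b c; decide
        rw [e]
        simp only [hu, if_true, if_false]
        generalize tw σ w u v = c
        revert c; decide
      · have e : tw τ w u v = tw σ w u v := by
          rw [tw, tw, hy u hu, hy v hv]
        rw [e]
        simp [hu, hv]
  have hsym : ∀ u v, tw σ w u v = tw σ w v u := by
    intro u v
    simp only [tw]; rw [hs u v]
    generalize σ u = a; generalize σ v = b; generalize w v u = c
    revert a b c; decide
  rw [viol_int, viol_int]
  simp_rw [key, Finset.sum_add_distrib]
  have e1 : ∑ u, ∑ v, (if u = x then ((if tw σ w u v = 1 then (1:ℤ) else 0)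
        - (if tw σ w u v = -1 then (1:ℤ) else 0)) else 0) =
      (pos w σ x).card - (neg w σ x).card := by
    rw [Finset.sum_comm]
    simp [pos, neg]
  have e2 : ∑ u, ∑ v, (if v = x then ((if tw σ w u v = 1 then (1:ℤ) else 0)
        - (if tw σ w u v = -1 then (1:ℤ) else 0)) else 0) =
      (pos w σ x).card - (neg w σ x).card := by
    simp only [pos, neg, Finset.sum_ite_eq', Finset.mem_univ, if_true]
    simp_rw [fun u => hsym u x]
    simp
  rw [e1, e2]
  ring

lemma exists_opt (w : V → V → SignType) (hw : IsG w) :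
    ∃ σ : V → Bool, (∀ τ, viol w σ ≤ viol w τ) ∧ (∀ x, dg w x ≤ 2 * (pos w σ x).card) ∧
      (Bal w → ∀ x y, tw σ w x y ≠ -1) := by
  obtain ⟨σ, -, hσ⟩ := Finset.exists_min_image (Finset.univ : Finset (V → Bool)) (viol w)
    ⟨fun _ => true, Finset.mem_univ _⟩
  have hσ' : ∀ τ, viol w σ ≤ viol w τ := fun τ => hσ τ (Finset.mem_univ _)
  refine ⟨σ, hσ', fun x => ?_, fun ⟨τ, hτ⟩ x y hxy => ?_⟩
  · have h1 := viol_flip w hw.1 hw.2.1 σ x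
    have h2 := hσ' (Function.update σ x (!σ x))
    have h3 := dg_eq w σ x
    zify at h2 h3 ⊢
    omega
  · have h1 : viol w τ = 0 := by simp [viol, hτ]
    have h2 := hσ' τ
    rw [h1] at h2
    have h3 : viol w σ = 0 := by omega
    rw [viol, Finset.sum_eq_zero_iff] at h3
    have := h3 x (Finset.mem_univ _)
    rw [Finset.card_eq_zero, Finset.filter_eq_empty_iff] at this
    exact this (Finset.mem_univ y) hxy

lemma sg_not (b : Bool) : sg (!b) = - sg b := by revert b; decide

lemma tw_not {V : Type} (w : V → V → SignType) (σ : V → Bool) : tw (fun x => !σ x) w = tw σ w := by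
  funext x y
  simp only [tw]
  generalize σ x = a; generalize σ y = b; generalize w x y = c
  revert a b c; decide

def flipSet (w : V → V → SignType) (σ : V → Bool) (r : ℝ) : Finset (V → SignType) :=
  Finset.univ.filter (fun s => Ext w s ∧ (∃ x, s x = - sg (σ x)) ∧
    ((Finset.univ.filter (fun x => s x = - sg (σ x))).card : ℝ) ≤ r)

lemma flip_count (w : V → V → SignType) (σ : V → Bool) (r D : ℝ)
    (hD : ∀ x, D ≤ (pos w σ x).card) :
    ((flipSet w σ r).card : ℝ) ≤ (SP V r).card * 2 ^ ((Fintype.card V : ℝ) - D) := by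
  let P : (V → SignType) → V → Finset SignType := fun b y =>
    if (∃ x, b x ≠ 0 ∧ tw σ w x y = 1) ∨ b y ≠ 0 then {b y} else {0, sg (σ y)}
  let S := (SP V r).filter (fun b => ∃ x, b x ≠ 0)
  have hsub : flipSet w σ r ⊆ S.biUnion (fun b => Fintype.piFinset (P b)) := by
    intro s hs
    simp only [flipSet, Finset.mem_filter, Finset.mem_univ, true_and] at hs
    obtain ⟨hE, ⟨x, hx⟩, hc⟩ := hs
    let b : V → SignType := fun x => if s x = - sg (σ x) then s x else 0
    have hb : ∀ x, b x ≠ 0 ↔ s x = - sg (σ x) := by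
      intro x
      simp only [b]
      generalize s x = a; generalize σ x = c
      revert a c; decide
    refine Finset.mem_biUnion.mpr ⟨b, ?_, ?_⟩
    · simp only [S, SP, Finset.mem_filter, Finset.mem_univ, true_and]
      refine ⟨?_, x, (hb x).2 hx⟩
      have : supp b = Finset.univ.filter (fun x => s x = - sg (σ x)) := by
        ext x; simp [supp, hb]
      rw [this]; exact hc
    · rw [Fintype.mem_piFinset]
      intro y
      simp only [P]
      by_cases hy : s y = - sg (σ y)
      · have : b y = s y := by simp [b, hy]
        rw [if_pos (Or.inr ((hb y).2 hy)), this]; simp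
      · have hby : b y = 0 := by simp [b, hy]
        split_ifs with h
        · rw [hby]
          rcases h with ⟨z, hz, hzy⟩ | h
          · have hz' := (hb z).1 hz
            have hE' := hE z y
            rw [hz'] at hE'
            simp only [tw] at hzy
            rw [Finset.mem_singleton]
            generalize s y = p at *
            generalize w z y = q at *
            generalize σ z = a at *
            generalize σ y = c at *
            clear hb hc hx hby hz hz' hE
            revert p q a c; decide
          · exact absurd hby h
        · generalize s y = p at *
          generalize σ y = c at *
          clear hb hc hx hby hE h
          revert p c; decide
  have h1 : ((flipSet w σ r).card : ℝ) ≤ ∑ b ∈ S, ((Fintype.piFinset (P b)).card : ℝ) := by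
    exact_mod_cast (Finset.card_le_card hsub).trans Finset.card_biUnion_le
  refine h1.trans ?_
  calc ∑ b ∈ S, ((Fintype.piFinset (P b)).card : ℝ)
      ≤ ∑ _b ∈ S, (2:ℝ) ^ ((Fintype.card V : ℝ) - D) := by
        refine Finset.sum_le_sum (fun b hb => ?_)
        obtain ⟨x, hx⟩ := (Finset.mem_filter.mp hb).2
        refine (pi_card_le (P b) (pos w σ x) ?_ ?_).trans ?_
        · intro y
          simp only [P]
          split_ifs
          · simp
          · exact Finset.card_le_two
        · intro y hy
          simp only [P]
          rw [if_pos (Or.inl ⟨x, hx, (Finset.mem_filter.mp hy).2⟩)]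
          simp
        · exact Real.rpow_le_rpow_of_exponent_le (by norm_num) (by linarith [hD x])
    _ = S.card * 2 ^ ((Fintype.card V : ℝ) - D) := by rw [Finset.sum_const, nsmul_eq_mul]
    _ ≤ _ := by
        gcongr
        exact Finset.filter_subset _ _

/-- extension vectors contained in a section -/
def Sub (σ : V → Bool) (s : V → SignType) : Prop := ∀ x, s x = 0 ∨ s x = sg (σ x)

def subExt (w : V → V → SignType) (σ : V → Bool) : Finset (V → SignType) :=
  Finset.univ.filter (fun s => Ext w s ∧ Sub σ s)

lemma mem_subExt {w : V → V → SignType} {σ : V → Bool} {s : V → SignType} :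
    s ∈ subExt w σ ↔ Ext w s ∧ Sub σ s := by simp [subExt]

def badExt (w : V → V → SignType) (σ : V → Bool) : Finset (V → SignType) :=
  Finset.univ.filter (fun s => Ext w s ∧ ¬ Sub σ s ∧ ¬ Sub (fun x => !σ x) s)

lemma mem_badExt {w : V → V → SignType} {σ : V → Bool} {s : V → SignType} :
    s ∈ badExt w σ ↔ Ext w s ∧ ¬ Sub σ s ∧ ¬ Sub (fun x => !σ x) s := by simp [badExt]

lemma sub_count (w : V → V → SignType) (h0 : ∀ x, w x x = 0) (σ : V → Bool) (x y : V)
    (hxy : tw σ w x y = -1) :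
    ((subExt w σ).card : ℝ) ≤ 3 / 4 * 2 ^ (Fintype.card V : ℝ) := by
  rw [subExt]
  have hne : x ≠ y := by
    rintro rfl
    rw [tw, h0] at hxy
    generalize σ x = a at hxy
    revert a; decide
  let P1 : V → Finset SignType := fun z => if z = x then {0} else {0, sg (σ z)}
  let P2 : V → Finset SignType := fun z => if z = x then {sg (σ z)} else
    if z = y then {0} else {0, sg (σ z)}
  have hsub : Finset.univ.filter (fun s => Ext w s ∧ Sub σ s) ⊆
      Fintype.piFinset P1 ∪ Fintype.piFinset P2 := by
    intro s hs
    obtain ⟨hE, hS⟩ := (Finset.mem_filter.mp hs).2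
    rw [Finset.mem_union, Fintype.mem_piFinset, Fintype.mem_piFinset]
    by_cases hx : s x = 0
    · left
      intro z
      simp only [P1]
      split_ifs with h
      · rw [h, hx]; simp
      · simpa using hS z
    · right
      have hx' := (hS x).resolve_left hx
      intro z
      simp only [P2]
      split_ifs with h h'
      · rw [h, hx']; simp
      · rw [h', Finset.mem_singleton]
        by_contra hy
        have hy' := (hS y).resolve_left hy
        apply hE x y
        rw [hx', hy']
        exact hxy
      · simpa using hS z
  have c1 := pi_card_le P1 {x} (by
    intro z; simp only [P1]; split_ifs
    · simp
    · exact Finset.card_le_two) (by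
    intro z hz; simp only [P1]; rw [if_pos (by simpa using hz)]; simp)
  have c2 := pi_card_le P2 {x, y} (by
    intro z; simp only [P2]; split_ifs
    · simp
    · simp
    · exact Finset.card_le_two) (by
    intro z hz; simp only [P2]; split_ifs with h h'
    · simp
    · simp
    · simp [h, h'] at hz)
  rw [Finset.card_singleton] at c1
  rw [Finset.card_pair hne] at c2
  rw [Real.rpow_sub (by norm_num)] at c1 c2
  have e1 : (2:ℝ) ^ ((1:ℕ):ℝ) = 2 := by norm_num
  have e2 : (2:ℝ) ^ ((2:ℕ):ℝ) = 4 := by norm_num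
  rw [e1] at c1
  rw [e2] at c2
  have h3 := (Finset.card_le_card hsub).trans (Finset.card_union_le _ _)
  have h4 : ((Finset.univ.filter (fun s => Ext w s ∧ Sub σ s)).card : ℝ) ≤
      (Fintype.piFinset P1).card + (Fintype.piFinset P2).card := by exact_mod_cast h3
  linarith

def N2p (w : V → V → SignType) (d : ℕ) (b : ℝ) : Prop :=
  ∃ A0 A2 : Finset V, Disjoint A0 A2 ∧
    (∀ x ∈ A2, (Finset.univ.filter (fun y => w x y ≠ 0 ∧ y ∉ A0)).card ≤ 2 * d) ∧
    b ≤ A0.card ∧ (A0.card : ℝ) < 0.65 * A2.card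

def N3p (w : V → V → SignType) (g r : ℝ) : Prop :=
  ∃ σ τ : V → Bool, (viol w σ : ℝ) ≤ g ∧ (viol w τ : ℝ) ≤ g ∧
    r ≤ (Finset.univ.filter (fun x => σ x = τ x)).card ∧
    r ≤ (Finset.univ.filter (fun x => σ x ≠ τ x)).card

lemma good_ext (w : V → V → SignType) (d : ℕ) (hd : 0 < d) (b g r a D g1 : ℝ)
    (hD : ∀ x, D ≤ dg w x) (hN2 : ¬ N2p w d b) (hN3 : ¬ N3p w g r)
    (hb : b ≤ D - 2 * d) (hg : (Fintype.card V : ℝ) * (d + 2 * a) ≤ g)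
    (hg1 : g1 ≤ a) (hg2 : g1 ≤ b / 13) (σ : V → Bool) (hσ : ∀ τ, viol w σ ≤ viol w τ)
    (hσ2 : ∀ x, dg w x ≤ 2 * (pos w σ x).card) :
    ((badExt w σ).card : ℝ) ≤
      (SP V (2 * Fintype.card V / d)).card * 2 ^ ((Fintype.card V : ℝ) - g1) +
      2 * ((SP V r).card * 2 ^ ((Fintype.card V : ℝ) - D / 2)) := by
  rw [badExt]
  have hposD : ∀ x, D / 2 ≤ (pos w σ x).card := by
    intro x
    have h1 := hD x
    have h2 : (dg w x : ℝ) ≤ 2 * (pos w σ x).card := by exact_mod_cast hσ2 x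
    linarith
  let Q := (SP V (2 * Fintype.card V / d)).filter
    (fun f => ((inCont w d f).card : ℝ) ≤ 2 ^ ((Fintype.card V : ℝ) - g1))
  have hsub : Finset.univ.filter (fun s => Ext w s ∧ ¬ Sub σ s ∧ ¬ Sub (fun x => !σ x) s) ⊆
      Q.biUnion (inCont w d) ∪ (flipSet w σ r ∪ flipSet w (fun x => !σ x) r) := by
    intro s hs
    obtain ⟨hE, hS1, hS2⟩ := (Finset.mem_filter.mp hs).2
    obtain ⟨f, hf, hfs⟩ := exists_fingerprint w d hd s hE
    have hsc : s ∈ inCont w d f := by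
      rw [inCont, Fintype.mem_piFinset]
      intro x
      rw [Finset.mem_insert]; exact hfs x
    have hfSP : f ∈ SP V (2 * Fintype.card V / d) := by
      refine Finset.mem_filter.mpr ⟨Finset.mem_univ _, ?_⟩
      rw [le_div_iff₀ (by exact_mod_cast hd), mul_comm]
      exact_mod_cast hf
    have hcard := inCont_card w d f
    by_cases hsm : ((inCont w d f).card : ℝ) ≤ 2 ^ ((Fintype.card V : ℝ) - g1)
    · exact Finset.mem_union_left _ (Finset.mem_biUnion.mpr
        ⟨f, Finset.mem_filter.mpr ⟨hfSP, hsm⟩, hsc⟩)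
    apply Finset.mem_union_right
    have hexp : (Fintype.card V : ℝ) - g1 <
        (Fintype.card V : ℝ) - (lev w d f 0).card + 0.6 * (lev w d f 2).card := by
      by_contra hc
      push Not at hc
      exact hsm (hcard.trans (Real.rpow_le_rpow_of_exponent_le (by norm_num) hc))
    have h2 : lev w d f 2 = ∅ := by
      by_contra hne
      obtain ⟨x, hx⟩ := Finset.nonempty_iff_ne_empty.mpr hne
      have hb0 : b ≤ (lev w d f 0).card := by
        have h1 := lev_two_nbr hx
        have h2 : dg w x ≤ (lev w d f 0).card +
            (Finset.univ.filter (fun y => w x y ≠ 0 ∧ y ∉ lev w d f 0)).card := by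
          refine (Finset.card_le_card ?_).trans (Finset.card_union_le _ _)
          intro y hy
          by_cases h : y ∈ lev w d f 0
          · exact Finset.mem_union_left _ h
          · exact Finset.mem_union_right _ (by simpa [h] using hy)
        have h3 : (dg w x : ℝ) ≤ (lev w d f 0).card + 2 * d := by
          exact_mod_cast h2.trans (by omega)
        linarith [hD x]
      apply hN2
      refine ⟨lev w d f 0, lev w d f 2, ?_, fun x hx => lev_two_nbr hx, hb0, ?_⟩
      · rw [Finset.disjoint_left]
        intro y h1 h2
        have h1 := (Finset.mem_filter.mp h1).2
        have h2 := (Finset.mem_filter.mp h2).2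
        omega
      · linarith
    have h0 : ((lev w d f 0).card : ℝ) < a := by
      rw [h2] at hexp; simp at hexp; linarith
    obtain ⟨τ, hτ, hv⟩ := near_section w d f h2
    have hvτ : (viol w τ : ℝ) ≤ g := by
      have : (viol w τ : ℝ) ≤ Fintype.card V * (d + 2 * (lev w d f 0).card) := by exact_mod_cast hv
      refine this.trans (le_trans ?_ hg)
      gcongr
    have hvσ : (viol w σ : ℝ) ≤ g := le_trans (by exact_mod_cast hσ τ) hvτ
    have hsτ : ∀ x, s x = 0 ∨ s x = sg (τ x) := by
      intro x
      rcases hfs x with h | h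
      · exact Or.inl h
      · exact Or.inr (hτ x _ h)
    have hor : ((Finset.univ.filter (fun x => σ x = τ x)).card : ℝ) ≤ r ∨
        ((Finset.univ.filter (fun x => σ x ≠ τ x)).card : ℝ) ≤ r := by
      by_contra hc
      push Not at hc
      exact hN3 ⟨σ, τ, hvσ, hvτ, hc.1.le, hc.2.le⟩
    rw [Finset.mem_union]
    rcases hor with h | h
    · right
      refine Finset.mem_filter.mpr ⟨Finset.mem_univ _, hE, ?_, ?_⟩
      · by_contra hc
        push Not at hc
        apply hS2
        intro x
        have h1 := hc x
        change s x ≠ - sg (!σ x) at h1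
        change s x = 0 ∨ s x = sg (!σ x)
        generalize σ x = p at *
        generalize s x = q at *
        clear hfs hsτ
        revert p q; decide
      · refine le_trans ?_ h
        norm_cast
        refine Finset.card_le_card ?_
        intro x hx
        have hx := (Finset.mem_filter.mp hx).2
        refine Finset.mem_filter.mpr ⟨Finset.mem_univ _, ?_⟩
        have h1 := hsτ x
        change s x = - sg (!σ x) at hx
        generalize σ x = p at *
        generalize s x = q at *
        generalize τ x = t at *
        clear hfs hsτ hτ
        revert p q t; decide
    · left
      refine Finset.mem_filter.mpr ⟨Finset.mem_univ _, hE, ?_, ?_⟩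
      · by_contra hc
        push Not at hc
        apply hS1
        intro x
        have h1 := hc x
        generalize σ x = p at *
        generalize s x = q at *
        clear hfs hsτ
        revert p q; decide
      · refine le_trans ?_ h
        norm_cast
        refine Finset.card_le_card ?_
        intro x hx
        have hx := (Finset.mem_filter.mp hx).2
        refine Finset.mem_filter.mpr ⟨Finset.mem_univ _, ?_⟩
        have h1 := hsτ x
        generalize σ x = p at *
        generalize s x = q at *
        generalize τ x = t at *
        clear hfs hsτ hτ
        revert p q t; decide
  have k1 := flip_count w σ r (D / 2) hposD
  have k2 := flip_count w (fun x => !σ x) r (D / 2) (by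
    intro x
    have : pos w (fun x => !σ x) x = pos w σ x := by
      simp only [pos, tw_not]
    rw [this]; exact hposD x)
  have k3 : ((Q.biUnion (inCont w d)).card : ℝ) ≤
      (SP V (2 * Fintype.card V / d)).card * 2 ^ ((Fintype.card V : ℝ) - g1) := by
    calc ((Q.biUnion (inCont w d)).card : ℝ) ≤ ∑ f ∈ Q, ((inCont w d f).card : ℝ) := by
          exact_mod_cast Finset.card_biUnion_le
      _ ≤ ∑ f ∈ Q, (2:ℝ) ^ ((Fintype.card V : ℝ) - g1) :=
          Finset.sum_le_sum (fun f hf => (Finset.mem_filter.mp hf).2)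
      _ = Q.card * 2 ^ ((Fintype.card V : ℝ) - g1) := by rw [Finset.sum_const, nsmul_eq_mul]
      _ ≤ _ := by
          gcongr
          exact Finset.filter_subset _ _
  have k4 := (Finset.card_le_card hsub).trans ((Finset.card_union_le _ _).trans
    (Nat.add_le_add_left (Finset.card_union_le _ _) _))
  have k5 : ((Finset.univ.filter (fun s => Ext w s ∧ ¬ Sub σ s ∧
      ¬ Sub (fun x => !σ x) s)).card : ℝ) ≤ (Q.biUnion (inCont w d)).card +
      ((flipSet w σ r).card + (flipSet w (fun x => !σ x) r).card) := by exact_mod_cast k4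
  linarith

end

end OB

namespace OB

section

open scoped Classical



lemma two_lt_card {m : ℕ} (R : Fin m → Fin m → Prop) (hR : ∀ x y, R x y ↔ R y x) :
    2 * (Finset.univ.filter (fun p : Fin m × Fin m => p.1 < p.2 ∧ R p.1 p.2)).card =
      (Finset.univ.filter (fun p : Fin m × Fin m => p.1 ≠ p.2 ∧ R p.1 p.2)).card := by
  have h1 : (Finset.univ.filter (fun p : Fin m × Fin m => p.2 < p.1 ∧ R p.1 p.2)).card =
      (Finset.univ.filter (fun p : Fin m × Fin m => p.1 < p.2 ∧ R p.1 p.2)).card := by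
    refine Finset.card_bij (fun p _ => p.swap) ?_ ?_ ?_
    · intro p hp
      simp only [Finset.mem_filter, Finset.mem_univ, true_and, Prod.fst_swap, Prod.snd_swap] at hp ⊢
      exact ⟨hp.1, (hR _ _).1 hp.2⟩
    · intro p _ q _ h
      exact Prod.swap_injective h
    · intro p hp
      simp only [Finset.mem_filter, Finset.mem_univ, true_and] at hp
      exact ⟨p.swap, by simpa using ⟨hp.1, (hR _ _).1 hp.2⟩, by simp⟩
  have h2 : Finset.univ.filter (fun p : Fin m × Fin m => p.1 ≠ p.2 ∧ R p.1 p.2) =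
      Finset.univ.filter (fun p : Fin m × Fin m => p.1 < p.2 ∧ R p.1 p.2) ∪
      Finset.univ.filter (fun p : Fin m × Fin m => p.2 < p.1 ∧ R p.1 p.2) := by
    ext p
    simp only [Finset.mem_filter, Finset.mem_univ, true_and, Finset.mem_union, ne_iff_lt_or_gt]
    tauto
  rw [h2, Finset.card_union_of_disjoint, h1, two_mul]
  rw [Finset.disjoint_left]
  intro p hp hq
  simp only [Finset.mem_filter, Finset.mem_univ, true_and] at hp hq
  exact absurd hp.1 (not_lt.mpr hq.1.le)

/-- pairs on the same side of `X` -/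
def NC {m : ℕ} (X : Finset (Fin m)) : Finset (Fin m × Fin m) :=
  Finset.univ.filter (fun p => p.1 < p.2 ∧ (p.1 ∈ X ↔ p.2 ∈ X))

lemma NC_card {m : ℕ} (X : Finset (Fin m)) :
    ((NC X).card : ℝ) = ((m:ℝ) ^ 2 - m) / 2 - X.card * Xᶜ.card := by
  have h := two_lt_card (fun x y => (x ∈ X ↔ y ∈ X)) (fun x y => by tauto)
  have h1 : (Finset.univ.filter (fun p : Fin m × Fin m => p.1 ≠ p.2 ∧ (p.1 ∈ X ↔ p.2 ∈ X))).card + m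
      = X.card * X.card + Xᶜ.card * Xᶜ.card := by
    have h2 : (Finset.univ.filter (fun p : Fin m × Fin m => p.1 ≠ p.2 ∧ (p.1 ∈ X ↔ p.2 ∈ X))) ∪
        Finset.univ.image (fun x : Fin m => (x, x)) = X ×ˢ X ∪ Xᶜ ×ˢ Xᶜ := by
      ext ⟨x, y⟩
      simp only [Finset.mem_union, Finset.mem_filter, Finset.mem_univ, true_and, Finset.mem_image,
        Prod.mk.injEq, Finset.mem_product, Finset.mem_compl, exists_eq_left]
      by_cases hxy : x = y
      · subst hxy; simp; tauto
      · simp [hxy]; tauto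
    have h3 := congrArg Finset.card h2
    rw [Finset.card_union_of_disjoint, Finset.card_union_of_disjoint, Finset.card_product,
      Finset.card_product, Finset.card_image_of_injective _ (fun a b h => (Prod.mk.inj h).1)] at h3
    · simpa only [Finset.card_univ, Fintype.card_fin] using h3
    · rw [Finset.disjoint_left]
      rintro ⟨x, y⟩ h1 h2
      simp only [Finset.mem_product, Finset.mem_compl] at h1 h2
      exact h2.1 h1.1
    · rw [Finset.disjoint_left]
      rintro ⟨x, y⟩ h1 h2
      simp only [Finset.mem_filter, Finset.mem_image, Finset.mem_univ, true_and, Prod.mk.injEq,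
        exists_eq_left] at h1 h2
      exact h1.1 h2
  have h4 : X.card + Xᶜ.card = m := by simpa using Finset.card_add_card_compl X
  replace h : 2 * (NC X).card = (Finset.univ.filter (fun p : Fin m × Fin m => p.1 ≠ p.2 ∧ (p.1 ∈ X ↔ p.2 ∈ X))).card := by
    rw [NC]; convert h
  rw [← h] at h1
  have h1' : 2 * ((NC X).card : ℝ) + m = X.card * X.card + Xᶜ.card * Xᶜ.card := by exact_mod_cast h1
  have h4' : (X.card : ℝ) + Xᶜ.card = m := by exact_mod_cast h4
  rw [← h4'] at h1' ⊢
  linarith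

def agree {m : ℕ} (σ τ : Fin m → Bool) : Finset (Fin m) := Finset.univ.filter (fun x => σ x = τ x)

lemma viol_card {m : ℕ} (w : Fin m → Fin m → SignType) (σ : Fin m → Bool) :
    (Finset.univ.filter (fun p : Fin m × Fin m => tw σ w p.1 p.2 = -1)).card = viol w σ := by
  rw [viol, Finset.card_filter, Fintype.sum_prod_type]
  simp_rw [Finset.card_filter]

lemma isG_ext {m : ℕ} {w w' : Fin m → Fin m → SignType} (hw : IsG w) (hw' : IsG w')
    (h : ∀ x y, x < y → w x y = w' x y) : w = w' := by
  funext x y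
  rcases lt_trichotomy x y with hxy | hxy | hxy
  · exact h x y hxy
  · rw [hxy, hw.1, hw'.1]
  · rw [hw.2.1, hw'.2.1]; exact h y x hxy

/-- graphs with few violations for both `σ` and `τ` -/
lemma two_section_count {m : ℕ} (σ τ : Fin m → Bool) (g : ℝ) :
    (((FS m).filter (fun w => (viol w σ : ℝ) ≤ g ∧ (viol w τ : ℝ) ≤ g)).card : ℝ) ≤
      (SP (Fin m × Fin m) (2 * g)).card *
        2 ^ (((m:ℝ) ^ 2 - m) / 2 - (agree σ τ).card * (agree σ τ)ᶜ.card) := by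
  have hcard : ((FS m).filter (fun w => (viol w σ : ℝ) ≤ g ∧ (viol w τ : ℝ) ≤ g)).card ≤
      ((SP (Fin m × Fin m) (2 * g)) ×ˢ (NC (agree σ τ)).powerset).card := by
    refine Finset.card_le_card_of_injOn (fun w => (fun p : Fin m × Fin m =>
      if tw σ w p.1 p.2 = -1 ∨ tw τ w p.1 p.2 = -1 then w p.1 p.2 else 0,
      Finset.univ.filter (fun p : Fin m × Fin m => p.1 < p.2 ∧ tw σ w p.1 p.2 = 1 ∧
        tw τ w p.1 p.2 = 1))) ?_ ?_
    · intro w hw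
      obtain ⟨hwF, h1, h2⟩ := Finset.mem_filter.mp hw
      rw [Finset.mem_coe, Finset.mem_product]
      refine ⟨mem_SP.mpr ?_, ?_⟩
      · have hs : supp (fun p : Fin m × Fin m =>
            if tw σ w p.1 p.2 = -1 ∨ tw τ w p.1 p.2 = -1 then w p.1 p.2 else 0) ⊆
            Finset.univ.filter (fun p : Fin m × Fin m => tw σ w p.1 p.2 = -1) ∪
            Finset.univ.filter (fun p : Fin m × Fin m => tw τ w p.1 p.2 = -1) := by
          intro p hp
          have hp := (Finset.mem_filter.mp hp).2
          simp only [Finset.mem_union, Finset.mem_filter, Finset.mem_univ, true_and]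
          by_contra hc
          simp [hc] at hp
        have h3 := (Finset.card_le_card hs).trans (Finset.card_union_le _ _)
        rw [viol_card, viol_card] at h3
        have h4 : ((supp (fun p : Fin m × Fin m =>
            if tw σ w p.1 p.2 = -1 ∨ tw τ w p.1 p.2 = -1 then w p.1 p.2 else 0)).card : ℝ) ≤
            viol w σ + viol w τ := by exact_mod_cast h3
        linarith
      · rw [Finset.mem_powerset]
        intro p hp
        obtain ⟨hlt, h3, h4⟩ := (Finset.mem_filter.mp hp).2
        refine Finset.mem_filter.mpr ⟨Finset.mem_univ _, hlt, ?_⟩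
        simp only [agree, Finset.mem_filter, Finset.mem_univ, true_and]
        simp only [tw] at h3 h4
        generalize σ p.1 = a1 at *
        generalize σ p.2 = a2 at *
        generalize τ p.1 = a3 at *
        generalize τ p.2 = a4 at *
        generalize w p.1 p.2 = a5 at *
        clear hlt h1 h2 hp hwF hw
        revert a1 a2 a3 a4 a5; decide
    · intro w hw w' hw' heq
      have hwF := (Finset.mem_filter.mp (Finset.mem_filter.mp hw).1).2
      have hwF' := (Finset.mem_filter.mp (Finset.mem_filter.mp hw').1).2
      refine isG_ext hwF hwF' (fun x y hxy => ?_)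
      have h1 := congrFun (Prod.mk.inj heq).1 (x, y)
      have h2 := Finset.ext_iff.mp (Prod.mk.inj heq).2 (x, y)
      simp only [Finset.mem_filter, Finset.mem_univ, true_and, hxy] at h2
      dsimp only at h1
      rw [tw, tw, tw, tw] at h1 h2
      generalize σ x = a1 at *
      generalize σ y = a2 at *
      generalize τ x = a3 at *
      generalize τ y = a4 at *
      generalize w x y = a5 at *
      generalize w' x y = a6 at *
      clear heq hxy hwF hwF' hw hw'
      revert a1 a2 a3 a4 a5 a6; decide
  rw [← NC_card, Real.rpow_natCast]
  rw [Finset.card_product, Finset.card_powerset] at hcard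
  exact_mod_cast hcard

lemma N3_count (m : ℕ) (g ρ : ℝ) (hρ : 0 ≤ ρ) :
    (((FS m).filter (fun w => N3p w g (ρ * m))).card : ℝ) ≤
      4 ^ (m:ℝ) * ((SP (Fin m × Fin m) (2 * g)).card *
        2 ^ (((m:ℝ) ^ 2 - m) / 2 - ρ * m ^ 2 / 2)) := by
  let I := (Finset.univ : Finset ((Fin m → Bool) × (Fin m → Bool))).filter
    (fun q => ρ * m ≤ (agree q.1 q.2).card ∧ ρ * m ≤ (agree q.1 q.2)ᶜ.card)
  have hsub : (FS m).filter (fun w => N3p w g (ρ * m)) ⊆ I.biUnion (fun q =>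
      (FS m).filter (fun w => (viol w q.1 : ℝ) ≤ g ∧ (viol w q.2 : ℝ) ≤ g)) := by
    intro w hw
    obtain ⟨hwF, σ, τ, h1, h2, h3, h4⟩ := Finset.mem_filter.mp hw
    refine Finset.mem_biUnion.mpr ⟨(σ, τ), ?_, Finset.mem_filter.mpr ⟨hwF, h1, h2⟩⟩
    refine Finset.mem_filter.mpr ⟨Finset.mem_univ _, h3, ?_⟩
    have : (agree σ τ)ᶜ = Finset.univ.filter (fun x => σ x ≠ τ x) := by
      ext x; simp [agree]
    dsimp only
    rw [this]; exact h4
  have h1 := (Finset.card_le_card hsub).trans Finset.card_biUnion_le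
  have h2 : (((FS m).filter (fun w => N3p w g (ρ * m))).card : ℝ) ≤ ∑ q ∈ I,
    (((FS m).filter (fun w => (viol w q.1 : ℝ) ≤ g ∧ (viol w q.2 : ℝ) ≤ g)).card : ℝ) := by
    exact_mod_cast h1
  refine h2.trans ?_
  calc _ ≤ ∑ q ∈ I, ((SP (Fin m × Fin m) (2 * g)).card : ℝ) *
        2 ^ (((m:ℝ) ^ 2 - m) / 2 - ρ * m ^ 2 / 2) := by
        refine Finset.sum_le_sum (fun q hq => ?_)
        refine (two_section_count q.1 q.2 g).trans ?_
        obtain ⟨h3, h4⟩ := (Finset.mem_filter.mp hq).2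
        have h5 : ((agree q.1 q.2).card : ℝ) + (agree q.1 q.2)ᶜ.card = m := by
          have := Finset.card_add_card_compl (agree q.1 q.2)
          rw [Fintype.card_fin] at this
          exact_mod_cast this
        gcongr
        · norm_num
        · have hm : (0:ℝ) ≤ m := by positivity
          have hr : 0 ≤ ρ * m := by positivity
          generalize ((agree q.1 q.2).card : ℝ) = a at *
          generalize ((agree q.1 q.2)ᶜ.card : ℝ) = b at *
          rcases le_total a b with h | h
          · nlinarith
          · nlinarith
    _ = I.card * (((SP (Fin m × Fin m) (2 * g)).card : ℝ) *
        2 ^ (((m:ℝ) ^ 2 - m) / 2 - ρ * m ^ 2 / 2)) := by rw [Finset.sum_const, nsmul_eq_mul]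
    _ ≤ _ := by
        gcongr
        have h6 : I.card ≤ 4 ^ m := by
          refine (Finset.card_le_univ _).trans ?_
          simp [← mul_pow]
        rw [Real.rpow_natCast]
        exact_mod_cast h6

lemma isG_comp {V W : Type} {w : V → V → SignType} (hw : IsG w) (e : W → V) :
    IsG (fun x y => w (e x) (e y)) :=
  ⟨fun _ => hw.1 _, fun _ _ => hw.2.1 _ _, fun _ _ _ => hw.2.2 _ _ _⟩

lemma N2_count_one (m d : ℕ) (A0 A2 : Finset (Fin m)) :
    ((FS m).filter (fun w => ∀ x ∈ A2,
      (Finset.univ.filter (fun y => w x y ≠ 0 ∧ y ∉ A0)).card ≤ 2 * d)).card ≤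
    (FS (A2ᶜ.card)).card * (3 ^ (A2.card * A0.card) * (SP (Fin m × Fin m) (2 * d * m)).card) := by
  let P : Fin m × Fin m → Finset SignType := fun p => if p ∈ A2 ×ˢ A0 then Finset.univ else {0}
  have hP : (Fintype.piFinset P).card = 3 ^ (A2.card * A0.card) := by
    rw [Fintype.card_piFinset]
    simp only [P, apply_ite Finset.card]
    rw [Finset.prod_ite]
    simp only [Finset.prod_const, Finset.card_univ, card_sign, Finset.card_singleton, one_pow, mul_one]
    rw [Finset.filter_mem_eq_inter, Finset.univ_inter, Finset.card_product]
  rw [← hP, ← Finset.card_product, ← Finset.card_product]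
  let e : Fin (A2ᶜ.card) → Fin m := fun i => A2ᶜ.orderEmbOfFin rfl i
  have he : ∀ x, x ∉ A2 → ∃ i, e i = x := by
    intro x hx
    have : x ∈ Set.range (A2ᶜ.orderEmbOfFin rfl) := by
      rw [Finset.range_orderEmbOfFin]; simpa using hx
    exact this
  refine Finset.card_le_card_of_injOn (fun w => (fun i j => w (e i) (e j),
    fun p => if p ∈ A2 ×ˢ A0 then w p.1 p.2 else 0,
    fun p => if p.1 ∈ A2 ∧ p.2 ∉ A0 then w p.1 p.2 else 0)) ?_ ?_
  · intro w hw
    obtain ⟨hwF, h1⟩ := Finset.mem_filter.mp hw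
    have hwF := (Finset.mem_filter.mp hwF).2
    rw [Finset.mem_coe, Finset.mem_product, Finset.mem_product]
    refine ⟨Finset.mem_filter.mpr ⟨Finset.mem_univ _, isG_comp hwF e⟩, ?_, ?_⟩
    · rw [Fintype.mem_piFinset]
      intro p
      simp only [P]
      split_ifs <;> simp
    · rw [mem_SP]
      dsimp only
      have h2 : (supp (fun p : Fin m × Fin m => if p.1 ∈ A2 ∧ p.2 ∉ A0 then w p.1 p.2 else 0)).card
          ≤ ∑ x : Fin m, 2 * d := by
        have h3 : supp (fun p : Fin m × Fin m => if p.1 ∈ A2 ∧ p.2 ∉ A0 then w p.1 p.2 else 0) =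
          Finset.univ.filter (fun p : Fin m × Fin m => p.1 ∈ A2 ∧ w p.1 p.2 ≠ 0 ∧ p.2 ∉ A0) := by
          ext p
          simp [supp]
          tauto
        rw [h3, Finset.card_filter, Fintype.sum_prod_type]
        refine Finset.sum_le_sum (fun x _ => ?_)
        rw [← Finset.card_filter]
        by_cases hx : x ∈ A2
        · simpa [hx] using h1 x hx
        · simp [hx]
      simp only [Finset.sum_const, Finset.card_univ, Fintype.card_fin, smul_eq_mul] at h2
      have : ((supp (fun p : Fin m × Fin m => if p.1 ∈ A2 ∧ p.2 ∉ A0 then w p.1 p.2 else 0)).card : ℝ)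
        ≤ m * (2 * d) := by exact_mod_cast h2
      linarith
  · intro w hw w' hw' heq
    have hwF := (Finset.mem_filter.mp (Finset.mem_filter.mp hw).1).2
    have hwF' := (Finset.mem_filter.mp (Finset.mem_filter.mp hw').1).2
    simp only [Prod.mk.injEq] at heq
    obtain ⟨q1, q2, q3⟩ := heq
    have key : ∀ x y, x ∈ A2 → w x y = w' x y := by
      intro x y hx
      by_cases hy : y ∈ A0
      · have := congrFun q2 (x, y)
        simpa [hx, hy] using this
      · have := congrFun q3 (x, y)
        simpa [hx, hy] using this
    funext x y
    by_cases hx : x ∈ A2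
    · exact key x y hx
    by_cases hy : y ∈ A2
    · rw [hwF.2.1, hwF'.2.1]; exact key y x hy
    obtain ⟨i, rfl⟩ := he x hx
    obtain ⟨j, rfl⟩ := he y hy
    exact congrFun (congrFun q1 i) j

lemma N2_count (m d : ℕ) (b M : ℝ) (hb : 0 ≤ b) (hM : 0 ≤ M)
    (hF : ∀ k ≤ m, ((FS k).card : ℝ) ≤ M * T k) :
    (((FS m).filter (fun w => N2p w d b)).card : ℝ) ≤
      4 ^ (m:ℝ) * (M * ((SP (Fin m × Fin m) (2 * d * m)).card *
        2 ^ (((m:ℝ) ^ 2 + m) / 2 - 1 - 0.06 * b * m))) := by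
  let I := (Finset.univ : Finset (Finset (Fin m) × Finset (Fin m))).filter
    (fun q => Disjoint q.1 q.2 ∧ b ≤ q.1.card ∧ (q.1.card : ℝ) < 0.65 * q.2.card)
  have hsub : (FS m).filter (fun w => N2p w d b) ⊆ I.biUnion (fun q =>
      (FS m).filter (fun w => ∀ x ∈ q.2,
      (Finset.univ.filter (fun y => w x y ≠ 0 ∧ y ∉ q.1)).card ≤ 2 * d)) := by
    intro w hw
    obtain ⟨hwF, A0, A2, h1, h2, h3, h4⟩ := Finset.mem_filter.mp hw
    exact Finset.mem_biUnion.mpr ⟨(A0, A2), Finset.mem_filter.mpr ⟨Finset.mem_univ _, h1, h3, h4⟩,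
      Finset.mem_filter.mpr ⟨hwF, by simpa using h2⟩⟩
  have h1 := (Finset.card_le_card hsub).trans Finset.card_biUnion_le
  have h2 : (((FS m).filter (fun w => N2p w d b)).card : ℝ) ≤ ∑ q ∈ I,
      (((FS m).filter (fun w => ∀ x ∈ q.2,
      (Finset.univ.filter (fun y => w x y ≠ 0 ∧ y ∉ q.1)).card ≤ 2 * d)).card : ℝ) := by
    exact_mod_cast h1
  refine h2.trans ?_
  calc _ ≤ ∑ q ∈ I, M * ((SP (Fin m × Fin m) (2 * d * m)).card *
        (2:ℝ) ^ (((m:ℝ) ^ 2 + m) / 2 - 1 - 0.06 * b * m)) := by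
        refine Finset.sum_le_sum (fun q hq => ?_)
        obtain ⟨hdis, h3, h4⟩ := (Finset.mem_filter.mp hq).2
        have h5 : (((FS m).filter (fun w => ∀ x ∈ q.2,
          (Finset.univ.filter (fun y => w x y ≠ 0 ∧ y ∉ q.1)).card ≤ 2 * d)).card : ℝ) ≤
          ((FS (q.2ᶜ.card)).card : ℝ) * (3 ^ (q.2.card * q.1.card) *
            (SP (Fin m × Fin m) (2 * d * m)).card) := by
          exact_mod_cast N2_count_one m d q.1 q.2
        refine h5.trans ?_
        have hcm : q.2ᶜ.card ≤ m := by simpa using Finset.card_le_univ q.2ᶜ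
        have h6 : ((q.2.card : ℝ)) + q.2ᶜ.card = m := by
          have := Finset.card_add_card_compl q.2
          rw [Fintype.card_fin] at this
          exact_mod_cast this
        have h7 : (q.1.card : ℝ) + q.2.card ≤ m := by
          have := Finset.card_union_of_disjoint hdis
          have h8 := Finset.card_le_univ (q.1 ∪ q.2)
          rw [this, Fintype.card_fin] at h8
          exact_mod_cast h8
        have h9 : (3:ℝ) ^ (q.2.card * q.1.card) ≤ 2 ^ (1.6 * (q.2.card * q.1.card : ℝ)) := by
          calc (3:ℝ) ^ (q.2.card * q.1.card) ≤ (2 ^ (1.6:ℝ)) ^ (q.2.card * q.1.card) := by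
                gcongr; exact three_le
            _ = _ := by
                rw [Real.rpow_mul (by norm_num), ← Real.rpow_natCast]; push_cast; rfl
        calc ((FS (q.2ᶜ.card)).card : ℝ) * (3 ^ (q.2.card * q.1.card) *
              (SP (Fin m × Fin m) (2 * d * m)).card)
            ≤ (M * T (q.2ᶜ.card)) * (2 ^ (1.6 * (q.2.card * q.1.card : ℝ)) *
              (SP (Fin m × Fin m) (2 * d * m)).card) := by
              have := hF _ hcm
              have h0 : 0 ≤ M * T (q.2ᶜ.card) := mul_nonneg hM (by rw [T]; positivity)
              gcongr
          _ = M * ((SP (Fin m × Fin m) (2 * d * m)).card *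
              (2:ℝ) ^ (((q.2ᶜ.card:ℝ) ^ 2 + q.2ᶜ.card) / 2 - 1 + 1.6 * (q.2.card * q.1.card))) := by
              rw [Real.rpow_add (by norm_num), T]; ring
          _ ≤ _ := by
              gcongr
              · norm_num
              · have h10 : (0:ℝ) ≤ q.1.card := by positivity
                have h11 : (0:ℝ) ≤ q.2.card := by positivity
                have h12 : (q.2ᶜ.card : ℝ) = m - q.2.card := by linarith
                rw [h12]
                generalize (q.1.card : ℝ) = x at *
                generalize (q.2.card : ℝ) = y at *
                have hm : (0:ℝ) ≤ m := by positivity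
                generalize (m:ℝ) = z at *
                have k1 : y / 2 + 1.6 * x ≤ 0.94 * z := by
                  nlinarith
                have k2 : b ≤ y := by linarith
                have k3 : y * (y / 2 + 1.6 * x) ≤ y * (0.94 * z) := by gcongr
                have k4 : b * z ≤ y * z := by gcongr
                nlinarith
    _ = I.card * (M * ((SP (Fin m × Fin m) (2 * d * m)).card *
        (2:ℝ) ^ (((m:ℝ) ^ 2 + m) / 2 - 1 - 0.06 * b * m))) := by rw [Finset.sum_const, nsmul_eq_mul]
    _ ≤ _ := by
        gcongr
        have h6 : I.card ≤ 4 ^ m := by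
          refine (Finset.card_le_univ _).trans ?_
          simp [← mul_pow]
        rw [Real.rpow_natCast]
        exact_mod_cast h6

lemma low_count (m : ℕ) (k : ℝ) :
    (((FS (m+1)).filter (fun w => ∃ v, (dg w v : ℝ) ≤ k)).card : ℝ) ≤
      (m + 1) * ((FS m).card * (SP (Fin m) k).card) := by
  have hsub : (FS (m+1)).filter (fun w => ∃ v, (dg w v : ℝ) ≤ k) ⊆
      (Finset.univ : Finset (Fin (m+1))).biUnion (fun v =>
        (FS (m+1)).filter (fun w => (dg w v : ℝ) ≤ k)) := by
    intro w hw
    obtain ⟨hwF, v, hv⟩ := Finset.mem_filter.mp hw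
    exact Finset.mem_biUnion.mpr ⟨v, Finset.mem_univ _, Finset.mem_filter.mpr ⟨hwF, hv⟩⟩
  have hone : ∀ v, ((FS (m+1)).filter (fun w => (dg w v : ℝ) ≤ k)).card ≤
      (FS m).card * (SP (Fin m) k).card := by
    intro v
    rw [← Finset.card_product]
    refine Finset.card_le_card_of_injOn (fun w => (fun i j => w (v.succAbove i) (v.succAbove j),
      fun i => w v (v.succAbove i))) ?_ ?_
    · intro w hw
      obtain ⟨hwF, h1⟩ := Finset.mem_filter.mp hw
      have hwF := (Finset.mem_filter.mp hwF).2
      rw [Finset.mem_coe, Finset.mem_product]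
      refine ⟨Finset.mem_filter.mpr ⟨Finset.mem_univ _, isG_comp hwF _⟩,
        mem_SP.mpr (le_trans ?_ h1)⟩
      norm_cast
      refine Finset.card_le_card_of_injOn v.succAbove ?_ ?_
      · intro i hi
        have hi := (Finset.mem_filter.mp hi).2
        exact Finset.mem_filter.mpr ⟨Finset.mem_univ _, hi⟩
      · exact Fin.succAbove_right_injective.injOn
    · intro w hw w' hw' heq
      have hwF := (Finset.mem_filter.mp (Finset.mem_filter.mp hw).1).2
      have hwF' := (Finset.mem_filter.mp (Finset.mem_filter.mp hw').1).2
      simp only [Prod.mk.injEq] at heq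
      obtain ⟨q1, q2⟩ := heq
      have key : ∀ y, w v y = w' v y := by
        intro y
        rcases Fin.eq_self_or_eq_succAbove v y with rfl | ⟨j, rfl⟩
        · rw [hwF.1, hwF'.1]
        · exact congrFun q2 j
      funext x y
      rcases Fin.eq_self_or_eq_succAbove v x with rfl | ⟨i, rfl⟩
      · exact key y
      rcases Fin.eq_self_or_eq_succAbove v y with rfl | ⟨j, rfl⟩
      · rw [hwF.2.1, hwF'.2.1]; exact key _
      · exact congrFun (congrFun q1 i) j
  have h1 : ((FS (m+1)).filter (fun w => ∃ v, (dg w v : ℝ) ≤ k)).card ≤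
      (m + 1) * ((FS m).card * (SP (Fin m) k).card) := by
    refine (Finset.card_le_card hsub).trans (Finset.card_biUnion_le.trans ?_)
    refine (Finset.sum_le_sum (fun v _ => hone v)).trans ?_
    simp
  exact_mod_cast h1

end

end OB

namespace OB

section

open scoped Classical



def rst {m : ℕ} (G : Fin (m+1) → Fin (m+1) → SignType) : Fin m → Fin m → SignType :=
  fun i j => G i.succ j.succ

def row {m : ℕ} (G : Fin (m+1) → Fin (m+1) → SignType) : Fin m → SignType :=
  fun i => G 0 i.succ

lemma rst_row_inj {m : ℕ} {G G' : Fin (m+1) → Fin (m+1) → SignType} (hG : IsG G) (hG' : IsG G')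
    (h1 : rst G = rst G') (h2 : row G = row G') : G = G' := by
  have key : ∀ y, G 0 y = G' 0 y := by
    intro y
    refine Fin.cases ?_ (fun j => ?_) y
    · rw [hG.1, hG'.1]
    · exact congrFun h2 j
  funext x y
  refine Fin.cases (key y) (fun i => ?_) x
  refine Fin.cases ?_ (fun j => ?_) y
  · rw [hG.2.1, hG'.2.1]; exact key _
  · exact congrFun (congrFun h1 i) j

lemma row_ext {m : ℕ} {G : Fin (m+1) → Fin (m+1) → SignType} (hG : IsG G) :
    Ext (rst G) (row G) := by
  intro x y
  have h := hG.2.2 0 x.succ y.succ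
  exact h

lemma rst_dg {m : ℕ} (G : Fin (m+1) → Fin (m+1) → SignType) (x : Fin m) :
    dg G x.succ ≤ dg (rst G) x + 1 := by
  have h : Finset.univ.filter (fun y => G x.succ y ≠ 0) ⊆
      insert 0 ((Finset.univ.filter (fun y => rst G x y ≠ 0)).image Fin.succ) := by
    intro y hy
    have hy := (Finset.mem_filter.mp hy).2
    rw [Finset.mem_insert]
    revert hy
    refine Fin.cases (fun _ => Or.inl rfl) (fun j hj => Or.inr ?_) y
    exact Finset.mem_image.mpr ⟨j, Finset.mem_filter.mpr ⟨Finset.mem_univ _, hj⟩, rfl⟩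
  rw [dg]
  refine (Finset.card_le_card h).trans ((Finset.card_insert_le _ _).trans ?_)
  gcongr
  exact Finset.card_image_le

lemma bal_of_sub {m : ℕ} {G : Fin (m+1) → Fin (m+1) → SignType} (hG : IsG G) (σ : Fin m → Bool)
    (hσ : ∀ x y, tw σ (rst G) x y ≠ -1) (hs : Sub σ (row G)) : Bal G := by
  have h0 : ∀ (σ : Fin m → Bool) (i : Fin m), row G i = 0 ∨ row G i = sg (σ i) →
      sg true * G 0 i.succ * sg (σ i) ≠ -1 := by
    intro σ i h
    rw [row] at h
    generalize σ i = a at *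
    generalize G 0 i.succ = c at *
    revert a c; decide
  refine ⟨Fin.cons true σ, fun x y => ?_⟩
  refine Fin.cases ?_ (fun i => ?_) x
  · refine Fin.cases ?_ (fun j => ?_) y
    · rw [tw, hG.1]; simp
    · simp only [tw, Fin.cons_zero, Fin.cons_succ]; exact h0 σ j (hs j)
  · refine Fin.cases ?_ (fun j => ?_) y
    · simp only [tw, Fin.cons_zero, Fin.cons_succ]
      have := h0 σ i (hs i)
      rw [hG.2.1]
      intro h
      apply this
      rw [← h, mul_comm, mul_comm (sg true), mul_assoc]
    · simp only [tw, Fin.cons_succ]; exact hσ i j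

lemma rec_count (m d : ℕ) (k D b g r B : ℝ) (hkD : D ≤ k - 1) (hB0 : 0 ≤ B)
    (hB : ∀ H ∈ FS m, (∀ x, D ≤ dg H x) → ¬ N2p H d b → ¬ N3p H g r → ∀ σ,
      (∀ τ, viol H σ ≤ viol H τ) → (∀ x, dg H x ≤ 2 * (pos H σ x).card) →
      ((badExt H σ).card : ℝ) ≤ B) :
    ((US (m+1)).card : ℝ) ≤ (((FS (m+1)).filter (fun w => ∃ v, (dg w v : ℝ) ≤ k)).card : ℝ) +
      (3:ℝ) ^ m * ((((FS m).filter (fun w => N2p w d b)).card : ℝ) +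
        (((FS m).filter (fun w => N3p w g r)).card : ℝ)) +
      (US m).card * (3 / 2 * 2 ^ (m:ℝ)) + (FS m).card * B := by
  set L := (FS (m+1)).filter (fun w => ∃ v, (dg w v : ℝ) ≤ k) with hL
  set R := (US (m+1)).filter (fun w => ∀ v, k < (dg w v : ℝ)) with hR
  have h1 : US (m+1) ⊆ L ∪ R := by
    intro w hw
    rw [Finset.mem_union, hL, hR, Finset.mem_filter, Finset.mem_filter]
    by_cases h : ∃ v, (dg w v : ℝ) ≤ k
    · exact Or.inl ⟨(Finset.mem_filter.mp hw).1, h⟩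
    · push Not at h
      exact Or.inr ⟨hw, h⟩
  have h2 : ((US (m+1)).card : ℝ) ≤ L.card + R.card := by
    exact_mod_cast (Finset.card_le_card h1).trans (Finset.card_union_le _ _)
  have hmaps : Set.MapsTo rst (R : Set (Fin (m+1) → Fin (m+1) → SignType)) (FS m) := by
    intro w hw
    have hw := (Finset.mem_filter.mp (Finset.mem_filter.mp (Finset.mem_filter.mp hw).1).1).2
    exact Finset.mem_filter.mpr ⟨Finset.mem_univ _, isG_comp hw _⟩
  have hfib := Finset.card_eq_sum_card_fiberwise hmaps
  have hinto : ∀ H, ∀ S : Finset (Fin m → SignType), (∀ w ∈ R, rst w = H → row w ∈ S) →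
      (R.filter (fun w => rst w = H)).card ≤ S.card := by
    intro H S hS
    refine Finset.card_le_card_of_injOn row ?_ ?_
    · intro w hw
      obtain ⟨hw1, hw2⟩ := Finset.mem_filter.mp hw
      exact hS w hw1 hw2
    · intro w hw w' hw' heq
      obtain ⟨hw1, hw2⟩ := Finset.mem_filter.mp hw
      obtain ⟨hw1', hw2'⟩ := Finset.mem_filter.mp hw'
      have q := (Finset.mem_filter.mp (Finset.mem_filter.mp (Finset.mem_filter.mp hw1).1).1).2
      have q' := (Finset.mem_filter.mp (Finset.mem_filter.mp (Finset.mem_filter.mp hw1').1).1).2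
      exact rst_row_inj q q' (hw2.trans hw2'.symm) heq
  have hone : ∀ H ∈ FS m, ((R.filter (fun w => rst w = H)).card : ℝ) ≤
      (if N2p H d b then (3:ℝ) ^ m else 0) + (if N3p H g r then (3:ℝ) ^ m else 0) +
      (if ¬ Bal H then 3 / 2 * 2 ^ (m:ℝ) else 0) + B := by
    intro H hH
    have p1 : (0:ℝ) ≤ (if N2p H d b then (3:ℝ) ^ m else 0) := by positivity
    have p2 : (0:ℝ) ≤ (if N3p H g r then (3:ℝ) ^ m else 0) := by positivity
    have p3 : (0:ℝ) ≤ (if ¬ Bal H then 3 / 2 * 2 ^ (m:ℝ) else 0) := by positivity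
    have hall : ((R.filter (fun w => rst w = H)).card : ℝ) ≤ (3:ℝ) ^ m := by
      have := hinto H Finset.univ (fun w _ _ => Finset.mem_univ _)
      rw [Finset.card_univ, Fintype.card_fun, card_sign, Fintype.card_fin] at this
      exact_mod_cast this
    by_cases hN2 : N2p H d b
    · rw [if_pos hN2] at p1 ⊢; linarith
    by_cases hN3 : N3p H g r
    · rw [if_pos hN3] at p2 ⊢; linarith
    by_cases hD : ∀ x, D ≤ dg H x
    swap
    · have : (R.filter (fun w => rst w = H)).card ≤ (∅ : Finset (Fin m → SignType)).card := by
        refine hinto H ∅ (fun w hw hwH => absurd (fun x => ?_) hD)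
        have q := (Finset.mem_filter.mp hw).2 x.succ
        have q2 : (dg w x.succ : ℝ) ≤ dg (rst w) x + 1 := by exact_mod_cast rst_dg w x
        rw [hwH] at q2
        linarith
      have h0 : ((R.filter (fun w => rst w = H)).card : ℝ) ≤ 0 := by exact_mod_cast this
      linarith
    have hHG := (Finset.mem_filter.mp hH).2
    obtain ⟨σ, o1, o2, o3⟩ := exists_opt H hHG
    have hb := hB H hH hD hN2 hN3 σ o1 o2
    by_cases hbal : Bal H
    · have h5 := hinto H (badExt H σ) (fun w hw hwH => by
        have hwU := Finset.mem_filter.mp (Finset.mem_filter.mp hw).1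
        have hwG := (Finset.mem_filter.mp hwU.1).2
        have h3 := o3 hbal
        subst hwH
        refine mem_badExt.mpr ⟨row_ext hwG, fun hs => hwU.2 (bal_of_sub hwG σ h3 hs),
          fun hs => hwU.2 (bal_of_sub hwG _ ?_ hs)⟩
        rw [tw_not]; exact h3)
      have h5' : ((R.filter (fun w => rst w = H)).card : ℝ) ≤ (badExt H σ).card := by
        exact_mod_cast h5
      linarith
    · obtain ⟨x, y, hxy⟩ : ∃ x y, tw σ H x y = -1 := by
        by_contra hcon
        push Not at hcon
        exact hbal ⟨σ, hcon⟩
      have h5 := hinto H (subExt H σ ∪ subExt H (fun x => !σ x) ∪ badExt H σ) (fun w hw hwH => by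
        have hwU := Finset.mem_filter.mp (Finset.mem_filter.mp hw).1
        have hwG := (Finset.mem_filter.mp hwU.1).2
        subst hwH
        have := row_ext hwG
        rw [Finset.mem_union, Finset.mem_union, mem_subExt, mem_subExt, mem_badExt]
        tauto)
      have h6 := sub_count H hHG.1 σ x y hxy
      have h7 := sub_count H hHG.1 (fun x => !σ x) x y (by rw [tw_not]; exact hxy)
      rw [Fintype.card_fin] at h6 h7
      have h8 := h5.trans ((Finset.card_union_le _ _).trans
        (Nat.add_le_add_right (Finset.card_union_le _ _) _))
      have h9 : ((R.filter (fun w => rst w = H)).card : ℝ) ≤ (subExt H σ).card +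
        (subExt H (fun x => !σ x)).card + (badExt H σ).card := by exact_mod_cast h8
      rw [if_pos hbal]
      linarith
  have hsum : (R.card : ℝ) ≤ ∑ H ∈ FS m, ((if N2p H d b then (3:ℝ) ^ m else 0) +
      (if N3p H g r then (3:ℝ) ^ m else 0) +
      (if ¬ Bal H then 3 / 2 * 2 ^ (m:ℝ) else 0) + B) := by
    rw [hfib]; push_cast
    exact Finset.sum_le_sum hone
  rw [Finset.sum_add_distrib, Finset.sum_add_distrib, Finset.sum_add_distrib, ← Finset.sum_filter,
    ← Finset.sum_filter, ← Finset.sum_filter] at hsum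
  simp only [Finset.sum_const, nsmul_eq_mul] at hsum
  have hU : US m = (FS m).filter (fun w => ¬ Bal w) := rfl
  rw [hU]
  linarith

end

end OB

namespace OB

section

open scoped Classical



lemma p2 (a b : ℝ) : (2:ℝ) ^ a * 2 ^ b = 2 ^ (a + b) := (Real.rpow_add (by norm_num) a b).symm

lemma p2le {a b : ℝ} (h : a ≤ b) : (2:ℝ) ^ a ≤ 2 ^ b :=
  Real.rpow_le_rpow_of_exponent_le (by norm_num) h

lemma T_pos (m : ℕ) : 0 < T m := by unfold T; positivity

lemma T_succ (m : ℕ) : T (m+1) = 2 ^ ((m:ℝ) + 1) * T m := by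
  unfold T
  rw [p2]; congr 1; push_cast; ring

def err (β ρ c : ℝ) (m : ℕ) : ℝ :=
  (m + 1) * 2 ^ (-(m:ℝ) / 2) + 2 ^ (4 * (m:ℝ) - 0.02 * β * m ^ 2) +
    2 ^ (4 * (m:ℝ) - ρ / 4 * m ^ 2) + (2 ^ (-(c / 2 * (m:ℝ))) + 2 * 2 ^ (1 - β / 4 * (m:ℝ)))

lemma tendsto_two_pow {f : ℕ → ℝ} (hf : Tendsto f atTop atBot) :
    Tendsto (fun m => (2:ℝ) ^ f m) atTop (nhds 0) :=
  (tendsto_rpow_atBot_of_base_gt_one 2 (by norm_num)).comp hf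

lemma lin_bot (C c : ℝ) (hc : 0 < c) : Tendsto (fun m : ℕ => C - c * (m:ℝ)) atTop atBot := by
  have h : Tendsto (fun m : ℕ => c * (m:ℝ)) atTop atTop :=
    tendsto_natCast_atTop_atTop.const_mul_atTop hc
  have h2 := tendsto_atBot_add_const_left atTop C (tendsto_neg_atTop_atBot.comp h)
  exact h2.congr (fun m => by simp [sub_eq_add_neg])

lemma quad_bot (C c : ℝ) (hc : 0 < c) :
    Tendsto (fun m : ℕ => C * (m:ℝ) - c * (m:ℝ) ^ 2) atTop atBot := by
  have h1 := lin_bot C c hc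
  have h2 := h1.atBot_mul_atTop₀ (tendsto_natCast_atTop_atTop (R := ℝ))
  exact h2.congr (fun m => by ring)

lemma err_tendsto (β ρ c : ℝ) (hβ : 0 < β) (hρ : 0 < ρ) (hc : 0 < c) :
    Tendsto (err β ρ c) atTop (nhds 0) := by
  have h1 : Tendsto (fun m : ℕ => ((m:ℝ) + 1) * 2 ^ (-(m:ℝ) / 2)) atTop (nhds 0) := by
    have hr0 : (0:ℝ) ≤ 2 ^ (-(1/2 : ℝ)) := by positivity
    have hr1 : (2:ℝ) ^ (-(1/2 : ℝ)) < 1 := Real.rpow_lt_one_of_one_lt_of_neg (by norm_num) (by norm_num)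
    have a := (tendsto_self_mul_const_pow_of_lt_one hr0 hr1).add
      (tendsto_pow_atTop_nhds_zero_of_lt_one hr0 hr1)
    rw [add_zero] at a
    refine a.congr (fun m => ?_)
    have : (2:ℝ) ^ (-(m:ℝ) / 2) = ((2:ℝ) ^ (-(1/2 : ℝ))) ^ m := by
      rw [← Real.rpow_natCast, ← Real.rpow_mul (by norm_num)]; congr 1; ring
    rw [this]; ring
  have h2 := tendsto_two_pow (quad_bot 4 (0.02 * β) (by positivity))
  have h3 := tendsto_two_pow (quad_bot 4 (ρ / 4) (by positivity))
  have h4 := tendsto_two_pow (lin_bot 0 (c / 2) (by positivity))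
  have h5 := (tendsto_two_pow (lin_bot 1 (β / 4) (by positivity))).const_mul 2
  have h := ((h1.add h2).add h3).add (h4.add h5)
  simp only [mul_zero, add_zero, zero_sub] at h
  exact h

set_option maxHeartbeats 2000000 in
lemma key_ineq : ∃ β ρ c : ℝ, 0 < β ∧ 0 < ρ ∧ 0 < c ∧ ∃ m0 : ℕ, ∀ m ≥ m0, ∀ M : ℝ, 1 ≤ M →
    (∀ k ≤ m, ((FS k).card : ℝ) ≤ M * T k) →
    ((US (m+1)).card : ℝ) ≤ (US m).card * (3 / 2 * 2 ^ (m:ℝ)) + M * err β ρ c m * T (m+1) := by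
  obtain ⟨δ1, hδ1, S1⟩ := sparse (1/2) (by norm_num)
  set β := min 1 δ1 with hβd
  have hβ : 0 < β := by positivity
  obtain ⟨δ2, hδ2, S2⟩ := sparse (0.01 * β) (by positivity)
  obtain ⟨ρ, hρ, S4⟩ := sparse (β / 4) (by positivity)
  obtain ⟨δ3, hδ3, S3⟩ := sparse (ρ / 4) (by positivity)
  set ε := δ3 / 8 with hε
  set c := min ε (β / 26) with hcd
  have hc : 0 < c := by positivity
  obtain ⟨δ5, hδ5, S5⟩ := sparse (c / 2) (by positivity)
  set δd := min (β / 16) (min (δ2 / 8) (δ3 / 8)) with hδd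
  have hd0 : 0 < δd := by positivity
  have e1 : β ≤ δ1 := min_le_right _ _
  have e2 : δd ≤ β / 16 := min_le_left _ _
  have e3 : δd ≤ δ2 / 8 := (min_le_right _ _).trans (min_le_left _ _)
  have e4 : δd ≤ δ3 / 8 := (min_le_right _ _).trans (min_le_right _ _)
  have e5 : c ≤ ε := min_le_left _ _
  have e6 : c ≤ β / 26 := min_le_right _ _
  refine ⟨β, ρ, c, hβ, hρ, hc, ⌈4 / β + 1 / δd + 2 / (δd * δ5) + 1⌉₊, fun m hm M hM1 hF => ?_⟩
  have hM : 0 ≤ M := zero_le_one.trans hM1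
  have hm' : 4 / β + 1 / δd + 2 / (δd * δ5) + 1 ≤ (m:ℝ) := (Nat.le_ceil _).trans (by exact_mod_cast hm)
  have q1 : 0 < 4 / β := by positivity
  have q2 : 0 < 1 / δd := by positivity
  have q3 : 0 < 2 / (δd * δ5) := by positivity
  have hm1 : (1:ℝ) ≤ m := by linarith
  have f1 : 4 ≤ β * m := by
    have : 4 / β ≤ m := by linarith
    rw [div_le_iff₀ hβ] at this; linarith
  have f2 : 1 ≤ δd * m := by
    have : 1 / δd ≤ m := by linarith
    rw [div_le_iff₀ hd0] at this; linarith
  have f3 : 2 / δd ≤ δ5 * m := by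
    have : 2 / (δd * δ5) ≤ m := by linarith
    rw [div_le_iff₀ (by positivity)] at this
    rw [div_le_iff₀ hd0]; linarith
  set d := ⌈δd * m⌉₊ with hd
  have d1 : δd * m ≤ d := Nat.le_ceil _
  have d2 : (d:ℝ) ≤ 2 * δd * m := by
    have : (d:ℝ) < δd * m + 1 := Nat.ceil_lt_add_one (by positivity)
    linarith
  have d3 : 0 < d := Nat.ceil_pos.mpr (by linarith)
  have d3' : (0:ℝ) < d := by exact_mod_cast d3
  set g := (2 * δd + 2 * ε) * (m:ℝ) ^ 2 with hg
  have cm : ((Fintype.card (Fin m) : ℕ) : ℝ) ≤ m := by simp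
  have cm2 : ((Fintype.card (Fin m × Fin m) : ℕ) : ℝ) ≤ (m:ℝ) ^ 2 := by simp [sq]
  have s1 := S1 (Fin m) m (β * m) cm (by gcongr)
  have s2 := S2 (Fin m × Fin m) ((m:ℝ) ^ 2) (2 * d * m) cm2 (by
    have : 2 * (d:ℝ) * m ≤ 2 * (2 * δd * m) * m := by gcongr
    have h2 : 4 * δd * (m:ℝ) ^ 2 ≤ δ2 * m ^ 2 := by gcongr; linarith
    nlinarith)
  have s3 := S3 (Fin m × Fin m) ((m:ℝ) ^ 2) (2 * g) cm2 (by
    have h2 : (4 * δd + 4 * ε) * (m:ℝ) ^ 2 ≤ δ3 * m ^ 2 := by gcongr; linarith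
    rw [hg]; linarith)
  have s4 := S4 (Fin m) m (ρ * m) cm le_rfl
  have s5 := S5 (Fin m) m (2 * m / d) cm (by
    refine le_trans ?_ f3
    rw [div_le_div_iff₀ d3' hd0]; nlinarith)
  set B : ℝ := (SP (Fin m) (2 * m / d)).card * 2 ^ ((m:ℝ) - c * m) +
      2 * ((SP (Fin m) (ρ * m)).card * 2 ^ ((m : ℝ) - (β * m - 1) / 2)) with hBd
  have hrec := rec_count m d (β * m) (β * m - 1) (β / 2 * m) g (ρ * m) B le_rfl (by positivity) (by
    intro H hH hD hN2 hN3 σ hσ hσ2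
    have := good_ext H d d3 (β / 2 * m) g (ρ * m) (ε * m) (β * m - 1) (c * m) hD hN2 hN3
      (by nlinarith) (by
        rw [Fintype.card_fin, hg]
        have : (m:ℝ) * (d + 2 * (ε * m)) ≤ m * (2 * δd * m + 2 * (ε * m)) := by gcongr
        linarith) (by gcongr) (by nlinarith) σ hσ hσ2
    rwa [Fintype.card_fin] at this)
  have hlow := low_count m (β * m)
  have hN2 := N2_count m d (β / 2 * m) M (by positivity) hM hF
  have hN3 := N3_count m g ρ hρ.le
  have hFm := hF m le_rfl
  have h4 : (4:ℝ) ^ (m:ℝ) = 2 ^ (2 * (m:ℝ)) := by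
    rw [Real.rpow_mul (by norm_num)]; norm_num
  have h3 : (3:ℝ) ^ m ≤ 2 ^ (2 * (m:ℝ)) := by
    rw [← h4, Real.rpow_natCast]; gcongr; norm_num
  rw [h4] at hN2 hN3
  -- low
  have t1 : (((FS (m+1)).filter (fun w => ∃ v, (dg w v : ℝ) ≤ β * m)).card : ℝ) ≤
      M * ((m + 1) * 2 ^ (-(m:ℝ) / 2)) * T (m+1) := by
    calc _ ≤ ((m:ℝ) + 1) * ((M * T m) * 2 ^ (1 / 2 * (m:ℝ))) := hlow.trans (by
          have := T_pos m
          gcongr)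
      _ ≤ ((m:ℝ) + 1) * ((M * T m) * (2 ^ (-(m:ℝ) / 2) * 2 ^ ((m:ℝ) + 1))) := by
          have := T_pos m
          gcongr
          rw [p2]
          exact Real.rpow_le_rpow_of_exponent_le (by norm_num) (by linarith)
      _ = _ := by rw [T_succ]; ring
  have t2 : (3:ℝ) ^ m * (((FS m).filter (fun w => N2p w d (β / 2 * m))).card : ℝ) ≤
      M * 2 ^ (4 * (m:ℝ) - 0.02 * β * m ^ 2) * T (m+1) := by
    calc _ ≤ 2 ^ (2 * (m:ℝ)) * (2 ^ (2 * (m:ℝ)) * (M * (2 ^ (0.01 * β * (m:ℝ) ^ 2) *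
          2 ^ (((m:ℝ) ^ 2 + m) / 2 - 1 - 0.06 * (β / 2 * m) * m)))) := by
          gcongr
          refine hN2.trans ?_
          gcongr
      _ = M * (2 ^ (2 * (m:ℝ)) * (2 ^ (2 * (m:ℝ)) * (2 ^ (0.01 * β * (m:ℝ) ^ 2) *
          2 ^ (((m:ℝ) ^ 2 + m) / 2 - 1 - 0.06 * (β / 2 * m) * m)))) := by ring
      _ ≤ M * (2 ^ (4 * (m:ℝ) - 0.02 * β * m ^ 2) * (2 ^ ((m:ℝ) + 1) * T m)) := by
          unfold T
          simp only [p2]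
          exact mul_le_mul_of_nonneg_left (p2le (by linarith)) hM
      _ = _ := by rw [T_succ]; ring
  have t3 : (3:ℝ) ^ m * (((FS m).filter (fun w => N3p w g (ρ * m))).card : ℝ) ≤
      M * 2 ^ (4 * (m:ℝ) - ρ / 4 * m ^ 2) * T (m+1) := by
    calc _ ≤ 2 ^ (2 * (m:ℝ)) * (2 ^ (2 * (m:ℝ)) * (2 ^ (ρ / 4 * (m:ℝ) ^ 2) *
          2 ^ (((m:ℝ) ^ 2 - m) / 2 - ρ * m ^ 2 / 2))) := by
          gcongr
          refine hN3.trans ?_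
          gcongr
      _ ≤ 1 * (2 ^ (4 * (m:ℝ) - ρ / 4 * m ^ 2) * (2 ^ ((m:ℝ) + 1) * T m)) := by
          unfold T
          simp only [p2, one_mul]
          exact p2le (by linarith)
      _ ≤ M * (2 ^ (4 * (m:ℝ) - ρ / 4 * m ^ 2) * (2 ^ ((m:ℝ) + 1) * T m)) := by
          have := T_pos m
          gcongr
      _ = _ := by rw [T_succ]; ring
  have t4 : ((FS m).card : ℝ) * B ≤
      M * (2 ^ (-(c / 2 * (m:ℝ))) + 2 * 2 ^ (1 - β / 4 * (m:ℝ))) * T (m+1) := by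
    have hB1 : B ≤ (2 ^ (-(c / 2 * (m:ℝ))) + 2 * 2 ^ (1 - β / 4 * (m:ℝ))) * 2 ^ ((m:ℝ) + 1) := by
      calc B ≤ 2 ^ (c / 2 * (m:ℝ)) * 2 ^ ((m:ℝ) - c * m) +
          2 * (2 ^ (β / 4 * (m:ℝ)) * 2 ^ ((m : ℝ) - (β * m - 1) / 2)) := by
            rw [hBd]; gcongr
        _ ≤ 2 ^ (-(c / 2 * (m:ℝ))) * 2 ^ ((m:ℝ) + 1) +
          2 * (2 ^ (1 - β / 4 * (m:ℝ)) * 2 ^ ((m:ℝ) + 1)) := by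
            simp only [p2]
            exact add_le_add (p2le (by linarith))
              (mul_le_mul_of_nonneg_left (p2le (by linarith)) (by norm_num))
        _ = _ := by ring
    have hB0 : 0 ≤ B := by positivity
    calc _ ≤ (M * T m) * ((2 ^ (-(c / 2 * (m:ℝ))) + 2 * 2 ^ (1 - β / 4 * (m:ℝ))) * 2 ^ ((m:ℝ) + 1)) := by
          have := T_pos m
          gcongr
      _ = _ := by rw [T_succ]; ring
  rw [err]
  linarith

end

end OB

namespace OB

section

open scoped Classical



def BS (n : ℕ) : Finset (Fin n → Fin n → SignType) := (FS n).filter Bal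

def sec {n : ℕ} (σ : Fin n → Bool) : Finset (Fin n → Fin n → SignType) :=
  (FS n).filter (fun w => ∀ x y, tw σ w x y ≠ -1)

lemma SP_zero (ι : Type) [Fintype ι] : ((SP ι (2 * 0)).card : ℝ) ≤ 1 := by
  have : SP ι (2 * 0) ⊆ {0} := by
    intro s hs
    have h := mem_SP.mp hs
    rw [mul_zero] at h
    have h2 : (supp s).card = 0 := by
      have : (supp s).card ≤ 0 := by exact_mod_cast h
      omega
    rw [Finset.card_eq_zero] at h2
    rw [Finset.mem_singleton]
    funext i
    by_contra hi
    have : i ∈ supp s := Finset.mem_filter.mpr ⟨Finset.mem_univ _, hi⟩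
    rw [h2] at this
    simp at this
  exact_mod_cast Finset.card_le_card this

lemma viol_zero {n : ℕ} {w : Fin n → Fin n → SignType} {σ : Fin n → Bool}
    (h : ∀ x y, tw σ w x y ≠ -1) : (viol w σ : ℝ) ≤ 0 := by
  have : viol w σ = 0 := by
    rw [viol]
    refine Finset.sum_eq_zero (fun x _ => ?_)
    rw [Finset.card_eq_zero, Finset.filter_eq_empty_iff]
    exact fun y _ => h x y
  rw [this]; simp

lemma sec_inter {n : ℕ} (σ τ : Fin n → Bool) :
    ((sec σ ∩ sec τ).card : ℝ) ≤
      2 ^ (((n:ℝ) ^ 2 - n) / 2 - (agree σ τ).card * (agree σ τ)ᶜ.card) := by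
  have h := two_section_count σ τ 0
  have h1 := SP_zero (Fin n × Fin n)
  have h2 : (sec σ ∩ sec τ) ⊆
      (FS n).filter (fun w => (viol w σ : ℝ) ≤ 0 ∧ (viol w τ : ℝ) ≤ 0) := by
    intro w hw
    rw [Finset.mem_inter, sec, sec, Finset.mem_filter, Finset.mem_filter] at hw
    exact Finset.mem_filter.mpr ⟨hw.1.1, viol_zero hw.1.2, viol_zero hw.2.2⟩
  have h3 : ((sec σ ∩ sec τ).card : ℝ) ≤
    ((FS n).filter (fun w => (viol w σ : ℝ) ≤ 0 ∧ (viol w τ : ℝ) ≤ 0)).card := by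
    exact_mod_cast Finset.card_le_card h2
  refine h3.trans (h.trans ?_)
  refine (mul_le_mul_of_nonneg_right h1 (by positivity)).trans (by rw [one_mul])

lemma sec_le {n : ℕ} (σ : Fin n → Bool) :
    ((sec σ).card : ℝ) ≤ 2 ^ (((n:ℝ) ^ 2 - n) / 2) := by
  have h := sec_inter σ σ
  rw [Finset.inter_self] at h
  have : agree σ σ = Finset.univ := by simp [agree]
  rw [this] at h
  simpa using h

lemma le_sec {n : ℕ} (σ : Fin n → Bool) :
    (2:ℝ) ^ (((n:ℝ) ^ 2 - n) / 2) ≤ (sec σ).card := by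
  have h := NC_card (Finset.univ : Finset (Fin n))
  simp only [Finset.compl_univ, Finset.card_empty, Nat.cast_zero, mul_zero, sub_zero] at h
  rw [← h, Real.rpow_natCast]
  have : (NC (Finset.univ : Finset (Fin n))).powerset.card ≤ (sec σ).card := by
    refine Finset.card_le_card_of_injOn (fun P x y =>
      if (x, y) ∈ P ∨ (y, x) ∈ P then sg (σ x) * sg (σ y) else 0) ?_ ?_
    · intro P hP
      have hP := Finset.mem_powerset.mp hP
      have hlt : ∀ x y, (x, y) ∈ P → x < y := fun x y h => (Finset.mem_filter.mp (hP h)).2.1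
      rw [Finset.mem_coe, sec, Finset.mem_filter]
      have htw : ∀ x y, tw σ (fun x y =>
          if (x, y) ∈ P ∨ (y, x) ∈ P then sg (σ x) * sg (σ y) else 0) x y ≠ -1 := by
        intro x y
        simp only [tw]
        generalize σ x = a; generalize σ y = b
        split_ifs
        · revert a b; decide
        · revert a b; decide
      refine ⟨Finset.mem_filter.mpr ⟨Finset.mem_univ _, ?_, ?_, ?_⟩, htw⟩
      · intro x
        have : (x, x) ∉ P := fun h => lt_irrefl _ (hlt _ _ h)
        simp [this]
      · intro x y
        simp only [or_comm, mul_comm]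
      · intro x y z
        beta_reduce
        generalize σ x = a; generalize σ y = b; generalize σ z = c
        split_ifs
        all_goals (revert a b c; decide)
    · intro P hP Q hQ heq
      have hP := Finset.mem_powerset.mp hP
      have hQ := Finset.mem_powerset.mp hQ
      have key : ∀ P Q : Finset (Fin n × Fin n), P ⊆ NC Finset.univ → Q ⊆ NC Finset.univ →
          (fun (x y : Fin n) => if (x, y) ∈ P ∨ (y, x) ∈ P then sg (σ x) * sg (σ y) else 0) =
          (fun (x y : Fin n) => if (x, y) ∈ Q ∨ (y, x) ∈ Q then sg (σ x) * sg (σ y) else 0) →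
          P ⊆ Q := by
        intro P Q hP hQ heq p hp
        obtain ⟨x, y⟩ := p
        have h1 := congrFun (congrFun heq x) y
        simp only [hp, true_or, if_true] at h1
        have hxy := (Finset.mem_filter.mp (hP hp)).2.1
        by_contra hn
        have hn2 : (y, x) ∉ Q := fun h =>
          absurd (Finset.mem_filter.mp (hQ h)).2.1 (not_lt.mpr (le_of_lt hxy))
        simp only [hn, hn2, or_self, if_false] at h1
        revert h1
        generalize σ x = a; generalize σ y = b
        revert a b; decide
      exact Finset.Subset.antisymm (key P Q hP hQ heq) (key Q P hQ hP heq.symm)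
  rw [Finset.card_powerset] at this
  exact_mod_cast this

def cs {m : ℕ} (τ : Fin m → Bool) : Fin (m+1) → Bool := Fin.cons true τ

lemma BS_eq (m : ℕ) : BS (m+1) = (Finset.univ : Finset (Fin m → Bool)).biUnion (fun τ => sec (cs τ)) := by
  ext w
  rw [BS, Finset.mem_filter, Finset.mem_biUnion]
  constructor
  · rintro ⟨hF, σ, hσ⟩
    by_cases h0 : σ 0 = true
    · refine ⟨fun i => σ i.succ, Finset.mem_univ _, Finset.mem_filter.mpr ⟨hF, ?_⟩⟩
      have : cs (fun i => σ i.succ) = σ := by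
        funext i; refine Fin.cases ?_ (fun j => ?_) i
        · simp [cs, h0]
        · simp [cs]
      rw [this]; exact hσ
    · refine ⟨fun i => !σ i.succ, Finset.mem_univ _, Finset.mem_filter.mpr ⟨hF, ?_⟩⟩
      have : cs (fun i => !σ i.succ) = fun x => !σ x := by
        funext i; refine Fin.cases ?_ (fun j => ?_) i
        · simp [cs, h0]
        · simp [cs]
      rw [this, tw_not]; exact hσ
  · rintro ⟨τ, -, hτ⟩
    obtain ⟨h1, h2⟩ := Finset.mem_filter.mp hτ
    exact ⟨h1, _, h2⟩

lemma T_succ' (m : ℕ) : T (m+1) = 2 ^ m * 2 ^ ((((m+1 : ℕ):ℝ) ^ 2 - (m+1 : ℕ)) / 2) := by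
  rw [T, ← Real.rpow_natCast 2 m, p2]; congr 1; push_cast; ring

lemma BS_le (m : ℕ) : ((BS (m+1)).card : ℝ) ≤ T (m+1) := by
  rw [BS_eq, T_succ']
  have h1 : (((Finset.univ : Finset (Fin m → Bool)).biUnion (fun τ => sec (cs τ))).card : ℝ) ≤
      ∑ τ : Fin m → Bool, ((sec (cs τ)).card : ℝ) := by
    exact_mod_cast Finset.card_biUnion_le
  refine h1.trans ((Finset.sum_le_sum (fun τ _ => sec_le (cs τ))).trans ?_)
  simp

lemma FS_split (n : ℕ) : ((FS n).card : ℝ) = (BS n).card + (US n).card := by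
  have := Finset.card_filter_add_card_filter_not (s := FS n) (p := Bal)
  rw [BS, US]
  exact_mod_cast this.symm

end

end OB

namespace OB

section

open scoped Classical



lemma contract {a e : ℕ → ℝ} (ha : ∀ m, 0 ≤ a m) (he : Tendsto e atTop (nhds 0)) (m0 : ℕ)
    (h : ∀ m ≥ m0, a (m+1) ≤ 3 / 4 * a m + e m) : Tendsto a atTop (nhds 0) := by
  rw [Metric.tendsto_atTop]
  intro ε hε
  obtain ⟨N1, hN1⟩ := eventually_atTop.mp (he.eventually (gt_mem_nhds (show (0:ℝ) < ε / 8 by positivity)))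
  set N := max m0 N1
  have hj : ∀ j, a (N + j) ≤ (3/4 : ℝ) ^ j * a N + ε / 2 := by
    intro j
    induction j with
    | zero => simp; linarith
    | succ j ih =>
      have h1 := h (N + j) ((le_max_left m0 N1).trans (Nat.le_add_right _ _))
      have h2 := hN1 (N + j) ((le_max_right m0 N1).trans (Nat.le_add_right _ _))
      rw [← add_assoc, pow_succ]
      linarith
  have ht : Tendsto (fun j => (3/4 : ℝ) ^ j * a N) atTop (nhds 0) := by
    have := (tendsto_pow_atTop_nhds_zero_of_lt_one (r := (3/4 : ℝ)) (by norm_num) (by norm_num)).mul_const (a N)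
    rwa [zero_mul] at this
  obtain ⟨J, hJ⟩ := eventually_atTop.mp (ht.eventually (gt_mem_nhds (show (0:ℝ) < ε / 2 by positivity)))
  refine ⟨N + J, fun n hn => ?_⟩
  obtain ⟨j, rfl⟩ := Nat.exists_eq_add_of_le ((Nat.le_add_right N J).trans hn)
  have h3 := hJ j (by omega)
  have h4 := hj j
  rw [Real.dist_eq, sub_zero, abs_of_nonneg (ha _)]
  linarith

set_option maxHeartbeats 2000000 in
lemma US_small : Tendsto (fun n => ((US n).card : ℝ) / T n) atTop (nhds 0) := by
  obtain ⟨β, ρ, c, hβ, hρ, hc, m0, hkey⟩ := key_ineq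
  have herr := err_tendsto β ρ c hβ hρ hc
  obtain ⟨u, hu⟩ : ∃ u : ℕ → ℝ, u = fun n => ((US n).card : ℝ) / T n := ⟨_, rfl⟩
  rw [← hu]
  have hstep : ∀ m ≥ m0, ∀ M : ℝ, 1 ≤ M → (∀ k ≤ m, ((FS k).card : ℝ) ≤ M * T k) →
      u (m+1) ≤ 3 / 4 * u m + M * err β ρ c m := by
    intro m hm M hM hF
    have h := hkey m hm M hM hF
    have hT := T_pos m
    have hT1 := T_pos (m+1)
    simp only [hu]
    rw [div_le_iff₀ hT1]
    refine h.trans (le_of_eq ?_)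
    have h2 : (2:ℝ) ^ ((m:ℝ) + 1) = 2 * 2 ^ (m:ℝ) := by
      rw [Real.rpow_add (by norm_num), Real.rpow_one]; ring
    rw [T_succ, h2]
    field_simp
    ring
  obtain ⟨N1, hN1⟩ := eventually_atTop.mp (herr.eventually (gt_mem_nhds (show (0:ℝ) < 1 / 8 by norm_num)))
  obtain ⟨m1, hm1⟩ : ∃ m1, m1 = max m0 N1 := ⟨_, rfl⟩
  have hm10 : m0 ≤ m1 := hm1 ▸ le_max_left _ _
  have hm1N : N1 ≤ m1 := hm1 ▸ le_max_right _ _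
  obtain ⟨M, hMd⟩ : ∃ M : ℝ, M = 2 + ∑ k ∈ Finset.range (m1 + 1), ((FS k).card : ℝ) / T k := ⟨_, rfl⟩
  have hpos : ∀ k, 0 ≤ ((FS k).card : ℝ) / T k := fun k => by have := T_pos k; positivity
  have hM2 : 2 ≤ M := by
    have : 0 ≤ ∑ k ∈ Finset.range (m1 + 1), ((FS k).card : ℝ) / T k :=
      Finset.sum_nonneg (fun k _ => hpos k)
    linarith
  have huF : ∀ k, u k ≤ ((FS k).card : ℝ) / T k := by
    intro k
    have := T_pos k
    simp only [hu]
    gcongr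
    exact Finset.filter_subset _ _
  have hP : ∀ m, u m ≤ M - 1 ∧ ((FS m).card : ℝ) ≤ M * T m := by
    intro m
    induction m using Nat.strong_induction_on with
    | _ m ih =>
      by_cases hm : m ≤ m1
      · have h1 : ((FS m).card : ℝ) / T m ≤ M - 2 := by
          have := Finset.single_le_sum (f := fun k => ((FS k).card : ℝ) / T k)
            (fun k _ => hpos k) (Finset.mem_range.mpr (Nat.lt_succ_of_le hm))
          simp only [Nat.succ_eq_add_one] at this
          linarith
        refine ⟨by linarith [huF m], ?_⟩
        have h2 : ((FS m).card : ℝ) / T m ≤ M := by linarith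
        rwa [div_le_iff₀ (T_pos m)] at h2
      · obtain ⟨j, rfl⟩ : ∃ j, m = j + 1 := ⟨m - 1, by omega⟩
        have hj : m1 ≤ j := by omega
        have h1 := hstep j (hm10.trans hj) M (by linarith)
          (fun k hk => (ih k (by omega)).2)
        have h2 := hN1 j (hm1N.trans hj)
        have h3 := (ih j (by omega)).1
        have h4 : M * err β ρ c j ≤ M * (1 / 8) :=
          mul_le_mul_of_nonneg_left h2.le (by linarith)
        have h5 : u (j+1) ≤ M - 1 := by linarith
        refine ⟨h5, ?_⟩
        have h6 := FS_split (j+1)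
        have h7 := BS_le j
        simp only [hu] at h5
        rw [div_le_iff₀ (T_pos _)] at h5
        linarith
  refine contract (e := fun m => M * err β ρ c m) (fun m => ?_) ?_ m0 (fun m hm => ?_)
  · have := T_pos m
    simp only [hu]; positivity
  · have := herr.const_mul M
    rwa [mul_zero] at this
  · exact hstep m hm M (by linarith) (fun k _ => (hP k).2)

lemma sum_q {m : ℕ} (τ : Fin m → Bool) (p q : ℝ) :
    ∑ τ' : Fin m → Bool, p ^ (Finset.univ.filter (fun x => τ x = τ' x)).card *
      q ^ (Finset.univ.filter (fun x => ¬ τ x = τ' x)).card = (p + q) ^ m := by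
  have h := Finset.prod_univ_sum (fun _ : Fin m => (Finset.univ : Finset Bool))
    (fun i a => if τ i = a then p else q)
  have h1 : ∀ i, ∑ a : Bool, (if τ i = a then p else q) = p + q := by
    intro i
    cases τ i <;> simp [add_comm]
  simp only [h1, Finset.prod_const, Finset.card_univ, Fintype.piFinset_univ, Fintype.card_fin] at h
  rw [h]
  refine Finset.sum_congr rfl (fun s _ => ?_)
  rw [Finset.prod_ite]
  simp

lemma agree_cs {m : ℕ} (τ τ' : Fin m → Bool) : (agree (cs τ) (cs τ')).card =
    (Finset.univ.filter (fun x => τ x = τ' x)).card + 1 := by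
  rw [agree, Fin.card_filter_univ_succ]
  simp [cs]

lemma agree_cs_compl {m : ℕ} (τ τ' : Fin m → Bool) : (agree (cs τ) (cs τ'))ᶜ.card =
    (Finset.univ.filter (fun x => ¬ τ x = τ' x)).card := by
  have h : (agree (cs τ) (cs τ'))ᶜ = Finset.univ.filter (fun x => ¬ cs τ x = cs τ' x) := by
    ext x; simp [agree]
  rw [h, Fin.card_filter_univ_succ]
  simp [cs]

lemma pow_split (n a k : ℕ) (hn : a + k = n) : (2:ℝ) ^ (-((a:ℝ) * k)) ≤
    ((2:ℝ) ^ (-(n:ℝ) / 2)) ^ k + ((2:ℝ) ^ (-(n:ℝ) / 2)) ^ a := by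
  have hn' : (a:ℝ) + k = n := by exact_mod_cast hn
  rw [← Real.rpow_natCast _ k, ← Real.rpow_natCast _ a, ← Real.rpow_mul (by norm_num),
    ← Real.rpow_mul (by norm_num)]
  have ha : (0:ℝ) ≤ a := Nat.cast_nonneg _
  have hk : (0:ℝ) ≤ k := Nat.cast_nonneg _
  have p1 : (0:ℝ) ≤ 2 ^ (-(n:ℝ) / 2 * k) := by positivity
  have p3 : (0:ℝ) ≤ 2 ^ (-(n:ℝ) / 2 * a) := by positivity
  rcases le_total (a:ℝ) k with h | h
  · have : (2:ℝ) ^ (-((a:ℝ) * k)) ≤ 2 ^ (-(n:ℝ) / 2 * a) := p2le (by nlinarith)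
    linarith
  · have : (2:ℝ) ^ (-((a:ℝ) * k)) ≤ 2 ^ (-(n:ℝ) / 2 * k) := p2le (by nlinarith)
    linarith

lemma le_BS (m : ℕ) :
    T (m+1) * (2 - (1 + (2:ℝ) ^ (-((m+1 : ℕ):ℝ) / 2)) ^ (m+1)) ≤ (BS (m+1)).card := by
  set q : ℝ := (2:ℝ) ^ (-((m+1 : ℕ):ℝ) / 2) with hq
  have hq0 : 0 ≤ q := by positivity
  set E : ℝ := 2 ^ ((((m+1 : ℕ):ℝ) ^ 2 - (m+1 : ℕ)) / 2) with hE
  have hE0 : 0 ≤ E := by positivity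
  set uq : (Fin m → Bool) → Finset (Fin (m+1) → Fin (m+1) → SignType) := fun τ =>
    sec (cs τ) \ (Finset.univ.erase τ).biUnion (fun τ' => sec (cs τ) ∩ sec (cs τ')) with huq
  have hdisj : ((Finset.univ : Finset (Fin m → Bool)) : Set (Fin m → Bool)).PairwiseDisjoint uq := by
    intro τ _ τ' _ hne
    rw [Function.onFun, Finset.disjoint_left]
    intro w hw hw'
    obtain ⟨h1, h2⟩ := Finset.mem_sdiff.mp hw
    obtain ⟨h1', -⟩ := Finset.mem_sdiff.mp hw'
    exact h2 (Finset.mem_biUnion.mpr ⟨τ', Finset.mem_erase.mpr ⟨hne.symm, Finset.mem_univ _⟩,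
      Finset.mem_inter.mpr ⟨h1, h1'⟩⟩)
  have hsub : Finset.univ.biUnion uq ⊆ BS (m+1) := by
    rw [BS_eq]
    exact Finset.biUnion_mono (fun τ _ => Finset.sdiff_subset)
  have hcard := Finset.card_le_card hsub
  rw [Finset.card_biUnion hdisj] at hcard
  have hcard' : ∑ τ, ((uq τ).card : ℝ) ≤ (BS (m+1)).card := by exact_mod_cast hcard
  refine le_trans ?_ hcard'
  have hone : ∀ τ, E * (2 - (1 + q) ^ (m+1)) ≤ ((uq τ).card : ℝ) := by
    intro τ
    have h1 : ((sec (cs τ)).card : ℝ) ≤ (uq τ).card +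
        ∑ τ' ∈ Finset.univ.erase τ, ((sec (cs τ) ∩ sec (cs τ')).card : ℝ) := by
      have a1 := Finset.le_card_sdiff ((Finset.univ.erase τ).biUnion
        (fun τ' => sec (cs τ) ∩ sec (cs τ'))) (sec (cs τ))
      have a2 : ((Finset.univ.erase τ).biUnion (fun τ' => sec (cs τ) ∩ sec (cs τ'))).card ≤
        ∑ τ' ∈ Finset.univ.erase τ, (sec (cs τ) ∩ sec (cs τ')).card := Finset.card_biUnion_le
      have a3 : (sec (cs τ)).card ≤ (uq τ).card +
        ∑ τ' ∈ Finset.univ.erase τ, (sec (cs τ) ∩ sec (cs τ')).card := by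
        simp only [huq]; omega
      exact_mod_cast a3
    have h2 : ∑ τ' ∈ Finset.univ.erase τ, ((sec (cs τ) ∩ sec (cs τ')).card : ℝ) ≤
        ∑ τ' ∈ Finset.univ.erase τ, E * (q ^ (Finset.univ.filter (fun x => ¬ τ x = τ' x)).card +
          q * q ^ (Finset.univ.filter (fun x => τ x = τ' x)).card) := by
      refine Finset.sum_le_sum (fun τ' _ => ?_)
      refine (sec_inter _ _).trans ?_
      have hsum : (agree (cs τ) (cs τ')).card + (agree (cs τ) (cs τ'))ᶜ.card = m + 1 := by
        rw [Finset.card_add_card_compl, Fintype.card_fin]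
      have h3 := pow_split (m+1) _ _ hsum
      rw [sub_eq_add_neg, ← p2]
      refine (mul_le_mul_of_nonneg_left h3 hE0).trans ?_
      rw [agree_cs_compl, agree_cs, pow_succ, mul_comm q]
    have h3 : ∑ τ' ∈ Finset.univ.erase τ, E * (q ^ (Finset.univ.filter (fun x => ¬ τ x = τ' x)).card +
          q * q ^ (Finset.univ.filter (fun x => τ x = τ' x)).card) ≤ E * ((1 + q) ^ (m+1) - 1) := by
      have s1 : ∑ τ' : Fin m → Bool, q ^ (Finset.univ.filter (fun x => ¬ τ x = τ' x)).card =
          (1 + q) ^ m := by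
        rw [← sum_q τ 1 q]; simp only [one_pow, one_mul]
      have s2 : ∑ τ' : Fin m → Bool, q ^ (Finset.univ.filter (fun x => τ x = τ' x)).card =
          (q + 1) ^ m := by
        rw [← sum_q τ q 1]; simp only [one_pow, mul_one]
      have s3 := Finset.add_sum_erase Finset.univ (fun τ' : Fin m → Bool =>
        E * (q ^ (Finset.univ.filter (fun x => ¬ τ x = τ' x)).card +
          q * q ^ (Finset.univ.filter (fun x => τ x = τ' x)).card)) (Finset.mem_univ τ)
      rw [← Finset.mul_sum (s := Finset.univ), Finset.sum_add_distrib, ← Finset.mul_sum (s := Finset.univ), s1, s2] at s3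
      simp only [not_true_eq_false, Finset.filter_false, Finset.card_empty, pow_zero] at s3
      have s4 : ∀ k : ℕ, 0 ≤ E * (q * q ^ k) := fun k => by positivity
      have s5 : E * ((1 + q) ^ m + q * (q + 1) ^ m) = E * (1 + q) ^ (m+1) := by
        rw [pow_succ, add_comm q 1]; ring
      rw [s5, mul_add] at s3
      have s6 := s4 (Finset.univ.filter (fun _ : Fin m => True)).card
      simp only [Finset.filter_true, Finset.card_univ] at s3 s6
      linarith
    have h4 := le_sec (cs τ)
    rw [← hE] at h4
    linarith
  calc T (m+1) * (2 - (1 + q) ^ (m+1)) = ∑ _τ : Fin m → Bool, E * (2 - (1 + q) ^ (m+1)) := by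
        rw [T_succ', ← hE]; simp; ring
    _ ≤ _ := Finset.sum_le_sum (fun τ _ => hone τ)

lemma one_add_tendsto : Tendsto (fun n : ℕ => (1 + (2:ℝ) ^ (-(n:ℝ) / 2)) ^ n) atTop (nhds 1) := by
  have hr0 : (0:ℝ) ≤ 2 ^ (-(1/2 : ℝ)) := by positivity
  have hr1 : (2:ℝ) ^ (-(1/2 : ℝ)) < 1 := Real.rpow_lt_one_of_one_lt_of_neg (by norm_num) (by norm_num)
  have a := (tendsto_self_mul_const_pow_of_lt_one hr0 hr1)
  have b := (Real.continuous_exp.tendsto 0).comp a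
  rw [Real.exp_zero] at b
  refine tendsto_of_tendsto_of_tendsto_of_le_of_le tendsto_const_nhds b (fun n => ?_) (fun n => ?_)
  · exact one_le_pow₀ (by have : (0:ℝ) ≤ 2 ^ (-(n:ℝ) / 2) := by positivity
                          linarith)
  · have : (2:ℝ) ^ (-(n:ℝ) / 2) = ((2:ℝ) ^ (-(1/2 : ℝ))) ^ n := by
      rw [← Real.rpow_natCast, ← Real.rpow_mul (by norm_num)]; congr 1; ring
    simp only [Function.comp]
    rw [← this, Real.exp_nat_mul]
    have h2 := Real.add_one_le_exp ((2:ℝ) ^ (-(n:ℝ) / 2))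
    gcongr
    linarith

lemma FS_tendsto : Tendsto (fun n => ((FS n).card : ℝ) / T n) atTop (nhds 1) := by
  have h1 : Tendsto (fun n : ℕ => 2 - (1 + (2:ℝ) ^ (-(n:ℝ) / 2)) ^ n) atTop (nhds 1) := by
    have := one_add_tendsto.const_sub 2
    norm_num at this
    exact this
  have h2 := US_small.const_add 1
  rw [add_zero] at h2
  refine tendsto_of_tendsto_of_tendsto_of_le_of_le' h1 h2 ?_ ?_
  · filter_upwards [eventually_ge_atTop 1] with n hn
    obtain ⟨m, rfl⟩ : ∃ m, n = m + 1 := ⟨n - 1, by omega⟩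
    rw [le_div_iff₀ (T_pos _), FS_split, mul_comm]
    have := le_BS m
    have h3 : (0:ℝ) ≤ (US (m+1)).card := Nat.cast_nonneg _
    linarith
  · filter_upwards [eventually_ge_atTop 1] with n hn
    obtain ⟨m, rfl⟩ : ∃ m, n = m + 1 := ⟨n - 1, by omega⟩
    have hT := T_pos (m+1)
    rw [FS_split, add_div]
    gcongr
    rw [div_le_one hT]
    exact BS_le m

end

end OB

namespace OB

section

open scoped Classical



def enc {n : ℕ} (G : ColoredGraph n) (x y : Fin n) : SignType :=
  if G.red.Adj x y then 1 else if G.blue.Adj x y then -1 else 0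

def dec {n : ℕ} (w : Fin n → Fin n → SignType) (h : IsG w) : ColoredGraph n where
  red := { Adj := fun x y => w x y = 1
           symm := ⟨fun x y hxy => by rw [h.2.1]; exact hxy⟩
           loopless := ⟨fun x hx => by rw [h.1] at hx; exact absurd hx (by decide)⟩ }
  blue := { Adj := fun x y => w x y = -1
            symm := ⟨fun x y hxy => by rw [h.2.1]; exact hxy⟩
            loopless := ⟨fun x hx => by rw [h.1] at hx; exact absurd hx (by decide)⟩ }
  disj := fun x y hxy => by
    obtain ⟨h1, h2⟩ := hxy
    change w x y = 1 at h1
    change w x y = -1 at h2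
    rw [h1] at h2
    exact absurd h2 (by decide)

lemma enc_red {n : ℕ} (G : ColoredGraph n) (x y : Fin n) : enc G x y = 1 ↔ G.red.Adj x y := by
  unfold enc; split_ifs <;> simp_all

lemma enc_blue {n : ℕ} (G : ColoredGraph n) (x y : Fin n) : enc G x y = -1 ↔ G.blue.Adj x y := by
  have := G.disj x y
  unfold enc; split_ifs <;> simp_all

lemma enc_adj {n : ℕ} (G : ColoredGraph n) (x y : Fin n) : enc G x y ≠ 0 ↔ G.Adj x y := by
  change _ ↔ (G.red ⊔ G.blue).Adj x y
  rw [SimpleGraph.sup_adj, ← enc_red, ← enc_blue]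
  cases enc G x y <;> decide

lemma blueInd_eq {n : ℕ} (G : ColoredGraph n) (x y : Fin n) :
    G.blueInd x y = if enc G x y = -1 then 1 else 0 := by
  unfold ColoredGraph.blueInd
  simp only [enc_blue]

lemma enc_inj {n : ℕ} : Function.Injective (enc (n := n)) := by
  intro G H h
  have h1 : G.red = H.red := by
    ext x y; rw [← enc_red, ← enc_red, h]
  have h2 : G.blue = H.blue := by
    ext x y; rw [← enc_blue, ← enc_blue, h]
  cases G; cases H
  simp_all

lemma sign_aux (a b c : SignType) : (a ≠ 0 → b ≠ 0 → c ≠ 0 →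
    ¬ Odd ((if a = -1 then 1 else 0) + (if b = -1 then 1 else 0) + (if c = -1 then 1 else 0) : ℕ)) ↔
    a * b * c ≠ -1 := by
  cases a <;> cases b <;> cases c <;> decide

lemma obtf_iff {n : ℕ} (G : ColoredGraph n) : G.OBTF ↔ IsG (enc G) := by
  have key : G.OBTF ↔ ∀ x y z, enc G x y * enc G y z * enc G x z ≠ -1 := by
    unfold ColoredGraph.OBTF
    refine forall_congr' fun x => forall_congr' fun y => forall_congr' fun z => ?_
    rw [← sign_aux, ← enc_adj, ← enc_adj, ← enc_adj, blueInd_eq, blueInd_eq, blueInd_eq]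
  rw [key]
  refine ⟨fun h => ⟨fun x => ?_, fun x y => ?_, h⟩, fun h => h.2.2⟩
  · simp [enc]
  · simp only [enc, G.red.adj_comm x y, G.blue.adj_comm x y]

lemma enc_dec {n : ℕ} (w : Fin n → Fin n → SignType) (h : IsG w) : enc (dec w h) = w := by
  funext x y
  have h1 : enc (dec w h) x y = 1 ↔ w x y = 1 := enc_red (dec w h) x y
  have h2 : enc (dec w h) x y = -1 ↔ w x y = -1 := enc_blue (dec w h) x y
  revert h1 h2
  generalize enc (dec w h) x y = a
  generalize w x y = b
  cases a <;> cases b <;> decide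

lemma Fnum_eq (n : ℕ) : Fnum n = (FS n).card := by
  unfold Fnum
  rw [← Set.ncard_image_of_injective _ (enc_inj (n := n)), ← Set.ncard_coe_finset]
  congr 1
  ext w
  simp only [Set.mem_image, Finset.mem_coe, FS, Finset.mem_filter, Finset.mem_univ, true_and]
  constructor
  · rintro ⟨G, hG, rfl⟩
    exact (obtf_iff G).mp hG
  · intro h
    refine ⟨dec w h, ?_, enc_dec w h⟩
    change (dec w h).OBTF
    rw [obtf_iff, enc_dec]
    exact h

lemma T_eq (n : ℕ) (hn : 1 ≤ n) : T n = (2 : ℝ) ^ (n * (n + 1) / 2 - 1) := by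
  unfold T
  obtain ⟨k, hk⟩ := (Nat.even_mul_succ_self n).two_dvd
  have hk1 : 1 ≤ k := by nlinarith
  have h1 : n * (n + 1) / 2 - 1 = k - 1 := by omega
  have h2 : (n : ℝ) * (n + 1) = 2 * k := by exact_mod_cast hk
  have h3 : ((n : ℝ) ^ 2 + n) / 2 - 1 = ((k - 1 : ℕ) : ℝ) := by
    rw [Nat.cast_sub hk1]
    push_cast
    linarith
  rw [h1, h3, Real.rpow_natCast]

lemma main : Tendsto (fun n : ℕ => (Fnum n : ℝ) / (2 : ℝ) ^ (n * (n + 1) / 2 - 1)) atTop (nhds 1) := by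
  refine FS_tendsto.congr' ?_
  filter_upwards [eventually_ge_atTop 1] with n hn
  rw [Fnum_eq, T_eq n hn]

end

end OB

/-- `F(n) = (1+o(1)) 2^{n(n+1)/2 - 1}`: almost all OBTF graphs are blue-bipartite. -/
theorem obtf_count :
    Tendsto (fun n : ℕ => (Fnum n : ℝ) / (2 : ℝ) ^ (n * (n + 1) / 2 - 1)) atTop (nhds 1) := by
  exact OB.main
end
end

section
/- There exist constants C > 0 and c > 0 such that, with s = ⌈C·log n⌉ (log base 2), for all sufficiently large n and every integer t with 1 ≤ t ≤ s: |{G ∈ 𝓕(n) : κ(G) ≥ t}| < 2^{(1−c)·s·n}·F(n−s) + 2^{(1−c)·n·⌈t/3⌉}·F(n−⌈t/3⌉). -/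
open Filter

noncomputable section

section Helpers

open Finset
open scoped Classical

namespace ColoredGraph

variable {n : ℕ}

/-- The color of a pair, as an `Option Bool` (`true` = blue). -/
def cl (G : ColoredGraph n) (x y : Fin n) : Option Bool :=
  if G.blue.Adj x y then some true else if G.red.Adj x y then some false else none

lemma cl_blue (G : ColoredGraph n) (x y : Fin n) : G.cl x y = some true ↔ G.blue.Adj x y := by
  unfold cl; split_ifs <;> simp_all

lemma cl_red (G : ColoredGraph n) (x y : Fin n) : G.cl x y = some false ↔ G.red.Adj x y := by
  have := G.disj x y
  unfold cl; split_ifs <;> simp_all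

lemma adj_iff (G : ColoredGraph n) (x y : Fin n) : G.Adj x y ↔ (G.red.Adj x y ∨ G.blue.Adj x y) := by
  simp [Adj, graph]

lemma cl_adj (G : ColoredGraph n) (x y : Fin n) : G.Adj x y ↔ G.cl x y ≠ none := by
  rw [adj_iff]; unfold cl; split_ifs <;> simp_all

lemma cl_adj' (G : ColoredGraph n) (x y : Fin n) : G.Adj x y ↔ ∃ a, G.cl x y = some a := by
  rw [cl_adj, Option.ne_none_iff_exists']

lemma cl_symm (G : ColoredGraph n) (x y : Fin n) : G.cl x y = G.cl y x := by
  unfold cl; simp only [G.blue.adj_comm x y, G.red.adj_comm x y]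

lemma adj_symm (G : ColoredGraph n) {x y : Fin n} (h : G.Adj x y) : G.Adj y x := by
  rw [cl_adj] at *; rwa [cl_symm]

lemma cl_self (G : ColoredGraph n) (x : Fin n) : G.cl x x = none := by
  unfold cl; simp

lemma cl_inj : Function.Injective (cl : ColoredGraph n → _) := by
  intro G G' h
  have hr : G.red = G'.red := by
    ext x y; rw [← cl_red, ← cl_red, h]
  have hb : G.blue = G'.blue := by
    ext x y; rw [← cl_blue, ← cl_blue, h]
  cases G; cases G'; simp_all

instance : Fintype (ColoredGraph n) := Fintype.ofInjective _ cl_inj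

lemma obtf_iff (G : ColoredGraph n) : G.OBTF ↔ ∀ x y z a b c, G.cl x y = some a →
    G.cl y z = some b → G.cl x z = some c → c = xor a b := by
  have key : ∀ x y a, G.cl x y = some a → G.blueInd x y = a.toNat := by
    intro x y a h
    unfold blueInd
    rw [← cl_blue, h]
    cases a <;> simp
  constructor
  · intro h x y z a b c h1 h2 h3
    have := h x y z ((cl_adj' _ _ _).2 ⟨_, h1⟩) ((cl_adj' _ _ _).2 ⟨_, h2⟩) ((cl_adj' _ _ _).2 ⟨_, h3⟩)
    rw [key _ _ _ h1, key _ _ _ h2, key _ _ _ h3] at this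
    revert this
    cases a <;> cases b <;> cases c <;> simp <;> decide
  · intro h x y z h1 h2 h3
    obtain ⟨a, ha⟩ := (cl_adj' _ _ _).1 h1
    obtain ⟨b, hb⟩ := (cl_adj' _ _ _).1 h2
    obtain ⟨c, hc⟩ := (cl_adj' _ _ _).1 h3
    have := h _ _ _ _ _ _ ha hb hc
    rw [key _ _ _ ha, key _ _ _ hb, key _ _ _ hc, this]
    cases a <;> cases b <;> simp

lemma bb_iff (G : ColoredGraph n) (A : Set (Fin n)) : G.BlueBipartiteOn A ↔
    ∃ u : Fin n → Bool, ∀ x ∈ A, ∀ y ∈ A, ∀ a, G.cl x y = some a → a = xor (u x) (u y) := by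
  constructor
  · rintro ⟨U, hU, h⟩
    refine ⟨fun x => decide (x ∈ U), fun x hx y hy a ha => ?_⟩
    have := h x hx y hy
    rw [← cl_blue, ← cl_red, ha] at this
    cases a <;> by_cases h1 : x ∈ U <;> by_cases h2 : y ∈ U <;> simp_all
  · rintro ⟨u, h⟩
    refine ⟨{x | x ∈ A ∧ u x = true}, fun x hx => hx.1, fun x hx y hy => ?_⟩
    constructor
    · intro hb
      have := h x hx y hy _ ((cl_blue _ _ _).2 hb)
      simp only [Set.mem_ofPred_eq, hx, hy, true_and]
      revert this
      cases u x <;> cases u y <;> simp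
    · intro hb
      have := h x hx y hy _ ((cl_red _ _ _).2 hb)
      simp only [Set.mem_ofPred_eq, hx, hy, true_and]
      revert this
      cases u x <;> cases u y <;> simp

/-- Pull back of a colored graph. -/
def pull {k : ℕ} (G : ColoredGraph n) (e : Fin k → Fin n) : ColoredGraph k where
  red := G.red.comap e
  blue := G.blue.comap e
  disj := fun x y => G.disj (e x) (e y)

lemma cl_pull {k : ℕ} (G : ColoredGraph n) (e : Fin k → Fin n) (i j : Fin k) :
    (G.pull e).cl i j = G.cl (e i) (e j) := rfl

lemma pull_obtf {k : ℕ} {G : ColoredGraph n} (h : G.OBTF) (e : Fin k → Fin n) : (G.pull e).OBTF := by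
  rw [obtf_iff] at *
  intro x y z
  exact h _ _ _

lemma kappa_mem (G : ColoredGraph n) :
    ∃ K : Set (Fin n), K.ncard = G.kappa ∧ G.BlueBipartiteOn Kᶜ := by
  have : G.kappa ∈ {k | ∃ K : Set (Fin n), K.ncard = k ∧ G.BlueBipartiteOn Kᶜ} := by
    apply Nat.sInf_mem
    refine ⟨_, Set.univ, rfl, ?_⟩
    rw [bb_iff]
    exact ⟨fun _ => true, by simp⟩
  exact this

lemma kappa_le (G : ColoredGraph n) (K : Set (Fin n)) (h : G.BlueBipartiteOn Kᶜ) :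
    G.kappa ≤ K.ncard := Nat.sInf_le ⟨K, rfl, h⟩

lemma kappa_zero (G : ColoredGraph n) : G.kappa = 0 ↔ G.BlueBipartite := by
  constructor
  · intro h
    obtain ⟨K, hK, h2⟩ := G.kappa_mem
    rw [h, Set.ncard_eq_zero] at hK
    subst hK
    simpa [BlueBipartite] using h2
  · intro h
    have := G.kappa_le ∅ (by simpa [BlueBipartite] using h)
    simpa using this

lemma kappa_pull {k r : ℕ} (G : ColoredGraph n) (e : Fin k → Fin n) (he : Function.Injective e)
    (x : Fin r → Fin n) (hc : ∀ v, (∃ i, e i = v) ∨ ∃ j, x j = v) :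
    G.kappa ≤ (G.pull e).kappa + r := by
  obtain ⟨K, hK, h2⟩ := (G.pull e).kappa_mem
  rw [bb_iff] at h2
  obtain ⟨u, hu⟩ := h2
  have h3 : G.BlueBipartiteOn (e '' K ∪ Set.range x)ᶜ := by
    rw [bb_iff]
    refine ⟨fun v => if h : ∃ i, e i = v then u h.choose else true, ?_⟩
    have key : ∀ v ∈ (e '' K ∪ Set.range x)ᶜ, ∃ i, e i = v ∧ i ∈ Kᶜ ∧
       (if h : ∃ i, e i = v then u h.choose else true) = u i := by
      intro v hv
      have h1 : ¬ ∃ j, x j = v := fun ⟨j, hj⟩ => hv (Or.inr ⟨j, hj⟩)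
      obtain ⟨i, hi⟩ := (hc v).resolve_right h1
      refine ⟨i, hi, fun hk => hv (Or.inl ⟨i, hk, hi⟩), ?_⟩
      have h4 : ∃ i, e i = v := ⟨i, hi⟩
      rw [dif_pos h4]
      congr 1
      exact he (h4.choose_spec.trans hi.symm)
    intro a ha b hb c hcl
    obtain ⟨i, hi, hiK, hi2⟩ := key a ha
    obtain ⟨j, hj, hjK, hj2⟩ := key b hb
    simp only [hi2, hj2]
    subst hi hj
    exact hu i hiK j hjK c hcl
  refine (G.kappa_le _ h3).trans ((Set.ncard_union_le _ _).trans ?_)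
  rw [Set.ncard_image_of_injective _ he, hK]
  gcongr
  rw [← Nat.card_coe_set_eq]
  simpa using Finite.card_range_le x

/-- A graph is determined by its restriction and the attachments. -/
lemma eq_of_pull {k r : ℕ} {G G' : ColoredGraph n} (e : Fin k → Fin n)
    (x : Fin r → Fin n) (hc : ∀ v, (∃ i, e i = v) ∨ ∃ j, x j = v)
    (h1 : G.pull e = G'.pull e) (h2 : ∀ i v, G.cl (x i) (e v) = G'.cl (x i) (e v))
    (h3 : ∀ i j, G.cl (x i) (x j) = G'.cl (x i) (x j)) : G = G' := by
  apply cl_inj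
  funext a b
  rcases hc a with ⟨i, rfl⟩ | ⟨i, rfl⟩ <;> rcases hc b with ⟨j, rfl⟩ | ⟨j, rfl⟩
  · rw [← cl_pull, ← cl_pull, h1]
  · rw [cl_symm, h2, cl_symm]
  · exact h2 _ _
  · exact h3 _ _

end ColoredGraph

open ColoredGraph

lemma count_weight {V α : Type*} [Fintype V] [Fintype α] (good : V → Finset α) (g : ℕ)
    (hg : ∀ v, (good v).card ≤ g) (a : ℕ) (z : ℝ) (hz : 0 < z) (hz1 : z ≤ 1) :
    ((univ.filter fun f : V → α => (univ.filter fun v => f v ∉ good v).card ≤ a).card : ℝ) * z ^ a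
      ≤ (g + Fintype.card α * z) ^ (Fintype.card V) := by
  set w : V → α → ℝ := fun v x => if x ∈ good v then 1 else z with hw
  have hw0 : ∀ v x, 0 ≤ w v x := by
    intro v x; simp only [hw]; split_ifs <;> positivity
  calc _ = ∑ f ∈ (univ.filter fun f : V → α => (univ.filter fun v => f v ∉ good v).card ≤ a), z ^ a := by
        simp
    _ ≤ ∑ f ∈ (univ.filter fun f : V → α => (univ.filter fun v => f v ∉ good v).card ≤ a),
          ∏ v, w v (f v) := by
        apply Finset.sum_le_sum
        intro f hf
        have : ∏ v, w v (f v) = z ^ (univ.filter fun v => f v ∉ good v).card := by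
          simp only [hw, Finset.prod_ite, Finset.prod_const, one_pow, one_mul]
        rw [this]
        exact pow_le_pow_of_le_one hz.le hz1 (by simpa using hf)
    _ ≤ ∑ f : V → α, ∏ v, w v (f v) := by
        apply Finset.sum_le_sum_of_subset_of_nonneg (Finset.subset_univ _)
        intro f _ _
        exact Finset.prod_nonneg fun v _ => hw0 _ _
    _ = ∏ v, ∑ x, w v x := by
        rw [Finset.prod_univ_sum]; simp
    _ ≤ ∏ v : V, ((g : ℝ) + Fintype.card α * z) := by
        apply Finset.prod_le_prod
        · intro v _; exact Finset.sum_nonneg fun x _ => hw0 _ _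
        · intro v _
          have : ∀ x, w v x ≤ (if x ∈ good v then 1 else 0) + z := by
            intro x; simp only [hw]; split_ifs <;> linarith
          refine (Finset.sum_le_sum fun x _ => this x).trans ?_
          rw [Finset.sum_add_distrib]
          simp only [Finset.sum_ite_mem, Finset.univ_inter, Finset.sum_const, Finset.card_univ,
            nsmul_eq_mul, mul_one]
          have := hg v
          gcongr
    _ = _ := by simp

/-- OBTF graphs with `t ≤ κ`. -/
def Ys (n t : ℕ) : Finset (ColoredGraph n) := univ.filter fun G => G.OBTF ∧ t ≤ G.kappa

lemma exists_split {n r : ℕ} (x : Fin r → Fin n) (hx : Function.Injective x) :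
    ∃ e : Fin (n - r) → Fin n, Function.Injective e ∧ (∀ i j, e i ≠ x j) ∧
      ∀ v, (∃ i, e i = v) ∨ ∃ j, x j = v := by
  have hcard : ((univ.image x)ᶜ).card = n - r := by
    rw [Finset.card_compl, Finset.card_image_of_injective _ hx]; simp
  refine ⟨(univ.image x)ᶜ.orderEmbOfFin hcard, RelEmbedding.injective _, ?_, ?_⟩
  · intro i j h
    have := (univ.image x)ᶜ.orderEmbOfFin_mem hcard i
    rw [h] at this
    simp at this
  · intro v
    by_cases h : v ∈ univ.image x
    · right; simpa using h
    · left
      have : v ∈ Set.range ((univ.image x)ᶜ.orderEmbOfFin hcard) := by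
        rw [Finset.range_orderEmbOfFin]; simpa using h
      exact this

lemma fiber_bound {n r t : ℕ} (x : Fin r → Fin n) (hx : Function.Injective x)
    (S : Finset (ColoredGraph n)) (hS : S ⊆ Ys n t) (M : ℝ)
    (h : ∀ e : Fin (n - r) → Fin n, Function.Injective e → (∀ i j, e i ≠ x j) →
      (∀ v, (∃ i, e i = v) ∨ ∃ j, x j = v) → ∀ H, ((S.filter fun G => G.pull e = H).card : ℝ) ≤ M) :
    (S.card : ℝ) ≤ M * (Ys (n - r) (t - r)).card := by
  obtain ⟨e, he, hd, hc⟩ := exists_split x hx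
  have h1 := h e he hd hc
  have hmap : ∀ G ∈ S, G.pull e ∈ Ys (n - r) (t - r) := by
    intro G hG
    have := hS hG
    simp only [Ys, mem_filter, mem_univ, true_and] at this ⊢
    refine ⟨pull_obtf this.1 e, ?_⟩
    have := kappa_pull G e he x hc
    omega
  rw [Finset.card_eq_sum_card_fiberwise hmap]
  push_cast
  calc _ ≤ ∑ H ∈ Ys (n - r) (t - r), M := Finset.sum_le_sum fun H _ => h1 H
    _ = _ := by simp [mul_comm]

lemma count_weight' {V α : Type*} [Fintype V] [Fintype α] (good : V → Finset α) (g : ℕ)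
    (hg : ∀ v, (good v).card ≤ g) (a : ℕ) (N : ℝ) (hN : 1 ≤ N) :
    ((univ.filter fun f : V → α => (univ.filter fun v => f v ∉ good v).card ≤ a).card : ℝ)
      ≤ N ^ a * (g + Fintype.card α * N⁻¹) ^ (Fintype.card V) := by
  have h := count_weight good g hg a N⁻¹ (by positivity) (inv_le_one_of_one_le₀ hN)
  rw [inv_pow, mul_inv_le_iff₀ (by positivity)] at h
  linarith

/-- Bad pairs. -/
def TypeA {n : ℕ} (G : ColoredGraph n) (x y : Fin n) : Prop :=
  x ≠ y ∧ ∃ J : Finset (Fin n), x ∉ J ∧ y ∉ J ∧ J.card ≤ 1000 ∧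
    (univ.filter fun v => if (∃ j ∈ J, G.Adj j v) then G.Adj x v else G.Adj y v).card * 500 ≤ n

lemma small_sets (k K : ℕ) : ((univ.filter fun J : Finset (Fin k) => J.card ≤ K).card : ℝ) ≤
    100 ^ K * (1.02 : ℝ) ^ k := by
  have h := count_weight' (V := Fin k) (α := Bool) (fun _ => {false}) 1 (by simp) K 100 (by norm_num)
  have e : ((1 : ℕ) : ℝ) + (Fintype.card Bool : ℝ) * (100 : ℝ)⁻¹ = 1.02 := by norm_num
  rw [e, Fintype.card_fin] at h
  refine le_trans ?_ h
  norm_cast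
  apply Finset.card_le_card_of_injOn (fun J v => decide (v ∈ J))
  · intro J hJ
    simpa using hJ
  · intro J _ J' _ hJ
    ext v
    have := congrFun hJ v
    simpa using this

/-- A large constant. -/
@[irreducible] def KA : ℝ := 100 ^ 1000

lemma KA_pos : 0 < KA := by unfold KA; positivity

lemma typeA_fiber {n : ℕ} (x : Fin 2 → Fin n)
    (e : Fin (n - 2) → Fin n) (he : Function.Injective e) (hd : ∀ i j, e i ≠ x j)
    (hc : ∀ v, (∃ i, e i = v) ∨ ∃ j, x j = v) (H : ColoredGraph (n - 2)) :
    ((univ.filter fun G : ColoredGraph n => TypeA G (x 0) (x 1) ∧ G.pull e = H).card : ℝ) ≤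
      81 * KA * (3.2 : ℝ) ^ n := by
  set Js := univ.filter fun J : Finset (Fin (n - 2)) => J.card ≤ 1000 with hJs
  let good : Finset (Fin (n - 2)) → Fin (n - 2) → Finset (Fin 2 → Option Bool) := fun J v =>
    if (∃ j ∈ J, H.Adj j v) then univ.filter (fun f => f 0 = none) else univ.filter (fun f => f 1 = none)
  have hgood : ∀ J v, (good J v).card ≤ 3 := by
    intro J v
    simp only [good]
    split_ifs <;> decide +revert
  let Fs : Finset (Fin (n - 2)) → Finset (Fin (n - 2) → Fin 2 → Option Bool) := fun J =>
    univ.filter fun f => (univ.filter fun v => f v ∉ good J v).card ≤ n / 500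
  let T : Finset (Fin (n - 2)) → Finset (ColoredGraph n) := fun J =>
    univ.filter fun G => G.pull e = H ∧ (fun v i => G.cl (x i) (e v)) ∈ Fs J
  have hsub : (univ.filter fun G : ColoredGraph n => TypeA G (x 0) (x 1) ∧ G.pull e = H) ⊆
      Js.biUnion T := by
    intro G hG
    simp only [mem_filter, mem_univ, true_and] at hG
    obtain ⟨⟨hxy, J, hxJ, hyJ, hJc, hJ⟩, hH⟩ := hG
    simp only [mem_biUnion]
    refine ⟨univ.filter fun i => e i ∈ J, ?_, ?_⟩
    · simp only [hJs, mem_filter, mem_univ, true_and]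
      refine le_trans ?_ hJc
      apply Finset.card_le_card_of_injOn e
      · intro i hi; simpa using hi
      · exact he.injOn
    · simp only [T, Fs, mem_filter, mem_univ, true_and, hH]
      rw [Nat.le_div_iff_mul_le (by norm_num)]
      refine le_trans (Nat.mul_le_mul_right _ ?_) hJ
      apply Finset.card_le_card_of_injOn e
      · intro v hv
        have hadj : ∀ a b, H.Adj a b ↔ G.Adj (e a) (e b) := by
          intro a b; rw [cl_adj, cl_adj, ← hH, cl_pull]
        have hiff : (∃ j ∈ (univ.filter fun i => e i ∈ J), H.Adj j v) ↔ ∃ j ∈ J, G.Adj j (e v) := by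
          constructor
          · rintro ⟨j, hj, hjv⟩
            exact ⟨e j, by simpa using hj, (hadj _ _).1 hjv⟩
          · rintro ⟨j, hj, hjv⟩
            rcases hc j with ⟨i, rfl⟩ | ⟨i, rfl⟩
            · exact ⟨i, by simpa using hj, (hadj _ _).2 hjv⟩
            · fin_cases i
              · exact absurd hj hxJ
              · exact absurd hj hyJ
        simp only [coe_filter, mem_univ, true_and, Set.mem_ofPred_eq, good] at hv ⊢
        by_cases h1 : ∃ j ∈ J, G.Adj j (e v)
        · rw [if_pos (hiff.2 h1)] at hv
          rw [if_pos h1]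
          simpa [cl_adj] using hv
        · rw [if_neg (fun h => h1 (hiff.1 h))] at hv
          rw [if_neg h1]
          simpa [cl_adj] using hv
      · exact he.injOn
  have hF : ∀ J, ((Fs J).card : ℝ) ≤ 100 ^ (n / 500) * (3.09 : ℝ) ^ (n - 2) := by
    intro J
    have h := count_weight' (good J) 3 (hgood J) (n / 500) 100 (by norm_num)
    have e : ((3 : ℕ) : ℝ) + (Fintype.card (Fin 2 → Option Bool) : ℝ) * (100 : ℝ)⁻¹ = 3.09 := by
      simp; norm_num
    rw [e, Fintype.card_fin] at h
    convert h
  have hT : ∀ J, ((T J).card : ℝ) ≤ (Fs J).card * 81 := by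
    intro J
    have : (T J).card ≤ ((Fs J) ×ˢ (univ : Finset (Fin 2 → Fin 2 → Option Bool))).card := by
      apply Finset.card_le_card_of_injOn
        (fun G => ((fun v i => G.cl (x i) (e v)), fun i j => G.cl (x i) (x j)))
      · intro G hG
        simp only [T, coe_filter, mem_univ, true_and, Set.mem_ofPred_eq] at hG
        simpa using hG.2
      · intro G hG G' hG' h
        simp only [T, coe_filter, mem_univ, true_and, Set.mem_ofPred_eq] at hG hG'
        simp only [Prod.mk.injEq] at h
        exact eq_of_pull e x hc (hG.1.trans hG'.1.symm) (fun i v => congrFun (congrFun h.1 v) i)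
          (fun i j => congrFun (congrFun h.2 i) j)
    rw [Finset.card_product] at this
    have h2 : (univ : Finset (Fin 2 → Fin 2 → Option Bool)).card = 81 := by simp
    rw [h2] at this
    exact_mod_cast this
  have hJcard : (Js.card : ℝ) ≤ KA * 1.02 ^ (n - 2) := by
    have := small_sets (n - 2) 1000
    rw [← KA] at this
    exact this
  have hpow : (100 : ℝ) ^ (n / 500) ≤ 1.01 ^ n := by
    calc (100 : ℝ) ^ (n / 500) ≤ ((1.01 : ℝ) ^ 500) ^ (n / 500) := by
          have h1 : (2.6 : ℝ) ≤ 1.01 ^ 100 := by norm_num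
          have h2 : (100 : ℝ) ≤ 1.01 ^ 500 := by
            calc (100 : ℝ) ≤ 2.6 ^ 5 := by norm_num
              _ ≤ (1.01 ^ 100) ^ 5 := by gcongr
              _ = 1.01 ^ 500 := by rw [← pow_mul]
          exact pow_le_pow_left₀ (by norm_num) h2 _
      _ = 1.01 ^ (500 * (n / 500)) := by rw [pow_mul]
      _ ≤ 1.01 ^ n := by
          apply pow_le_pow_right₀ (by norm_num); omega
  calc _ ≤ ((Js.biUnion T).card : ℝ) := by exact_mod_cast Finset.card_le_card hsub
    _ ≤ ∑ J ∈ Js, ((T J).card : ℝ) := by exact_mod_cast Finset.card_biUnion_le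
    _ ≤ ∑ J ∈ Js, (1.01 ^ n * (3.09 : ℝ) ^ n * 81) := by
        apply Finset.sum_le_sum
        intro J _
        refine (hT J).trans ?_
        have h3 : (3.09 : ℝ) ^ (n - 2) ≤ 3.09 ^ n := pow_le_pow_right₀ (by norm_num) (by omega)
        have := hF J
        gcongr
        refine this.trans ?_
        gcongr
    _ = Js.card * (1.01 ^ n * (3.09 : ℝ) ^ n * 81) := by simp
    _ ≤ (KA * (1.02 : ℝ) ^ n) * (1.01 ^ n * (3.09 : ℝ) ^ n * 81) := by
        have h3 : (1.02 : ℝ) ^ (n - 2) ≤ 1.02 ^ n := pow_le_pow_right₀ (by norm_num) (by omega)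
        refine mul_le_mul_of_nonneg_right (hJcard.trans ?_) ?_
        · exact mul_le_mul_of_nonneg_left h3 KA_pos.le
        · positivity
    _ = 81 * KA * (1.02 * 1.01 * 3.09 : ℝ) ^ n := by
        rw [mul_pow, mul_pow]; ring
    _ ≤ _ := by
        have h5 := KA_pos
        refine mul_le_mul_of_nonneg_left ?_ (mul_pos (by norm_num) h5).le
        exact pow_le_pow_left₀ (by norm_num) (by norm_num) _

lemma typeA_count (n t : ℕ) :
    (((Ys n t).filter fun G => ∃ x y, TypeA G x y).card : ℝ) ≤
      n ^ 2 * (81 * KA * (3.2 : ℝ) ^ n * (Ys (n - 2) (t - 2)).card) := by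
  let S : Fin n × Fin n → Finset (ColoredGraph n) := fun p =>
    (Ys n t).filter fun G => TypeA G p.1 p.2
  have hsub : ((Ys n t).filter fun G => ∃ x y, TypeA G x y) ⊆ univ.biUnion S := by
    intro G hG
    simp only [mem_filter] at hG
    obtain ⟨hG, x, y, hxy⟩ := hG
    simp only [mem_biUnion, S, mem_filter, mem_univ, true_and]
    exact ⟨(x, y), hG, hxy⟩
  have hS : ∀ p, ((S p).card : ℝ) ≤ 81 * KA * (3.2 : ℝ) ^ n * (Ys (n - 2) (t - 2)).card := by
    intro p
    by_cases hp : p.1 = p.2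
    · have : S p = ∅ := by
        ext G; simp [S, TypeA, hp]
      rw [this]; simp only [card_empty, Nat.cast_zero]; have := KA_pos; positivity
    · refine fiber_bound (r := 2) ![p.1, p.2] ?_ (S p) (Finset.filter_subset _ _) _ ?_
      · intro i j h
        fin_cases i <;> fin_cases j <;> simp_all
      · intro e he hd hc H
        refine le_trans ?_ (typeA_fiber ![p.1, p.2] e he hd hc H)
        norm_cast
        apply Finset.card_le_card
        intro G hG
        simp only [S, mem_filter, mem_univ, true_and] at hG ⊢
        exact ⟨hG.1.2, hG.2⟩
  calc _ ≤ ((univ.biUnion S).card : ℝ) := by exact_mod_cast Finset.card_le_card hsub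
    _ ≤ ∑ p, ((S p).card : ℝ) := by exact_mod_cast Finset.card_biUnion_le
    _ ≤ ∑ p : Fin n × Fin n, (81 * KA * (3.2 : ℝ) ^ n * (Ys (n - 2) (t - 2)).card) :=
        Finset.sum_le_sum fun p _ => hS p
    _ = _ := by
        rw [Finset.sum_const, Finset.card_univ, Fintype.card_prod, Fintype.card_fin, nsmul_eq_mul]
        push_cast; ring

lemma low_few {n : ℕ} (G : ColoredGraph n) (hA : ¬ ∃ x y, TypeA G x y) (x : Fin n) :
    (univ.filter fun y => G.Adj x y ∧
      (univ.filter fun v => G.Adj x v ∧ G.Adj y v).card * 1000000 ≤ n).card ≤ 1000 := by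
  have hn : 0 < n := x.pos
  set Y := univ.filter fun y => G.Adj x y ∧
      (univ.filter fun v => G.Adj x v ∧ G.Adj y v).card * 1000000 ≤ n with hY
  let Γ : Finset (Fin n) → Finset (Fin n) := fun J => univ.filter fun v => ∃ j ∈ J, G.Adj j v
  let 𝒥 := Y.powerset.filter fun J => J.card * n ≤ (Γ J).card * 1000
  have hne : 𝒥.Nonempty := ⟨∅, by simp [𝒥]⟩
  obtain ⟨J, hJ, hmax⟩ := Finset.exists_max_image 𝒥 Finset.card hne
  simp only [𝒥, mem_filter, mem_powerset] at hJ hmax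
  obtain ⟨hJY, hJc⟩ := hJ
  have hJ1000 : J.card ≤ 1000 := by
    have h1 : (Γ J).card ≤ n := by simpa using Finset.card_le_univ (Γ J)
    have h2 : J.card * n ≤ 1000 * n := by omega
    exact Nat.le_of_mul_le_mul_right h2 hn
  by_cases hsub : Y ⊆ J
  · exact (Finset.card_le_card hsub).trans hJ1000
  exfalso
  obtain ⟨y, hyY, hyJ⟩ := Finset.not_subset.1 hsub
  have hyY' := hyY
  simp only [hY, mem_filter, mem_univ, true_and] at hyY'
  have hlt : (Γ (insert y J)).card * 1000 < (J.card + 1) * n := by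
    by_contra hcon
    have := hmax (insert y J) ⟨Finset.insert_subset hyY hJY, by
      rw [Finset.card_insert_of_notMem hyJ]; omega⟩
    rw [Finset.card_insert_of_notMem hyJ] at this
    omega
  have hsum : (Γ J).card + (univ.filter fun v => v ∉ Γ J ∧ G.Adj y v).card ≤
      (Γ (insert y J)).card := by
    rw [← Finset.card_union_of_disjoint]
    · apply Finset.card_le_card
      intro v hv
      simp only [Γ, mem_union, mem_filter, mem_univ, true_and, mem_insert] at hv ⊢
      rcases hv with ⟨j, hj, hv⟩ | hv
      · exact ⟨j, Or.inr hj, hv⟩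
      · exact ⟨y, Or.inl rfl, hv.2⟩
    · rw [Finset.disjoint_left]
      intro v hv hv2
      simp only [mem_filter, mem_univ, true_and] at hv2
      exact hv2.1 hv
  have hE1 : (univ.filter fun v => v ∈ Γ J ∧ G.Adj x v).card * 1000000 ≤ 1000 * n := by
    have h1 : (univ.filter fun v => v ∈ Γ J ∧ G.Adj x v) ⊆
        J.biUnion fun j => univ.filter fun v => G.Adj x v ∧ G.Adj j v := by
      intro v hv
      simp only [Γ, mem_filter, mem_univ, true_and, mem_biUnion] at hv ⊢
      obtain ⟨⟨j, hj, hjv⟩, hxv⟩ := hv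
      exact ⟨j, hj, hxv, hjv⟩
    have h2 := (Finset.card_le_card h1).trans Finset.card_biUnion_le
    calc _ ≤ (∑ j ∈ J, (univ.filter fun v => G.Adj x v ∧ G.Adj j v).card) * 1000000 :=
          Nat.mul_le_mul_right _ h2
      _ = ∑ j ∈ J, (univ.filter fun v => G.Adj x v ∧ G.Adj j v).card * 1000000 := by
          rw [Finset.sum_mul]
      _ ≤ ∑ j ∈ J, n := by
          apply Finset.sum_le_sum
          intro j hj
          have := hJY hj
          simp only [hY, mem_filter, mem_univ, true_and] at this
          exact this.2
      _ = J.card * n := by simp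
      _ ≤ 1000 * n := Nat.mul_le_mul_right _ hJ1000
  apply hA
  refine ⟨x, y, ?_, J, ?_, hyJ, hJ1000, ?_⟩
  · rintro rfl
    have := hyY'.1
    rw [cl_adj, cl_self] at this
    exact this rfl
  · intro hxJ
    have := hJY hxJ
    simp only [hY, mem_filter, mem_univ, true_and] at this
    have := this.1
    rw [cl_adj, cl_self] at this
    exact this rfl
  · have h1 : (univ.filter fun v => if (∃ j ∈ J, G.Adj j v) then G.Adj x v else G.Adj y v) ⊆
      (univ.filter fun v => v ∈ Γ J ∧ G.Adj x v) ∪ (univ.filter fun v => v ∉ Γ J ∧ G.Adj y v) := by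
      intro v hv
      simp only [Γ, mem_filter, mem_univ, true_and, mem_union] at hv ⊢
      by_cases h : ∃ j ∈ J, G.Adj j v
      · rw [if_pos h] at hv; exact Or.inl ⟨h, hv⟩
      · rw [if_neg h] at hv; exact Or.inr ⟨h, hv⟩
    have h2 := (Finset.card_le_card h1).trans (Finset.card_union_le _ _)
    have h3 : (univ.filter fun v => v ∉ Γ J ∧ G.Adj y v).card * 1000 < n := by
      rw [add_mul, one_mul] at hlt
      linarith
    linarith

/-- Size of the determining sets. -/
@[irreducible] def KD : ℕ := 2001000

lemma KD_eq : KD = 2001000 := by unfold KD; rfl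

lemma exists_D {n : ℕ} (G : ColoredGraph n) (hA : ¬ ∃ x y, TypeA G x y) (hn : 8000000 ≤ n)
    (x : Fin 4 → Fin n) (e : Fin (n - 4) → Fin n) (he : Function.Injective e)
    (hc : ∀ v, (∃ i, e i = v) ∨ ∃ j, x j = v) (p : Fin n) :
    ∃ D : Finset (Fin (n - 4)), D.card ≤ KD ∧ (∀ d ∈ D, G.Adj p (e d)) ∧
      ∀ z, G.Adj p (e z) → z ∈ D ∨ ∃ d ∈ D, ∃ u, G.Adj p (e u) ∧ G.Adj (e d) (e u) ∧
        G.Adj (e z) (e u) := by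
  let P : Fin (n - 4) → Finset (Fin (n - 4)) := fun z =>
    univ.filter fun u => G.Adj p (e u) ∧ G.Adj (e z) (e u)
  let Low : Finset (Fin (n - 4)) := univ.filter fun z => G.Adj p (e z) ∧
      (univ.filter fun v => G.Adj p v ∧ G.Adj (e z) v).card * 1000000 ≤ n
  let High : Finset (Fin (n - 4)) := univ.filter fun z => G.Adj p (e z) ∧
      n < (univ.filter fun v => G.Adj p v ∧ G.Adj (e z) v).card * 1000000
  have hLow : Low.card ≤ 1000 := by
    refine le_trans ?_ (low_few G hA p)
    apply Finset.card_le_card_of_injOn e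
    · intro z hz; simpa [Low] using hz
    · exact he.injOn
  have hP : ∀ z ∈ High, n ≤ (P z).card * 2000000 := by
    intro z hz
    simp only [High, mem_filter, mem_univ, true_and] at hz
    have h1 : (univ.filter fun v => G.Adj p v ∧ G.Adj (e z) v) ⊆ (P z).image e ∪ univ.image x := by
      intro v hv
      simp only [P, mem_filter, mem_univ, true_and, mem_union, mem_image] at hv ⊢
      rcases hc v with ⟨i, rfl⟩ | ⟨j, rfl⟩
      · exact Or.inl ⟨i, hv, rfl⟩
      · exact Or.inr ⟨j, rfl⟩
    have h2 := (Finset.card_le_card h1).trans (Finset.card_union_le _ _)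
    have h3 : ((P z).image e).card ≤ (P z).card := Finset.card_image_le
    have h4 : (univ.image x).card ≤ 4 := by
      simpa using (Finset.card_image_le (s := (univ : Finset (Fin 4))) (f := x))
    omega
  let 𝒟 := High.powerset.filter fun D : Finset (Fin (n - 4)) => (D : Set (Fin (n - 4))).PairwiseDisjoint P
  have hne : 𝒟.Nonempty := ⟨∅, by simp [𝒟]⟩
  obtain ⟨D, hD, hmax⟩ := Finset.exists_max_image 𝒟 Finset.card hne
  simp only [𝒟, mem_filter, mem_powerset] at hD hmax
  obtain ⟨hDH, hDd⟩ := hD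
  have hDc : D.card ≤ 2000000 := by
    have h1 := Finset.card_biUnion (s := D) (t := P) hDd
    have h2 : (D.biUnion P).card ≤ n := by
      have := Finset.card_le_univ (D.biUnion P)
      rw [Fintype.card_fin] at this
      omega
    have h3 : D.card * n ≤ 2000000 * n := by
      calc D.card * n = ∑ d ∈ D, n := by simp
        _ ≤ ∑ d ∈ D, (P d).card * 2000000 := Finset.sum_le_sum fun d hd => hP d (hDH hd)
        _ = (D.biUnion P).card * 2000000 := by rw [h1, Finset.sum_mul]
        _ ≤ _ := by omega
    exact Nat.le_of_mul_le_mul_right h3 (by omega)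
  refine ⟨D ∪ Low, ?_, ?_, ?_⟩
  · have := Finset.card_union_le D Low
    rw [KD_eq]; omega
  · intro d hd
    rcases Finset.mem_union.1 hd with hd | hd
    · have := hDH hd
      simp only [High, mem_filter] at this
      exact this.2.1
    · simp only [Low, mem_filter] at hd
      exact hd.2.1
  · intro z hz
    by_cases hzl : z ∈ Low
    · exact Or.inl (Finset.mem_union_right _ hzl)
    have hzh : z ∈ High := by
      simp only [High, Low, mem_filter, mem_univ, true_and, hz, not_le] at hzl ⊢
      exact hzl
    by_cases hzD : z ∈ D
    · exact Or.inl (Finset.mem_union_left _ hzD)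
    right
    by_contra hcon
    push Not at hcon
    have := hmax (insert z D) ⟨Finset.insert_subset hzh hDH, by
      rw [Finset.coe_insert]
      apply hDd.insert
      intro d hd _
      rw [Finset.disjoint_left]
      intro u hu hu2
      simp only [P, mem_filter, mem_univ, true_and] at hu hu2
      exact hcon d (Finset.mem_union_left _ hd) u hu.1 hu2.2 hu.2⟩
    rw [Finset.card_insert_of_notMem hzD] at this
    omega

/-- Bad quadruples. -/
def TypeB {n : ℕ} (G : ColoredGraph n) (x : Fin 4 → Fin n) : Prop :=
  Function.Injective x ∧ ∀ v, ∃ i, ¬ G.Adj (x i) v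

/-- Good states. -/
def goodB : Finset (Fin 4 → Option (Option Bool)) :=
  (univ : Finset (Fin 4 → Bool)).image (fun f i => if f i then some none else none) \
    {fun _ => some none}

lemma goodB_card : goodB.card ≤ 15 := by
  have h : (fun _ => some none) ∈
    (univ : Finset (Fin 4 → Bool)).image (fun f i => if f i then some (none : Option Bool) else none) := by
    rw [mem_image]
    exact ⟨fun _ => true, mem_univ _, by simp⟩
  unfold goodB
  rw [Finset.card_sdiff_of_subset (by simpa using h)]
  have := Finset.card_image_le (s := (univ : Finset (Fin 4 → Bool)))
    (f := (fun f i => if f i then some (none : Option Bool) else none))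
  simp at this ⊢
  omega

lemma mem_goodB (f : Fin 4 → Option (Option Bool)) (h1 : ∀ i, f i = none ∨ f i = some none)
    (i : Fin 4) (h2 : f i = none) : f ∈ goodB := by
  unfold goodB
  rw [Finset.mem_sdiff, Finset.mem_image, Finset.mem_singleton]
  refine ⟨⟨fun j => (f j).isSome, Finset.mem_univ _, ?_⟩, ?_⟩
  · funext j
    rcases h1 j with h | h <;> simp [h]
  · intro h
    rw [h] at h2
    simp at h2

/-- A large constant. -/
@[irreducible] def KB : ℝ := 3 ^ 16 * 1000 ^ (4 * KD)

lemma KB_pos : 0 < KB := by unfold KB; positivity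

lemma typeB_fiber {n : ℕ} (hn : 8000000 ≤ n) (x : Fin 4 → Fin n)
    (e : Fin (n - 4) → Fin n) (he : Function.Injective e)
    (hc : ∀ v, (∃ i, e i = v) ∨ ∃ j, x j = v) (H : ColoredGraph (n - 4)) :
    ((univ.filter fun G : ColoredGraph n => G.OBTF ∧ (¬ ∃ x y, TypeA G x y) ∧ TypeB G x ∧
      G.pull e = H).card : ℝ) ≤ KB * (15.3 : ℝ) ^ n := by
  have hex : ∀ G : ColoredGraph n, ∃ D : Fin 4 → Finset (Fin (n - 4)), (¬ ∃ x y, TypeA G x y) →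
      ∀ i, (D i).card ≤ KD ∧ (∀ d ∈ D i, G.Adj (x i) (e d)) ∧
      ∀ z, G.Adj (x i) (e z) → z ∈ D i ∨ ∃ d ∈ D i, ∃ u, G.Adj (x i) (e u) ∧ G.Adj (e d) (e u) ∧
        G.Adj (e z) (e u) := by
    intro G
    by_cases hA : ¬ ∃ x y, TypeA G x y
    · choose D hD using fun i => exists_D G hA hn x e he hc (x i)
      exact ⟨D, fun _ => hD⟩
    · exact ⟨fun _ => ∅, fun h => absurd h hA⟩
  choose D hD using hex
  let code : ColoredGraph n → Fin (n - 4) → Fin 4 → Option (Option Bool) := fun G v i =>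
    (G.cl (x i) (e v)).map fun b => if v ∈ D G i then some b else none
  have hcodeNone : ∀ G v i, code G v i = none ↔ ¬ G.Adj (x i) (e v) := by
    intro G v i
    simp [code, cl_adj]
  have hcodeD : ∀ G, (¬ ∃ x y, TypeA G x y) → ∀ v i, v ∈ D G i ↔ ∃ b, code G v i = some (some b) := by
    intro G hA v i
    constructor
    · intro hv
      obtain ⟨b, hb⟩ := (cl_adj' _ _ _).1 ((hD G hA i).2.1 v hv)
      exact ⟨b, by simp [code, hb, hv]⟩
    · rintro ⟨b, hb⟩
      by_contra hv
      simp [code, hv] at hb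
  have hcodeC : ∀ G v i b, code G v i = some (some b) → G.cl (x i) (e v) = some b := by
    intro G v i b hb
    simp only [code, Option.map_eq_some_iff] at hb
    obtain ⟨a, ha, hb⟩ := hb
    split_ifs at hb
    rw [ha, hb]
  let Fs : Finset (Fin (n - 4) → Fin 4 → Option (Option Bool)) :=
    univ.filter fun f => (univ.filter fun v => f v ∉ goodB).card ≤ 4 * KD
  have hF : (Fs.card : ℝ) ≤ 1000 ^ (4 * KD) * (15.3 : ℝ) ^ n := by
    have h := count_weight' (V := Fin (n - 4)) (fun _ => goodB) 15 (fun _ => goodB_card)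
      (4 * KD) 1000 (by norm_num)
    have e : ((15 : ℕ) : ℝ) + (Fintype.card (Fin 4 → Option (Option Bool)) : ℝ) * (1000 : ℝ)⁻¹
        = 15.256 := by
      simp; norm_num
    rw [e, Fintype.card_fin] at h
    have h' : (Fs.card : ℝ) ≤ 1000 ^ (4 * KD) * (15.256 : ℝ) ^ (n - 4) := by
      convert h
    refine h'.trans ?_
    · refine mul_le_mul_of_nonneg_left ?_ (by positivity)
      calc (15.256 : ℝ) ^ (n - 4) ≤ 15.256 ^ n := pow_le_pow_right₀ (by norm_num) (by omega)
        _ ≤ _ := pow_le_pow_left₀ (by norm_num) (by norm_num) _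
  have hcard : (univ.filter fun G : ColoredGraph n => G.OBTF ∧ (¬ ∃ x y, TypeA G x y) ∧ TypeB G x ∧
      G.pull e = H).card ≤ (Fs ×ˢ (univ : Finset (Fin 4 → Fin 4 → Option Bool))).card := by
    apply Finset.card_le_card_of_injOn (fun G => (code G, fun i j => G.cl (x i) (x j)))
    · intro G hG
      simp only [coe_filter, mem_univ, true_and, Set.mem_ofPred_eq] at hG
      obtain ⟨hO, hA, hB, hH⟩ := hG
      simp only [coe_product, coe_univ, Set.mem_prod, Set.mem_univ, and_true, mem_coe, Fs, mem_filter,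
        mem_univ, true_and]
      have hsub : (univ.filter fun v => code G v ∉ goodB) ⊆ univ.biUnion (D G) := by
        intro v hv
        by_contra hvD
        simp only [mem_biUnion, mem_univ, true_and, not_exists] at hvD
        simp only [mem_filter, mem_univ, true_and] at hv
        apply hv
        obtain ⟨i, hi⟩ := hB.2 (e v)
        refine mem_goodB _ (fun i => ?_) i ((hcodeNone G v i).2 hi)
        by_cases h : G.Adj (x i) (e v)
        · obtain ⟨b, hb⟩ := (cl_adj' _ _ _).1 h
          right
          simp [code, hb, hvD i]
        · exact Or.inl ((hcodeNone G v i).2 h)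
      refine (Finset.card_le_card hsub).trans (Finset.card_biUnion_le.trans ?_)
      refine (Finset.sum_le_sum fun i _ => (hD G hA i).1).trans ?_
      simp
    · intro G hG G' hG' h
      simp only [coe_filter, mem_univ, true_and, Set.mem_ofPred_eq] at hG hG'
      obtain ⟨hO, hA, hB, hH⟩ := hG
      obtain ⟨hO', hA', hB', hH'⟩ := hG'
      simp only [Prod.mk.injEq] at h
      obtain ⟨h1, h2⟩ := h
      have hpull := hH.trans hH'.symm
      have hee : ∀ a b, G.cl (e a) (e b) = G'.cl (e a) (e b) := by
        intro a b; rw [← cl_pull, ← cl_pull, hpull]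
      have hadj : ∀ i v, G.Adj (x i) (e v) ↔ G'.Adj (x i) (e v) := by
        intro i v
        have := (hcodeNone G v i).symm.trans ((by rw [h1]) : _ ↔ code G' v i = none)
        have := this.trans (hcodeNone G' v i)
        exact not_iff_not.1 this
      have hDcol : ∀ i v, v ∈ D G i → G.cl (x i) (e v) = G'.cl (x i) (e v) := by
        intro i v hv
        obtain ⟨b, hb⟩ := (hcodeD G hA v i).1 hv
        rw [hcodeC G v i b hb]
        rw [h1] at hb
        rw [hcodeC G' v i b hb]
      refine eq_of_pull e x hc hpull (fun i v => ?_) (fun i j => congrFun (congrFun h2 i) j)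
      by_cases hv : G.Adj (x i) (e v)
      · rcases (hD G hA i).2.2 v hv with hvD | ⟨d, hd, u, hpu, hdu, hvu⟩
        · exact hDcol i v hvD
        · have key : ∀ w w', G.cl (x i) (e w) = G'.cl (x i) (e w) → G.Adj (x i) (e w) →
              G.Adj (x i) (e w') → G.Adj (e w) (e w') →
              G.cl (x i) (e w') = G'.cl (x i) (e w') := by
            intro w w' heq hw hw' hww
            have hw'' := (hadj i w').1 hw'
            obtain ⟨a, ha⟩ := (cl_adj' _ _ _).1 hw
            obtain ⟨b, hb⟩ := (cl_adj' _ _ _).1 hww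
            obtain ⟨c, hcc⟩ := (cl_adj' _ _ _).1 hw'
            obtain ⟨c', hcc'⟩ := (cl_adj' _ _ _).1 hw''
            have e1 := (obtf_iff G).1 hO _ _ _ _ _ _ ha hb hcc
            rw [heq] at ha
            rw [hee] at hb
            have e2 := (obtf_iff G').1 hO' _ _ _ _ _ _ ha hb hcc'
            rw [hcc, hcc', e1, e2]
          have s1 := key d u (hDcol i d hd) ((hD G hA i).2.1 d hd) hpu hdu
          exact key u v s1 hpu hv (G.adj_symm hvu)
      · have hv' : ¬ G'.Adj (x i) (e v) := fun h => hv ((hadj i v).2 h)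
        rw [cl_adj, not_not] at hv hv'
        rw [hv, hv']
  have h81 : (univ : Finset (Fin 4 → Fin 4 → Option Bool)).card = 3 ^ 16 := by simp
  rw [Finset.card_product, h81] at hcard
  calc _ ≤ ((Fs.card * 3 ^ 16 : ℕ) : ℝ) := by exact_mod_cast hcard
    _ = Fs.card * 3 ^ 16 := by push_cast; ring
    _ ≤ (1000 ^ (4 * KD) * (15.3 : ℝ) ^ n) * 3 ^ 16 :=
        mul_le_mul_of_nonneg_right hF (by positivity)
    _ = _ := by unfold KB; ring

lemma typeB_count (n t : ℕ) (hn : 8000000 ≤ n) :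
    (((Ys n t).filter fun G => (¬ ∃ x y, TypeA G x y) ∧ ∃ x, TypeB G x).card : ℝ) ≤
      n ^ 4 * (KB * (15.3 : ℝ) ^ n * (Ys (n - 4) (t - 4)).card) := by
  let S : (Fin 4 → Fin n) → Finset (ColoredGraph n) := fun p =>
    (Ys n t).filter fun G => (¬ ∃ x y, TypeA G x y) ∧ TypeB G p
  have hsub : ((Ys n t).filter fun G => (¬ ∃ x y, TypeA G x y) ∧ ∃ x, TypeB G x) ⊆
      univ.biUnion S := by
    intro G hG
    simp only [mem_filter] at hG
    obtain ⟨hG, hA, x, hx⟩ := hG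
    simp only [mem_biUnion, S, mem_filter, mem_univ, true_and]
    exact ⟨x, hG, hA, hx⟩
  have hS : ∀ p, ((S p).card : ℝ) ≤ KB * (15.3 : ℝ) ^ n * (Ys (n - 4) (t - 4)).card := by
    intro p
    by_cases hp : Function.Injective p
    · refine fiber_bound (r := 4) p hp (S p) (Finset.filter_subset _ _) _ ?_
      intro e he hd hc H
      refine le_trans ?_ (typeB_fiber hn p e he hc H)
      norm_cast
      apply Finset.card_le_card
      intro G hG
      simp only [S, Ys, mem_filter, mem_univ, true_and] at hG ⊢
      exact ⟨hG.1.1.1, hG.1.2.1, hG.1.2.2, hG.2⟩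
    · have : S p = ∅ := by
        ext G; simp [S, TypeB, hp]
      rw [this]; simp only [card_empty, Nat.cast_zero]; have := KB_pos; positivity
  calc _ ≤ ((univ.biUnion S).card : ℝ) := by exact_mod_cast Finset.card_le_card hsub
    _ ≤ ∑ p, ((S p).card : ℝ) := by exact_mod_cast Finset.card_biUnion_le
    _ ≤ ∑ p : Fin 4 → Fin n, (KB * (15.3 : ℝ) ^ n * (Ys (n - 4) (t - 4)).card) :=
        Finset.sum_le_sum fun p _ => hS p
    _ = _ := by
        rw [Finset.sum_const, Finset.card_univ, nsmul_eq_mul]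
        simp

/-- No bad quadruples: blue-bipartite. -/
lemma bb_of_good {n : ℕ} (hn : 4 ≤ n) (G : ColoredGraph n) (hO : G.OBTF)
    (hB : ¬ ∃ x, TypeB G x) : G.BlueBipartite := by
  have hcn : ∀ S : Finset (Fin n), S.card ≤ 4 → ∃ v, ∀ s ∈ S, G.Adj s v := by
    intro S hS
    obtain ⟨T, hST, _, hT⟩ := Finset.exists_subsuperset_card_eq (Finset.subset_univ S) hS (by simpa using hn)
    by_contra hcon
    push Not at hcon
    apply hB
    refine ⟨T.orderEmbOfFin hT, RelEmbedding.injective _, fun v => ?_⟩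
    obtain ⟨s, hs, hsv⟩ := hcon v
    have : s ∈ Set.range (T.orderEmbOfFin hT) := by
      rw [Finset.range_orderEmbOfFin]; exact hST hs
    obtain ⟨i, hi⟩ := this
    exact ⟨i, by rw [hi]; exact hsv⟩
  rw [obtf_iff] at hO
  let x0 : Fin n := ⟨0, by omega⟩
  have hw : ∀ v, ∃ w, G.Adj x0 w ∧ G.Adj v w := by
    intro v
    obtain ⟨w, hw⟩ := hcn {x0, v} (Finset.card_le_two.trans (by norm_num))
    exact ⟨w, hw _ (by simp), hw _ (by simp)⟩
  choose w hw0 hwv using hw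
  choose a ha using fun v => (cl_adj' G _ _).1 (hw0 v)
  choose b hb using fun v => (cl_adj' G _ _).1 (hwv v)
  -- independence of the midpoint
  have key : ∀ v w' a' b', G.cl x0 w' = some a' → G.cl v w' = some b' →
      xor a' b' = xor (a v) (b v) := by
    intro v w' a' b' h1 h2
    obtain ⟨z, hz⟩ := hcn {x0, v, w v, w'} Finset.card_le_four
    obtain ⟨z1, hz1⟩ := (cl_adj' G _ _).1 (hz x0 (by simp))
    obtain ⟨z2, hz2⟩ := (cl_adj' G _ _).1 (hz v (by simp))
    obtain ⟨z3, hz3⟩ := (cl_adj' G _ _).1 (hz (w v) (by simp))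
    obtain ⟨z4, hz4⟩ := (cl_adj' G _ _).1 (hz w' (by simp))
    have e1 := hO _ _ _ _ _ _ (ha v) hz3 hz1
    have e2 := hO _ _ _ _ _ _ (hb v) hz3 hz2
    have e3 := hO _ _ _ _ _ _ h1 hz4 hz1
    have e4 := hO _ _ _ _ _ _ h2 hz4 hz2
    have bool_aux : ∀ p q r s z1 z2 z3 z4 : Bool, z1 = xor p z3 → z2 = xor q z3 → z1 = xor r z4 →
        z2 = xor s z4 → xor r s = xor p q := by decide
    exact bool_aux _ _ _ _ _ _ _ _ e1 e2 e3 e4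
  rw [BlueBipartite, bb_iff]
  refine ⟨fun v => xor (a v) (b v), fun u _ v _ c hc => ?_⟩
  obtain ⟨z, hz⟩ := hcn {x0, u, v} (Finset.card_le_three.trans (by norm_num))
  obtain ⟨z1, hz1⟩ := (cl_adj' G _ _).1 (hz x0 (by simp))
  obtain ⟨z2, hz2⟩ := (cl_adj' G _ _).1 (hz u (by simp))
  obtain ⟨z3, hz3⟩ := (cl_adj' G _ _).1 (hz v (by simp))
  simp only
  rw [← key u z z1 z2 hz1 hz2, ← key v z z1 z3 hz1 hz3]
  have e := hO _ _ _ _ _ _ hc hz3 hz2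
  rw [e]
  cases c <;> cases z1 <;> cases z3 <;> rfl

/-- The triangular number `n(n+1)/2`. -/
def Tr (n : ℕ) : ℕ := (n + 1).choose 2

lemma Tr_succ (n : ℕ) : Tr (n + 1) = Tr n + (n + 1) := by
  unfold Tr
  rw [Nat.choose_succ_succ' (n + 1) 1, Nat.choose_one_right]; ring

/-- The blue-bipartite graph from a graph and a two-coloring. -/
def ofBip {n : ℕ} (E : SimpleGraph (Fin n)) (u : Fin n → Bool) : ColoredGraph n where
  red := { Adj := fun i j => E.Adj i j ∧ u i = u j
           symm := ⟨fun i j h => ⟨h.1.symm, h.2.symm⟩⟩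
           loopless := ⟨fun i h => E.loopless.irrefl i h.1⟩ }
  blue := { Adj := fun i j => E.Adj i j ∧ u i ≠ u j
            symm := ⟨fun i j h => ⟨h.1.symm, h.2.symm⟩⟩
            loopless := ⟨fun i h => E.loopless.irrefl i h.1⟩ }
  disj := fun _ _ h => h.2.2 h.1.2

lemma cl_ofBip {n : ℕ} (E : SimpleGraph (Fin n)) (u : Fin n → Bool) (i j : Fin n) :
    (ofBip E u).cl i j = if E.Adj i j then some (xor (u i) (u j)) else none := by
  unfold cl ofBip
  by_cases h : E.Adj i j <;> cases h1 : u i <;> cases h2 : u j <;> simp [h, h1, h2]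

lemma ofBip_bb {n : ℕ} (E : SimpleGraph (Fin n)) (u : Fin n → Bool) : (ofBip E u).BlueBipartite := by
  rw [BlueBipartite, bb_iff]
  refine ⟨u, fun x _ y _ a ha => ?_⟩
  rw [cl_ofBip] at ha
  split_ifs at ha
  simpa using ha.symm

lemma bb_eq {n : ℕ} (G : ColoredGraph n) (h : G.BlueBipartite) : ∃ u, G = ofBip G.graph u := by
  rw [BlueBipartite, bb_iff] at h
  obtain ⟨u, hu⟩ := h
  refine ⟨u, cl_inj ?_⟩
  funext i j
  rw [cl_ofBip]
  by_cases h : G.Adj i j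
  · obtain ⟨a, ha⟩ := (cl_adj' _ _ _).1 h
    rw [if_pos (show G.graph.Adj i j from h), ha, hu i trivial j trivial a ha]
  · rw [if_neg (show ¬ G.graph.Adj i j from h)]
    rw [cl_adj, not_not] at h
    exact h

lemma bb_obtf {n : ℕ} (G : ColoredGraph n) (h : G.BlueBipartite) : G.OBTF := by
  rw [BlueBipartite, bb_iff] at h
  obtain ⟨u, hu⟩ := h
  rw [obtf_iff]
  intro x y z a b c ha hb hc
  rw [hu x trivial y trivial a ha, hu y trivial z trivial b hb, hu x trivial z trivial c hc]
  cases u x <;> cases u y <;> cases u z <;> rfl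

/-- Blue-bipartite graphs. -/
def Bs (n : ℕ) : Finset (ColoredGraph n) := univ.filter fun G => G.BlueBipartite

lemma Bs_upper (n : ℕ) : (Bs n).card ≤ 2 ^ Tr n := by
  have hex : ∀ G : ColoredGraph n, ∃ u, G.BlueBipartite → G = ofBip G.graph u := by
    intro G
    by_cases h : G.BlueBipartite
    · obtain ⟨u, hu⟩ := bb_eq G h
      exact ⟨u, fun _ => hu⟩
    · exact ⟨fun _ => true, fun h' => absurd h' h⟩
  choose u hu using hex
  have hcard : (Bs n).card ≤ (univ : Finset ((Fin n → Bool) ×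
      Finset {e : Sym2 (Fin n) // ¬ e.IsDiag})).card := by
    apply Finset.card_le_card_of_injOn
      (fun G => (u G, univ.filter fun e => e.1 ∈ G.graph.edgeSet))
    · intro G _; simp
    · intro G hG G' hG' h
      simp only [Bs, coe_filter, mem_univ, true_and, Set.mem_ofPred_eq] at hG hG'
      simp only [Prod.mk.injEq] at h
      have hgr : G.graph = G'.graph := by
        ext i j
        by_cases hij : i = j
        · subst hij; simp
        · have := Finset.ext_iff.1 h.2 ⟨s(i, j), by simpa using hij⟩
          simpa using this
      rw [hu G hG, hu G' hG', h.1, hgr]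
  refine hcard.trans ?_
  rw [Finset.card_univ, Fintype.card_prod, Fintype.card_finset, Sym2.card_subtype_not_diag]
  simp only [Fintype.card_pi, Fintype.card_bool, Finset.prod_const, Finset.card_univ, Fintype.card_fin]
  rw [← pow_add]
  unfold Tr
  rw [Nat.choose_succ_succ' n 1, Nat.choose_one_right]

/-- Extension of a graph by a last vertex. -/
def extE {k : ℕ} (H : ColoredGraph k) (N : Finset (Fin k)) : SimpleGraph (Fin (k + 1)) :=
  SimpleGraph.fromRel fun a b => (∃ i j : Fin k, a = i.castSucc ∧ b = j.castSucc ∧ H.Adj i j) ∨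
    (a = Fin.last k ∧ ∃ i ∈ N, b = i.castSucc)

lemma extE_cc {k : ℕ} (H : ColoredGraph k) (N : Finset (Fin k)) (i j : Fin k) :
    (extE H N).Adj i.castSucc j.castSucc ↔ H.Adj i j := by
  have h1 : ∀ i : Fin k, i.castSucc ≠ Fin.last k := fun i => (Fin.castSucc_lt_last i).ne
  have h2 : H.Adj i j → i ≠ j := by
    rintro h rfl
    rw [cl_adj, cl_self] at h
    exact h rfl
  have h3 : H.Adj j i → H.Adj i j := H.adj_symm
  simp only [extE, SimpleGraph.fromRel_adj, h1, false_and, or_false, Fin.castSucc_inj]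
  constructor
  · rintro ⟨_, ⟨a, b, rfl, rfl, h⟩ | ⟨a, b, rfl, rfl, h⟩⟩
    · exact h
    · exact h3 h
  · intro h
    exact ⟨fun h' => h2 h (by simpa using h'), Or.inl ⟨i, j, rfl, rfl, h⟩⟩

lemma extE_lc {k : ℕ} (H : ColoredGraph k) (N : Finset (Fin k)) (i : Fin k) :
    (extE H N).Adj (Fin.last k) i.castSucc ↔ i ∈ N := by
  have h1 : ∀ i : Fin k, Fin.last k ≠ i.castSucc := fun i => (Fin.castSucc_lt_last i).ne'
  have h2 : ∀ i : Fin k, i.castSucc ≠ Fin.last k := fun i => (Fin.castSucc_lt_last i).ne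
  simp only [extE, SimpleGraph.fromRel_adj, h1, h2, false_and, or_false, Fin.castSucc_inj]
  constructor
  · rintro ⟨_, h⟩
    simpa using h
  · intro h
    refine ⟨h1 i, ?_⟩
    simpa using h

lemma Bs_lower_step (k : ℕ) : (2 ^ (k + 1) - 1) * (Bs k).card ≤ (Bs (k + 1)).card := by
  have hex : ∀ G : ColoredGraph k, ∃ u, G.BlueBipartite → G = ofBip G.graph u := by
    intro G
    by_cases h : G.BlueBipartite
    · obtain ⟨u, hu⟩ := bb_eq G h
      exact ⟨u, fun _ => hu⟩
    · exact ⟨fun _ => true, fun h' => absurd h' h⟩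
  choose u hu using hex
  have hc : ((univ : Finset (Finset (Fin k) × Bool)).erase (∅, true)).card = 2 ^ (k + 1) - 1 := by
    rw [Finset.card_erase_of_mem (mem_univ _), Finset.card_univ, Fintype.card_prod]
    simp [pow_succ]
  rw [← hc, ← Finset.card_product]
  let u' : ColoredGraph k → Bool → Fin (k + 1) → Bool := fun G σ => Fin.snoc (α := fun _ => Bool) (u G) σ
  apply Finset.card_le_card_of_injOn
    (fun p => ofBip (extE p.2 p.1.1) (u' p.2 p.1.2))
  · intro p _
    simp only [Bs, coe_filter, mem_univ, true_and, Set.mem_ofPred_eq]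
    exact ofBip_bb _ _
  · rintro ⟨⟨N, σ⟩, H⟩ hp ⟨⟨N', σ'⟩, H'⟩ hp' h
    simp only [Bs, coe_product, Set.mem_prod, mem_coe, mem_erase, mem_univ, and_true, mem_filter,
      true_and, ne_eq, Prod.mk.injEq, not_and] at hp hp'
    have hcl : ∀ i j, (ofBip (extE H N) (u' H σ)).cl i j = (ofBip (extE H' N') (u' H' σ')).cl i j := by
      intro i j
      exact congrArg (fun G => G.cl i j) h
    have hH : H = H' := by
      apply cl_inj
      funext i j
      have h1 := hcl i.castSucc j.castSucc
      have e1 : H.cl i j = (ofBip H.graph (u H)).cl i j := by rw [← hu H hp.2]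
      have e2 : H'.cl i j = (ofBip H'.graph (u H')).cl i j := by rw [← hu H' hp'.2]
      rw [e1, e2, cl_ofBip, cl_ofBip]
      rw [cl_ofBip, cl_ofBip, if_congr (extE_cc H N i j) rfl rfl, if_congr (extE_cc H' N' i j) rfl rfl] at h1
      simpa [u', ColoredGraph.Adj] using h1
    subst hH
    have hl : ∀ i : Fin k, (if i ∈ N then some (xor σ (u H i)) else none) =
        (if i ∈ N' then some (xor σ' (u H i)) else none) := by
      intro i
      have h1 := hcl (Fin.last k) i.castSucc
      rw [cl_ofBip, cl_ofBip, if_congr (extE_lc H N i) rfl rfl, if_congr (extE_lc H N' i) rfl rfl] at h1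
      simpa [u'] using h1
    have hN : N = N' := by
      ext i
      have h3 := hl i
      by_cases h1 : i ∈ N <;> by_cases h2 : i ∈ N' <;> simp [h1, h2] at h3 ⊢
    subst hN
    have hσ : σ = σ' := by
      by_cases hN : N = ∅
      · have h1 := hp.1 hN
        have h2 := hp'.1 hN
        rw [Bool.not_eq_true] at h1 h2
        rw [h1, h2]
      · obtain ⟨i, hi⟩ := Finset.nonempty_iff_ne_empty.2 hN
        have := hl i
        simp only [hi, if_true, Option.some.injEq] at this
        revert this
        cases σ <;> cases σ' <;> cases u H i <;> simp
    subst hσ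
    rfl

lemma Bs_lower (k : ℕ) : (2 : ℝ) ^ Tr k / 4 ≤ (Bs k).card := by
  have h0 : 1 ≤ (Bs 0).card := by
    rw [Nat.one_le_iff_ne_zero, Finset.card_ne_zero]
    refine ⟨ofBip ⊥ (fun _ => true), ?_⟩
    simp only [Bs, mem_filter, mem_univ, true_and]
    exact ofBip_bb _ _
  rcases Nat.eq_zero_or_pos k with rfl | hk
  · have : (1 : ℝ) ≤ (Bs 0).card := by exact_mod_cast h0
    simp only [Tr]
    norm_num
    linarith
  have key : ∀ k, 1 ≤ k → (2 : ℝ) ^ Tr k * (1 / 4 + 1 / 2 ^ (k + 1)) ≤ (Bs k).card := by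
    intro k hk
    induction k, hk using Nat.le_induction with
    | base =>
      have h1 := Bs_lower_step 0
      norm_num at h1
      have h2 : (1 : ℝ) ≤ (Bs 1).card := by exact_mod_cast h0.trans h1
      have h3 : Tr 1 = 1 := by decide
      have h4 : (2 : ℝ) ^ Tr 1 * (1 / 4 + 1 / 2 ^ (1 + 1)) = 1 := by rw [h3]; norm_num
      rw [h4]; exact h2
    | succ k hk ih =>
      have h1 := Bs_lower_step k
      have h2 : ((2 : ℝ) ^ (k + 1) - 1) * (Bs k).card ≤ (Bs (k + 1)).card := by
        have h3 : ((2 ^ (k + 1) - 1 : ℕ) : ℝ) = (2 : ℝ) ^ (k + 1) - 1 := by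
          rw [Nat.cast_sub Nat.one_le_two_pow]; push_cast; ring
        rw [← h3]
        exact_mod_cast h1
      refine le_trans ?_ h2
      have hq : (4 : ℝ) ≤ 2 ^ (k + 1) := by
        calc (4 : ℝ) = 2 ^ 2 := by norm_num
          _ ≤ _ := pow_le_pow_right₀ (by norm_num) (by omega)
      refine le_trans ?_ (mul_le_mul_of_nonneg_left ih (by linarith))
      rw [Tr_succ, pow_add, pow_succ (2 : ℝ) (k + 1)]
      set q : ℝ := 2 ^ (k + 1)
      set T : ℝ := 2 ^ Tr k
      have hT : 0 < T := by positivity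
      have hq0 : q ≠ 0 := by positivity
      have : q * (1 / 4 + 1 / (q * 2)) ≤ (q - 1) * (1 / 4 + 1 / q) := by
        have h5 : 1 / q ≤ 1 / 4 := one_div_le_one_div_of_le (by norm_num) hq
        have h6 : q * (1 / 4 + 1 / (q * 2)) = q / 4 + 1 / 2 := by
          field_simp
          try ring
        have h7 : (q - 1) * (1 / 4 + 1 / q) = q / 4 + 3 / 4 - 1 / q := by
          field_simp
          try ring
        rw [h6, h7]; linarith
      nlinarith
  refine le_trans ?_ (key k hk)
  have : (0 : ℝ) ≤ 1 / 2 ^ (k + 1) := by positivity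
  have hT : (0 : ℝ) < 2 ^ Tr k := by positivity
  nlinarith

lemma recursion (n t : ℕ) (hn : 8000000 ≤ n) (ht : 1 ≤ t) :
    ((Ys n t).card : ℝ) ≤ n ^ 2 * (81 * KA * (3.2 : ℝ) ^ n * (Ys (n - 2) (t - 2)).card) +
      n ^ 4 * (KB * (15.3 : ℝ) ^ n * (Ys (n - 4) (t - 4)).card) := by
  refine le_trans ?_ (add_le_add (typeA_count n t) (typeB_count n t hn))
  norm_cast
  refine le_trans (Finset.card_le_card ?_) (Finset.card_union_le _ _)
  intro G hG
  rw [mem_union, mem_filter, mem_filter]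
  by_cases hA : ∃ x y, TypeA G x y
  · exact Or.inl ⟨hG, hA⟩
  · right
    refine ⟨hG, hA, ?_⟩
    by_contra hB
    simp only [Ys, mem_filter, mem_univ, true_and] at hG
    have := (kappa_zero G).2 (bb_of_good (by omega) G hG.1 hB)
    omega

lemma Ys_zero (n : ℕ) : (Ys n 0).card ≤ (Bs n).card + (Ys n 1).card := by
  refine le_trans (Finset.card_le_card ?_) (Finset.card_union_le _ _)
  intro G hG
  simp only [Ys, Bs, mem_union, mem_filter, mem_univ, true_and] at hG ⊢
  by_cases h : G.kappa = 0
  · exact Or.inl ((kappa_zero G).1 h)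
  · exact Or.inr ⟨hG.1, by omega⟩

lemma step_aux (θ : ℝ) (h0 : 0 < θ) (h1 : θ ≤ 1) (n m t r : ℕ) (hnm : n = m + r) (htn : t ≤ n)
    (d a b K : ℝ) (hd : 0 ≤ d) (hb : 0 ≤ b) (ha : 0 ≤ a) (had : a ≤ 2 ^ r * b * θ ^ (2 * r)) (hT : (2 : ℝ) ^ (r * n) * 2 ^ Tr m = K * 2 ^ Tr n)
    (A Y : ℝ) (hA : 0 ≤ A) (hY : Y ≤ A * 2 ^ Tr m * θ ^ (m * (t - r))) :
    d * (a ^ n * Y) ≤ d * K * b ^ n * (A * 2 ^ Tr n * θ ^ (n * t)) := by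
  have hexp : n * t ≤ m * (t - r) + 2 * r * n := by
    subst hnm
    rcases le_total t r with h | h
    · have : (m + r) * t ≤ (m + r) * r := Nat.mul_le_mul_left _ h
      nlinarith
    · obtain ⟨s, rfl⟩ := Nat.exists_eq_add_of_le h
      rw [Nat.add_sub_cancel_left]
      nlinarith
  have hth : θ ^ (m * (t - r)) * (θ ^ (2 * r)) ^ n ≤ θ ^ (n * t) := by
    rw [← pow_mul, ← pow_add]
    exact pow_le_pow_of_le_one h0.le h1 hexp
  have hpow : a ^ n ≤ (2 ^ r) ^ n * b ^ n * (θ ^ (2 * r)) ^ n := by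
    rw [← mul_pow, ← mul_pow]
    exact pow_le_pow_left₀ ha had n
  rw [mul_assoc, mul_assoc]
  refine mul_le_mul_of_nonneg_left ?_ hd
  calc a ^ n * Y ≤ a ^ n * (A * 2 ^ Tr m * θ ^ (m * (t - r))) :=
        mul_le_mul_of_nonneg_left hY (by positivity)
    _ ≤ ((2 ^ r) ^ n * b ^ n * (θ ^ (2 * r)) ^ n) * (A * 2 ^ Tr m * θ ^ (m * (t - r))) :=
        mul_le_mul_of_nonneg_right hpow (by positivity)
    _ = (2 ^ (r * n) * 2 ^ Tr m) * (b ^ n * A) * (θ ^ (m * (t - r)) * (θ ^ (2 * r)) ^ n) := by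
        rw [← pow_mul (2 : ℝ) r n]; ring
    _ ≤ (2 ^ (r * n) * 2 ^ Tr m) * (b ^ n * A) * θ ^ (n * t) :=
        mul_le_mul_of_nonneg_left hth (by positivity)
    _ = _ := by rw [hT]; ring

lemma eventually_small : ∃ N : ℕ, 8000000 ≤ N ∧ ∀ n : ℕ, N ≤ n →
    (n : ℝ) ^ 2 * (81 * KA) * 2 * 0.9 ^ n + (n : ℝ) ^ 4 * KB * 64 * 0.97 ^ n ≤ 1 / 2 := by
  have t1 := (tendsto_pow_const_mul_const_pow_of_abs_lt_one 2 (r := (0.9 : ℝ))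
    (by rw [abs_of_pos] <;> norm_num)).const_mul (81 * KA * 2)
  have t2 := (tendsto_pow_const_mul_const_pow_of_abs_lt_one 4 (r := (0.97 : ℝ))
    (by rw [abs_of_pos] <;> norm_num)).const_mul (KB * 64)
  have t3 := t1.add t2
  simp only [mul_zero, add_zero] at t3
  have := t3.eventually (eventually_le_nhds (show (0 : ℝ) < 1 / 2 by norm_num))
  obtain ⟨N, hN⟩ := eventually_atTop.1 this
  refine ⟨max N 8000000, le_max_right _ _, fun n hn => ?_⟩
  have := hN n (le_trans (le_max_left _ _) hn)
  linarith

lemma main_step (θ : ℝ) (h0 : 0 < θ) (h1 : θ ≤ 1) (n t : ℕ) (K L : ℝ) (hK : 0 ≤ K) (hL : 0 ≤ L)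
    (A : ℝ) (hA : 0 ≤ A) (Y Y2 Y4 : ℝ) (hn : 8000000 ≤ n) (htn : t ≤ n)
    (hθ2 : 3.2 ≤ 2 ^ 2 * 0.9 * θ ^ (2 * 2)) (hθ4 : 15.3 ≤ 2 ^ 4 * 0.97 * θ ^ (2 * 4))
    (r1 : Y ≤ (n : ℝ) ^ 2 * K * (3.2 ^ n * Y2) + (n : ℝ) ^ 4 * L * (15.3 ^ n * Y4))
    (i2 : Y2 ≤ A * 2 ^ Tr (n - 2) * θ ^ ((n - 2) * (t - 2)))
    (i4 : Y4 ≤ A * 2 ^ Tr (n - 4) * θ ^ ((n - 4) * (t - 4)))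
    (hsm : (n : ℝ) ^ 2 * K * 2 * 0.9 ^ n + (n : ℝ) ^ 4 * L * 64 * 0.97 ^ n ≤ 1 / 2) :
    Y ≤ 1 / 2 * (A * 2 ^ Tr n * θ ^ (n * t)) := by
  have T2 : (2 : ℝ) ^ (2 * n) * 2 ^ Tr (n - 2) = 2 * 2 ^ Tr n := by
    obtain ⟨m, rfl⟩ : ∃ m, n = m + 2 := ⟨n - 2, by omega⟩
    rw [← pow_add, ← pow_succ', Nat.add_sub_cancel, Tr_succ, Tr_succ]
    congr 1
    ring
  have T4 : (2 : ℝ) ^ (4 * n) * 2 ^ Tr (n - 4) = 64 * 2 ^ Tr n := by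
    obtain ⟨m, rfl⟩ : ∃ m, n = m + 4 := ⟨n - 4, by omega⟩
    rw [show (64 : ℝ) = 2 ^ 6 by norm_num, ← pow_add, ← pow_add, Nat.add_sub_cancel,
      Tr_succ, Tr_succ, Tr_succ, Tr_succ]
    congr 1
    ring
  have d2 : 0 ≤ (n : ℝ) ^ 2 * K := by positivity
  have d4 : 0 ≤ (n : ℝ) ^ 4 * L := by positivity
  have s2 := step_aux θ h0 h1 n (n - 2) t 2 (by omega) htn ((n : ℝ) ^ 2 * K) 3.2 0.9 2
    d2 (by norm_num) (by norm_num) hθ2 T2 A Y2 hA i2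
  have s4 := step_aux θ h0 h1 n (n - 4) t 4 (by omega) htn ((n : ℝ) ^ 4 * L) 15.3 0.97 64
    d4 (by norm_num) (by norm_num) hθ4 T4 A Y4 hA i4
  have hX : 0 ≤ A * 2 ^ Tr n * θ ^ (n * t) := by positivity
  have h5 := mul_le_mul_of_nonneg_right hsm hX
  rw [add_mul] at h5
  exact le_trans r1 ((add_le_add s2 s4).trans h5)

lemma zero_step (θ : ℝ) (h0 : 0 < θ) (h1 : θ ≤ 1) (n : ℕ) (A : ℝ) (hA2 : 2 ≤ A)
    (e3 : ((Ys n 1).card : ℝ) ≤ 1 / 2 * (A * 2 ^ Tr n * θ ^ (n * 1))) :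
    ((Ys n 0).card : ℝ) ≤ A * 2 ^ Tr n := by
  have e1 : ((Ys n 0).card : ℝ) ≤ (Bs n).card + (Ys n 1).card := by exact_mod_cast Ys_zero n
  have e2 : ((Bs n).card : ℝ) ≤ (2 : ℝ) ^ Tr n := by exact_mod_cast Bs_upper n
  have hp : (0 : ℝ) < 2 ^ Tr n := pow_pos (by norm_num) _
  have e4 : θ ^ (n * 1) ≤ 1 := pow_le_one₀ h0.le h1
  have hA0 : 0 < A := by linarith
  have e5 : A * 2 ^ Tr n * θ ^ (n * 1) ≤ A * 2 ^ Tr n * 1 :=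
    mul_le_mul_of_nonneg_left e4 (mul_pos hA0 hp).le
  have e6 : 2 * (2 : ℝ) ^ Tr n ≤ A * 2 ^ Tr n := mul_le_mul_of_nonneg_right hA2 hp.le
  linarith

lemma main_ind (θ : ℝ) (h0 : 0 < θ) (h1 : θ ≤ 1) (hθ2 : 3.2 ≤ 2 ^ 2 * 0.9 * θ ^ (2 * 2))
    (hθ4 : 15.3 ≤ 2 ^ 4 * 0.97 * θ ^ (2 * 4)) :
    ∃ A : ℝ, 0 < A ∧ ∀ n t : ℕ, t ≤ n → ((Ys n t).card : ℝ) ≤ A * 2 ^ Tr n * θ ^ (n * t) := by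
  obtain ⟨N, hN8, hN⟩ := eventually_small
  obtain ⟨A, hA2, hAs⟩ : ∃ A : ℝ, 2 ≤ A ∧ ∀ n, n < N → ((Ys n 0).card : ℝ) / θ ^ (n * n) ≤ A := by
    have hsum : 0 ≤ ∑ n ∈ range N, ((Ys n 0).card : ℝ) / θ ^ (n * n) :=
      Finset.sum_nonneg fun n _ => by positivity
    refine ⟨2 + ∑ n ∈ range N, ((Ys n 0).card : ℝ) / θ ^ (n * n), by linarith, fun n hn => ?_⟩
    have := Finset.single_le_sum (f := fun n => ((Ys n 0).card : ℝ) / θ ^ (n * n))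
      (fun n _ => by positivity) (Finset.mem_range.2 hn)
    linarith
  have hA0 : 0 < A := by linarith
  refine ⟨A, by linarith, ?_⟩
  intro n
  induction n using Nat.strong_induction_on with
  | _ n ih =>
  by_cases hn : n < N
  · intro t ht
    have e1 : (Ys n t).card ≤ (Ys n 0).card := by
      apply Finset.card_le_card
      intro G hG
      simp only [Ys, mem_filter, mem_univ, true_and] at hG ⊢
      exact ⟨hG.1, Nat.zero_le _⟩
    have e2 : ((Ys n 0).card : ℝ) / θ ^ (n * n) ≤ A := hAs n hn
    rw [div_le_iff₀ (by positivity)] at e2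
    calc ((Ys n t).card : ℝ) ≤ (Ys n 0).card := by exact_mod_cast e1
      _ ≤ A * θ ^ (n * n) := e2
      _ ≤ A * θ ^ (n * t) := by
          refine mul_le_mul_of_nonneg_left ?_ (by linarith)
          exact pow_le_pow_of_le_one h0.le h1 (Nat.mul_le_mul_left _ ht)
      _ = A * 1 * θ ^ (n * t) := by ring
      _ ≤ A * 2 ^ Tr n * θ ^ (n * t) := by
          refine mul_le_mul_of_nonneg_right ?_ (by positivity)
          refine mul_le_mul_of_nonneg_left ?_ (by linarith)
          exact one_le_pow₀ (by norm_num)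
  · push Not at hn
    have hpos : ∀ t, 1 ≤ t → t ≤ n →
        ((Ys n t).card : ℝ) ≤ 1 / 2 * (A * 2 ^ Tr n * θ ^ (n * t)) := by
      intro t ht htn
      exact main_step θ h0 h1 n t (81 * KA) KB (mul_nonneg (by norm_num) KA_pos.le) KB_pos.le A hA0.le _ _ _
        (le_trans hN8 hn) htn hθ2 hθ4
        (by have r1 := recursion n t (le_trans hN8 hn) ht
            rw [← mul_assoc, ← mul_assoc, ← mul_assoc] at r1
            rw [← mul_assoc, ← mul_assoc, ← mul_assoc]
            linarith only [r1])
        (ih (n - 2) (by omega) (t - 2) (by omega))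
        (ih (n - 4) (by omega) (t - 4) (by omega)) (hN n hn)
    intro t htn
    rcases Nat.eq_zero_or_pos t with rfl | ht
    · have e3 := hpos 1 le_rfl (by omega)
      rw [mul_zero, pow_zero, mul_one]
      exact zero_step θ h0 h1 n A hA2 e3
    · have := hpos t ht htn
      have hX : 0 ≤ A * 2 ^ Tr n * θ ^ (n * t) := by positivity
      linarith

lemma Tr_le (k m : ℕ) : Tr (k + m) ≤ (k + m) * m + Tr k := by
  induction m with
  | zero => simp
  | succ m ih =>
    rw [← add_assoc, Tr_succ]
    nlinarith

lemma ncard_Ys (n t : ℕ) : {G ∈ obtfSet n | t ≤ G.kappa}.ncard = (Ys n t).card := by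
  rw [← Set.ncard_coe_finset]
  congr 1
  ext G
  simp [Ys, obtfSet]

lemma Fnum_ge (k : ℕ) : (2 : ℝ) ^ Tr k / 4 ≤ Fnum k := by
  refine (Bs_lower k).trans ?_
  unfold Fnum
  have h : (Bs k).card ≤ (obtfSet k).ncard := by
    rw [← Set.ncard_coe_finset]
    apply Set.ncard_le_ncard _ (Set.toFinite _)
    intro G hG
    simp only [Bs, coe_filter, mem_univ, true_and, Set.mem_ofPred_eq] at hG
    exact bb_obtf G hG
  exact_mod_cast h

end Helpers

/-- Theorem 3.1 (main technical result): with `s = ⌈C log₂ n⌉`, for large `n` and any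
`1 ≤ t ≤ s`, the number of OBTF graphs with `κ(G) ≥ t` is less than
`2^{(1-c)sn} F(n-s) + 2^{(1-c)n⌈t/3⌉} F(n-⌈t/3⌉)`. -/
theorem few_far_from_blue_bipartite :
    ∃ C : ℝ, 0 < C ∧ ∃ c : ℝ, 0 < c ∧ ∃ N : ℕ, ∀ n : ℕ, N ≤ n →
      ∀ t : ℕ, 1 ≤ t → t ≤ ⌈C * Real.logb 2 n⌉₊ →
        ({G ∈ obtfSet n | t ≤ G.kappa}.ncard : ℝ) <
          (2 : ℝ) ^ ((1 - c) * (⌈C * Real.logb 2 n⌉₊ : ℝ) * n) *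
              Fnum (n - ⌈C * Real.logb 2 n⌉₊) +
            (2 : ℝ) ^ ((1 - c) * n * (⌈(t : ℝ) / 3⌉₊ : ℝ)) * Fnum (n - ⌈(t : ℝ) / 3⌉₊) := by
  obtain ⟨A, hA, hmain⟩ := main_ind (0.9999 ^ 2) (by norm_num) (by norm_num) (by norm_num)
    (by norm_num)
  set ρ : ℝ := 0.9999 with hρ
  have hρ0 : 0 < ρ := by norm_num [hρ]
  have hρ1 : ρ < 1 := by norm_num [hρ]
  have hev : ∃ N : ℕ, ∀ n : ℕ, N ≤ n → 4 * A * ρ ^ n < 1 := by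
    have t1 := (tendsto_pow_atTop_nhds_zero_of_lt_one hρ0.le hρ1).const_mul (4 * A)
    rw [mul_zero] at t1
    exact eventually_atTop.1 (t1.eventually (gt_mem_nhds one_pos))
  obtain ⟨N, hN⟩ := hev
  refine ⟨1, one_pos, - Real.logb 2 ρ, ?_, max N 1, ?_⟩
  · rw [neg_pos]
    exact Real.logb_neg (by norm_num) hρ0 hρ1
  intro n hn t ht hts
  have hnN : N ≤ n := le_trans (le_max_left _ _) hn
  have hn1 : 1 ≤ n := le_trans (le_max_right _ _) hn
  have htn : t ≤ n := by
    refine hts.trans ?_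
    rw [Nat.ceil_le, one_mul, Real.logb_le_iff_le_rpow (by norm_num) (by exact_mod_cast hn1),
      Real.rpow_natCast]
    exact_mod_cast Nat.lt_two_pow_self.le
  set m := ⌈(t : ℝ) / 3⌉₊ with hm
  have hmt : m ≤ t := by
    rw [hm, Nat.ceil_le]
    have : (0 : ℝ) ≤ t := Nat.cast_nonneg t
    linarith
  have hfirst : (0 : ℝ) ≤ (2 : ℝ) ^ ((1 - -Real.logb 2 ρ) * (⌈1 * Real.logb 2 n⌉₊ : ℝ) * n) *
              Fnum (n - ⌈1 * Real.logb 2 n⌉₊) := by positivity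
  have hpow : (2 : ℝ) ^ ((1 - -Real.logb 2 ρ) * n * (m : ℝ)) = 2 ^ (n * m) * ρ ^ (n * m) := by
    have : (1 - -Real.logb 2 ρ) * n * (m : ℝ) = ((n * m : ℕ) : ℝ) + Real.logb 2 ρ * ((n * m : ℕ) : ℝ) := by
      push_cast; ring
    rw [this, Real.rpow_add (by norm_num), Real.rpow_natCast, Real.rpow_mul (by norm_num),
      Real.rpow_logb (by norm_num) (by norm_num) hρ0, Real.rpow_natCast]
  rw [ncard_Ys, hpow]
  have h1 := hmain n t htn
  have hF := Fnum_ge (n - m)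
  have hT : (2 : ℝ) ^ Tr n ≤ 2 ^ (n * m) * 2 ^ Tr (n - m) := by
    rw [← pow_add]
    apply pow_le_pow_right₀ (by norm_num)
    have := Tr_le (n - m) m
    rwa [Nat.sub_add_cancel (by omega)] at this
  have hlt : 4 * A * ρ ^ (n * t) < 1 := by
    refine lt_of_le_of_lt ?_ (hN n hnN)
    refine mul_le_mul_of_nonneg_left ?_ (by positivity)
    exact pow_le_pow_of_le_one hρ0.le hρ1.le (Nat.le_mul_of_pos_right n ht)
  have hle : ρ ^ (n * t) ≤ ρ ^ (n * m) :=
    pow_le_pow_of_le_one hρ0.le hρ1.le (Nat.mul_le_mul_left _ hmt)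
  have hP : 0 < ρ ^ (n * t) := by positivity
  refine lt_of_le_of_lt h1 (lt_of_lt_of_le ?_ (le_add_of_nonneg_left hfirst))
  calc A * 2 ^ Tr n * (ρ ^ 2) ^ (n * t)
      = (4 * A * ρ ^ (n * t)) * ρ ^ (n * t) * (2 ^ Tr n / 4) := by
        rw [← pow_mul, mul_comm 2 (n * t), pow_mul]; ring
    _ < 1 * ρ ^ (n * t) * (2 ^ Tr n / 4) := by
        refine mul_lt_mul_of_pos_right ?_ (by positivity)
        exact mul_lt_mul_of_pos_right hlt hP
    _ ≤ 1 * ρ ^ (n * m) * (2 ^ (n * m) * 2 ^ Tr (n - m) / 4) := by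
        gcongr
    _ = 2 ^ (n * m) * ρ ^ (n * m) * (2 ^ Tr (n - m) / 4) := by ring
    _ ≤ _ := mul_le_mul_of_nonneg_left hF (by positivity)
end
end
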